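/- arXiv:1508.04353 — 2 statements merged into one kernel-verified Lean document; each statement's English description precedes it below -/
import Mathlib

section
/- Let k be an algebraically closed field and Q a strongly locally finite quiver. Let M₁, …, M_{n+1} be indecomposable representations in rep(Q) and f_i : M_{i+1} → M_i irreducible morphisms for 1 ≤ i ≤ n. Then the composition h = f₁ ∘ f₂ ∘ ⋯ ∘ f_n : M_{n+1} → M₁ has finitely co-presented kernel and finitely presented cokernel. -/
open CategoryTheory CategoryTheory.Limits

namespace Paper

variable (k : Type) [Field k]

section General

variable (A : Type) [Category.{0} A] [Preadditive A] [CategoryTheory.Linear k A]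

/-- A spectroid over `k`: a (small) Hom-finite `k`-linear category in which every object
has a local endomorphism ring and distinct objects are not isomorphic. -/
class Spectroid : Prop where
  homFinite : ∀ a b : A, FiniteDimensional k (a ⟶ b)
  localEnd : ∀ a : A, IsLocalRing (End a)
  skeletal : ∀ a b : A, (a ≅ b) → a = b

variable {A}

/-- `M` is a module over `A`, i.e. the functor `M : A ⥤ ModuleCat k` is additive and
`k`-linear on morphisms. -/
def IsMod (M : A ⥤ ModuleCat.{0} k) : Prop :=
  (∀ {a b : A} (f g : a ⟶ b), M.map (f + g) = M.map f + M.map g) ∧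
  (∀ {a b : A} (r : k) (f : a ⟶ b), M.map (r • f) = r • M.map f)

/-- `M` is a locally finite dimensional module over `A`, i.e. an object of `mod A`. -/
def IsLfdMod (M : A ⥤ ModuleCat.{0} k) : Prop :=
  IsMod k M ∧ ∀ a : A, FiniteDimensional k (M.obj a)

/-- The projective module `P_a = Hom_A(a, -)` at an object `a`. -/
noncomputable def ProjAt (a : A) : A ⥤ ModuleCat.{0} k :=
  (linearCoyoneda k A).obj (Opposite.op a)

/-- The injective module `I_a = D Hom_A(-, a)` at an object `a`. -/
noncomputable def InjAt (a : A) : A ⥤ ModuleCat.{0} k where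
  obj b := ModuleCat.of k (Module.Dual k (b ⟶ a))
  map {b c} f := ModuleCat.ofHom (LinearMap.dualMap (Linear.leftComp k a f))
  map_id b := by
    have h : Linear.leftComp k a (𝟙 b) = LinearMap.id := by
      apply LinearMap.ext; intro g; simp
    rw [h, LinearMap.dualMap_id]; rfl
  map_comp {b c d} f g := by
    have h : Linear.leftComp k a (f ≫ g) =
        (Linear.leftComp k a f).comp (Linear.leftComp k a g) := by
      apply LinearMap.ext; intro h; simp
    rw [h]; rfl

instance : HasFiniteBiproducts (A ⥤ ModuleCat.{0} k) :=
  CategoryTheory.Abelian.hasFiniteBiproducts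

/-- `M` is finitely generated: there is an epimorphism `⊕_{i=1}^r P_{a_i} → M`. -/
def IsFG (M : A ⥤ ModuleCat.{0} k) : Prop :=
  ∃ (r : ℕ) (a : Fin r → A) (f : (⨁ fun i => ProjAt k (a i)) ⟶ M), Epi f

/-- `M` is finitely presented: there is an epimorphism `⊕_{i=1}^r P_{a_i} → M` with
finitely generated kernel. -/
def IsFP (M : A ⥤ ModuleCat.{0} k) : Prop :=
  ∃ (r : ℕ) (a : Fin r → A) (f : (⨁ fun i => ProjAt k (a i)) ⟶ M),
    Epi f ∧ IsFG k (kernel f)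

/-- `M` is finitely co-generated: there is a monomorphism `M → ⊕_{j=1}^s I_{b_j}`. -/
def IsFCG (M : A ⥤ ModuleCat.{0} k) : Prop :=
  ∃ (s : ℕ) (b : Fin s → A) (f : M ⟶ ⨁ fun j => InjAt k (b j)), Mono f

/-- `M` is finitely co-presented: there is a monomorphism `M → ⊕_{j=1}^s I_{b_j}` with
finitely co-generated cokernel. -/
def IsFCP (M : A ⥤ ModuleCat.{0} k) : Prop :=
  ∃ (s : ℕ) (b : Fin s → A) (f : M ⟶ ⨁ fun j => InjAt k (b j)),
    Mono f ∧ IsFCG k (cokernel f)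

/-- `f` is an irreducible morphism in `mod A`: it is neither a split mono nor a split epi,
and in any factorization `f = g ≫ h` through an object of `mod A`, `g` is a split mono
or `h` is a split epi. -/
def Irred {L M : A ⥤ ModuleCat.{0} k} (f : L ⟶ M) : Prop :=
  ¬ IsSplitMono f ∧ ¬ IsSplitEpi f ∧
    ∀ ⦃X : A ⥤ ModuleCat.{0} k⦄, IsLfdMod k X →
      ∀ (g : L ⟶ X) (h : X ⟶ M), g ≫ h = f → IsSplitMono g ∨ IsSplitEpi h

/-- `M` is an indecomposable object of `mod A`: it is nonzero, and whenever `M ≅ X ⊞ Y`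
with `X`, `Y` in `mod A`, one of `X`, `Y` is zero. -/
def Indec (M : A ⥤ ModuleCat.{0} k) : Prop :=
  ¬ IsZero M ∧ ∀ ⦃X Y : A ⥤ ModuleCat.{0} k⦄, IsLfdMod k X → IsLfdMod k Y →
    (M ≅ X ⊞ Y) → IsZero X ∨ IsZero Y

/-- `0 → L →f M →g N → 0` is an almost split sequence in `mod A`. -/
structure AlmostSplitSeq {L M N : A ⥤ ModuleCat.{0} k} (f : L ⟶ M) (g : M ⟶ N) : Prop where
  mono : Mono f
  epi : Epi g
  zero : f ≫ g = 0
  exact : (ShortComplex.mk f g zero).Exact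
  not_splitMono : ¬ IsSplitMono f
  not_splitEpi : ¬ IsSplitEpi g
  left_almost_split : ∀ ⦃X : A ⥤ ModuleCat.{0} k⦄, IsLfdMod k X →
    ∀ u : L ⟶ X, ¬ IsSplitMono u → ∃ v : M ⟶ X, f ≫ v = u
  right_almost_split : ∀ ⦃X : A ⥤ ModuleCat.{0} k⦄, IsLfdMod k X →
    ∀ u : X ⟶ N, ¬ IsSplitEpi u → ∃ v : X ⟶ M, v ≫ g = u

/-- `M` is projective as an object of `mod A`. -/
def ProjInMod (M : A ⥤ ModuleCat.{0} k) : Prop :=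
  ∀ ⦃X Y : A ⥤ ModuleCat.{0} k⦄, IsLfdMod k X → IsLfdMod k Y →
    ∀ (e : X ⟶ Y), Epi e → ∀ u : M ⟶ Y, ∃ t : M ⟶ X, t ≫ e = u

/-- `M` is injective as an object of `mod A`. -/
def InjInMod (M : A ⥤ ModuleCat.{0} k) : Prop :=
  ∀ ⦃X Y : A ⥤ ModuleCat.{0} k⦄, IsLfdMod k X → IsLfdMod k Y →
    ∀ (m : X ⟶ Y), Mono m → ∀ u : X ⟶ M, ∃ t : Y ⟶ M, m ≫ t = u

/-- `h` is a (nonempty) composition of irreducible morphisms between indecomposable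
objects of `mod A`. -/
inductive IrredChain : ∀ {X Y : A ⥤ ModuleCat.{0} k}, (X ⟶ Y) → Prop
  | single {X Y : A ⥤ ModuleCat.{0} k} (f : X ⟶ Y) :
      IsLfdMod k X → Indec k X → IsLfdMod k Y → Indec k Y → Irred k f → IrredChain f
  | comp {X Y Z : A ⥤ ModuleCat.{0} k} (f : X ⟶ Y) (g : Y ⟶ Z) :
      IsLfdMod k X → Indec k X → Irred k f → IrredChain g → IrredChain (f ≫ g)

end General

section QuiverSection

variable (Q : Type) [Quiver.{0} Q]

/-- `Q` is locally finite: every vertex is the source of finitely many arrows and the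
target of finitely many arrows. -/
def LocallyFinite : Prop :=
  ∀ x : Q, Finite (Σ y : Q, x ⟶ y) ∧ Finite (Σ y : Q, y ⟶ x)

/-- `Q` is interval finite: there are finitely many paths between any two vertices. -/
def IntervalFinite : Prop :=
  ∀ x y : Q, Finite (Quiver.Path x y)

/-- `Q` is strongly locally finite: locally finite and interval finite. -/
def StronglyLocallyFinite : Prop :=
  LocallyFinite Q ∧ IntervalFinite Q

/-- `Q` is connected: nonempty, and any two vertices are joined by a walk. -/
def QuiverConnected : Prop :=
  Nonempty Q ∧ ∀ x y : Q,
    Nonempty (Quiver.Path (Quiver.Symmetrify.of.obj x) (Quiver.Symmetrify.of.obj y))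

/-- The path category `kQ` of the quiver `Q`: the free `k`-linear category on the free
category on `Q`. -/
abbrev PathCat := CategoryTheory.Free k (Paths Q)

/-- A vertex of `Q`, seen as an object of the path category `kQ`. -/
noncomputable def vtx (x : Q) : PathCat k Q :=
  (Free.embedding k (Paths Q)).obj ((Paths.of Q).obj x)

/-- An arrow of `Q`, seen as a morphism of the path category `kQ`. -/
noncomputable def arrHom {x y : Q} (α : x ⟶ y) : vtx k Q x ⟶ vtx k Q y :=
  (Free.embedding k (Paths Q)).map ((Paths.of Q).map α)

/-- The degree of a vertex of `Q`: the total number of arrows incident to it. -/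
noncomputable def degree (x : Q) : ℕ :=
  Nat.card ((Σ y : Q, x ⟶ y) ⊕ (Σ y : Q, y ⟶ x))

/-- `M` belongs to `rrep(Q)`: it is the middle term of a short exact sequence
`0 → L → M → N → 0` with `L` finitely presented, `N` finitely co-presented, and only
finitely many arrows `α` of `Q` satisfy `M(α) ≠ 0`, `L(α) = 0` and `N(α) = 0`. -/
def InRrep (M : PathCat k Q ⥤ ModuleCat.{0} k) : Prop :=
  ∃ (L N : PathCat k Q ⥤ ModuleCat.{0} k) (f : L ⟶ M) (g : M ⟶ N) (zero : f ≫ g = 0),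
    Mono f ∧ Epi g ∧ (ShortComplex.mk f g zero).Exact ∧ IsFP k L ∧ IsFCP k N ∧
    Set.Finite {p : Σ (x : Q) (y : Q), x ⟶ y |
      M.map (arrHom k Q p.2.2) ≠ 0 ∧ L.map (arrHom k Q p.2.2) = 0 ∧
      N.map (arrHom k Q p.2.2) = 0}

variable {Q}

/-- The vertices occurring in a path. -/
def InPath {x : Q} : ∀ {y : Q}, Quiver.Path x y → Q → Prop
  | _, Quiver.Path.nil, v => v = x
  | _, @Quiver.Path.cons _ _ _ _ c p _, v => v = c ∨ InPath p v

variable (Q)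

/-- `Q` is a star quiver: it is obtained from a finite full convex subquiver `Γ` by
attaching finitely many rays and co-rays with no common vertices. -/
def IsStarQuiver : Prop :=
  ∃ (Γ S₁ S₂ : Set Q) (v : Q → ℕ → Q),
    Γ.Finite ∧ S₁ ⊆ Γ ∧ S₂ ⊆ Γ ∧ Disjoint S₁ S₂ ∧
    (∀ x y : Q, x ∈ Γ → y ∈ Γ → ∀ p : Quiver.Path x y, ∀ z : Q, InPath p z → z ∈ Γ) ∧
    (∀ s ∈ S₁ ∪ S₂, ∀ i : ℕ, v s i ∉ Γ) ∧
    (∀ s ∈ S₁ ∪ S₂, ∀ t ∈ S₁ ∪ S₂, ∀ i j : ℕ, v s i = v t j → s = t ∧ i = j) ∧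
    (∀ x : Q, x ∉ Γ → ∃ s ∈ S₁ ∪ S₂, ∃ i : ℕ, x = v s i) ∧
    (∀ s ∈ S₁, Nat.card (s ⟶ v s 0) = 1 ∧ ∀ i : ℕ, Nat.card (v s i ⟶ v s (i + 1)) = 1) ∧
    (∀ s ∈ S₂, Nat.card (v s 0 ⟶ s) = 1 ∧ ∀ i : ℕ, Nat.card (v s (i + 1) ⟶ v s i) = 1) ∧
    (∀ x y : Q, (x ⟶ y) → ¬(x ∈ Γ ∧ y ∈ Γ) →
      (∃ s ∈ S₁, (x = s ∧ y = v s 0) ∨ ∃ i : ℕ, x = v s i ∧ y = v s (i + 1)) ∨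
      (∃ s ∈ S₂, (x = v s 0 ∧ y = s) ∨ ∃ i : ℕ, x = v s (i + 1) ∧ y = v s i))

end QuiverSection

section Modules

set_option linter.unusedSectionVars false

variable {k} {A : Type} [Category.{0} A]

/-- The action of a morphism of `A` on a module over `A`. -/
def act (M : A ⥤ ModuleCat.{0} k) {x y : A} (f : x ⟶ y) : M.obj x →ₗ[k] M.obj y :=
  (M.map f).hom

/-- The component of a morphism of modules, as a linear map. -/
def ap {M N : A ⥤ ModuleCat.{0} k} (t : M ⟶ N) (x : A) : M.obj x →ₗ[k] N.obj x :=
  (t.app x).hom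

section Basic

variable {M N L : A ⥤ ModuleCat.{0} k}

@[simp] theorem act_id (x : A) (v : M.obj x) : act M (𝟙 x) v = v := by simp [act]

theorem act_comp {x y z : A} (f : x ⟶ y) (g : y ⟶ z) (v : M.obj x) :
    act M (f ≫ g) v = act M g (act M f v) := by simp [act]

@[simp] theorem ap_id (x : A) (v : M.obj x) : ap (𝟙 M) x v = v := by simp [ap]

@[simp] theorem ap_comp (s : M ⟶ N) (t : N ⟶ L) (x : A) (v : M.obj x) :
    ap (s ≫ t) x v = ap t x (ap s x v) := by simp [ap]

@[simp] theorem ap_zero (x : A) (v : M.obj x) : ap (0 : M ⟶ N) x v = 0 := by simp [ap]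

@[simp] theorem ap_add (s t : M ⟶ N) (x : A) (v : M.obj x) :
    ap (s + t) x v = ap s x v + ap t x v := by simp [ap]

@[simp] theorem ap_sub (s t : M ⟶ N) (x : A) (v : M.obj x) :
    ap (s - t) x v = ap s x v - ap t x v := by simp [ap]

theorem ap_act (t : M ⟶ N) {x y : A} (f : x ⟶ y) (v : M.obj x) :
    ap t y (act M f v) = act N f (ap t x v) := by
  have h := t.naturality f
  exact congrArg (fun u => u.hom v) h

theorem hom_ext' {s t : M ⟶ N} (h : ∀ x v, ap s x v = ap t x v) : s = t := by
  ext x v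
  exact h x v

/-- A morphism of modules from a compatible family of linear maps. -/
def mkHom (φ : ∀ x, M.obj x →ₗ[k] N.obj x)
    (h : ∀ {x y : A} (f : x ⟶ y) (v : M.obj x), φ y (act M f v) = act N f (φ x v)) : M ⟶ N where
  app x := ModuleCat.ofHom (φ x)
  naturality {x y} f := by
    ext v
    exact h f v

@[simp] theorem ap_mkHom (φ : ∀ x, M.obj x →ₗ[k] N.obj x)
    (h : ∀ {x y : A} (f : x ⟶ y) (v : M.obj x), φ y (act M f v) = act N f (φ x v))
    (x : A) (v : M.obj x) : ap (mkHom φ h) x v = φ x v := rfl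

/-- A functor to modules from a family of vector spaces with a functorial action. -/
def mkFun (V : A → Type) [∀ x, AddCommGroup (V x)] [∀ x, Module k (V x)]
    (a : ∀ {x y : A}, (x ⟶ y) → V x →ₗ[k] V y) (hid : ∀ x v, a (𝟙 x) v = v)
    (hcomp : ∀ {x y z : A} (f : x ⟶ y) (g : y ⟶ z) v, a (f ≫ g) v = a g (a f v)) :
    A ⥤ ModuleCat.{0} k where
  obj x := ModuleCat.of k (V x)
  map f := ModuleCat.ofHom (a f)
  map_id x := by ext v; exact hid x v
  map_comp f g := by ext v; exact hcomp f g v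

theorem mono_of_injective (t : M ⟶ N) (h : ∀ x, Function.Injective (ap t x)) : Mono t := by
  have : ∀ x, Mono (t.app x) := fun x => (ModuleCat.mono_iff_injective _).mpr (h x)
  exact NatTrans.mono_of_mono_app t

theorem epi_of_surjective (t : M ⟶ N) (h : ∀ x, Function.Surjective (ap t x)) : Epi t := by
  have : ∀ x, Epi (t.app x) := fun x => (ModuleCat.epi_iff_surjective _).mpr (h x)
  exact NatTrans.epi_of_epi_app t

theorem injective_of_mono (t : M ⟶ N) [Mono t] (x : A) : Function.Injective (ap t x) :=
  (ModuleCat.mono_iff_injective (t.app x)).mp inferInstance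

theorem surjective_of_epi (t : M ⟶ N) [Epi t] (x : A) : Function.Surjective (ap t x) :=
  (ModuleCat.epi_iff_surjective (t.app x)).mp inferInstance

/-- A morphism `θ` that vanishes on the kernel of `h` induces a morphism on every module
mapping into the image of `h`. -/
theorem exists_factor {F N' : A ⥤ ModuleCat.{0} k} (h : N ⟶ F) (θ : N ⟶ N') (g : L ⟶ F)
    (hθ : ∀ x v, ap h x v = 0 → ap θ x v = 0)
    (hg : ∀ x l, ∃ n, ap h x n = ap g x l) :
    ∃ t : L ⟶ N', ∀ x l n, ap g x l = ap h x n → ap t x l = ap θ x n := by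
  have key : ∀ x n n', ap h x n = ap h x n' → ap θ x n = ap θ x n' := by
    intro x n n' e
    rw [← sub_eq_zero, ← map_sub]
    exact hθ x _ (by rw [map_sub, e, sub_self])
  choose c hc using hg
  have hlin : ∀ x l n, ap g x l = ap h x n → ap θ x (c x l) = ap θ x n := by
    intro x l n e
    exact key x _ _ (by rw [hc, e])
  refine ⟨mkHom (fun x =>
    { toFun := fun l => ap θ x (c x l)
      map_add' := ?_
      map_smul' := ?_ }) ?_, ?_⟩
  · intro l l'
    rw [hlin x (l + l') (c x l + c x l') (by simp [hc]), map_add]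
  · intro r l
    rw [hlin x (r • l) (r • c x l) (by simp [hc]), map_smul, RingHom.id_apply]
  · intro x y f v
    change ap θ y (c y (act L f v)) = act N' f (ap θ x (c x v))
    rw [hlin y _ (act N f (c x v)) (by rw [ap_act, ap_act, hc]), ap_act]
  · intro x l n e
    exact hlin x l n e

end Basic

/-- A family of submodules stable under the action. -/
structure Sub (M : A ⥤ ModuleCat.{0} k) where
  /-- The underlying family of subspaces. -/
  car : ∀ x, Submodule k (M.obj x)
  act_mem : ∀ {x y : A} (f : x ⟶ y) (v : M.obj x), v ∈ car x → act M f v ∈ car y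

namespace Sub

variable {M N : A ⥤ ModuleCat.{0} k}

/-- A submodule, as a functor. -/
def toFun (K : Sub M) : A ⥤ ModuleCat.{0} k :=
  mkFun (fun x => K.car x) (fun f => (act M f).restrict (K.act_mem f))
    (fun x v => Subtype.ext (act_id x v.1))
    (fun f g v => Subtype.ext (act_comp f g v.1))

/-- The inclusion of a submodule. -/
def incl (K : Sub M) : K.toFun ⟶ M :=
  mkHom (fun x => (K.car x).subtype) (fun _ _ => rfl)

theorem incl_injective (K : Sub M) (x : A) : Function.Injective (ap K.incl x) :=
  Subtype.val_injective

theorem incl_mem (K : Sub M) {x : A} (v : K.toFun.obj x) : ap K.incl x v ∈ K.car x := v.2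

theorem exists_incl (K : Sub M) {x : A} {v : M.obj x} (h : v ∈ K.car x) :
    ∃ w : K.toFun.obj x, ap K.incl x w = v := ⟨⟨v, h⟩, rfl⟩

/-- The corestriction of a morphism to a submodule of the target. -/
def lift (K : Sub M) (t : N ⟶ M) (h : ∀ x v, ap t x v ∈ K.car x) : N ⟶ K.toFun :=
  mkHom (fun x => (ap t x).codRestrict (K.car x) (h x))
    (fun f v => Subtype.ext (ap_act t f v))

/-- The quotient by a submodule, as a functor. -/
def quot (K : Sub M) : A ⥤ ModuleCat.{0} k :=
  mkFun (fun x => M.obj x ⧸ K.car x)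
    (fun {x y} f => (K.car x).mapQ (K.car y) (act M f) (fun v hv => K.act_mem f v hv))
    (fun x v => by
      induction v using Submodule.Quotient.induction_on with
      | H v => rw [Submodule.mapQ_apply, act_id])
    (fun f g v => by
      induction v using Submodule.Quotient.induction_on with
      | H v => simp only [Submodule.mapQ_apply, act_comp])

/-- The projection to the quotient. -/
def proj (K : Sub M) : M ⟶ K.quot :=
  mkHom (fun x => (K.car x).mkQ) (fun _ _ => rfl)

theorem proj_surjective (K : Sub M) (x : A) : Function.Surjective (ap K.proj x) :=
  Submodule.Quotient.mk_surjective _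

theorem proj_eq_zero (K : Sub M) {x : A} {v : M.obj x} : ap K.proj x v = 0 ↔ v ∈ K.car x :=
  Submodule.Quotient.mk_eq_zero _

/-- The kernel of a morphism. -/
def ker (t : M ⟶ N) : Sub M where
  car x := LinearMap.ker (ap t x)
  act_mem f v hv := by
    rw [LinearMap.mem_ker] at hv ⊢
    rw [ap_act, hv, map_zero]

/-- The image of a morphism. -/
def range (t : M ⟶ N) : Sub N where
  car x := LinearMap.range (ap t x)
  act_mem f v hv := by
    obtain ⟨u, rfl⟩ := hv
    exact ⟨act M f u, ap_act t f u⟩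

theorem mem_ker {t : M ⟶ N} {x : A} {v : M.obj x} : v ∈ (ker t).car x ↔ ap t x v = 0 := Iff.rfl

theorem mem_range {t : M ⟶ N} {x : A} {v : N.obj x} :
    v ∈ (range t).car x ↔ ∃ u, ap t x u = v := Iff.rfl

end Sub

section Additive

variable [Preadditive A] [CategoryTheory.Linear k A] {M N : A ⥤ ModuleCat.{0} k}

theorem IsMod.act_add (h : IsMod k M) {x y : A} (f g : x ⟶ y) (v : M.obj x) :
    act M (f + g) v = act M f v + act M g v := by
  simp [act, h.1]

theorem IsMod.act_smul (h : IsMod k M) {x y : A} (r : k) (f : x ⟶ y) (v : M.obj x) :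
    act M (r • f) v = r • act M f v := by
  simp [act, h.2]

theorem isMod_of_act (h₁ : ∀ {x y : A} (f g : x ⟶ y) v, act M (f + g) v = act M f v + act M g v)
    (h₂ : ∀ {x y : A} (r : k) (f : x ⟶ y) v, act M (r • f) v = r • act M f v) : IsMod k M :=
  ⟨fun f g => by ext v; exact h₁ f g v, fun r f => by ext v; exact h₂ r f v⟩

theorem IsMod.of_injective (h : IsMod k N) (t : M ⟶ N) (ht : ∀ x, Function.Injective (ap t x)) :
    IsMod k M :=
  isMod_of_act (fun f g v => ht _ (by simp only [map_add, ap_act, h.act_add]))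
    (fun r f v => ht _ (by simp only [map_smul, ap_act, h.act_smul]))

theorem IsMod.of_surjective (h : IsMod k M) (t : M ⟶ N) (ht : ∀ x, Function.Surjective (ap t x)) :
    IsMod k N := by
  refine isMod_of_act (fun f g v => ?_) (fun r f v => ?_) <;> obtain ⟨u, rfl⟩ := ht _ v
  · simp only [← ap_act, h.act_add, map_add]
  · simp only [← ap_act, h.act_smul, map_smul]

theorem IsLfdMod.of_injective (h : IsLfdMod k N) (t : M ⟶ N)
    (ht : ∀ x, Function.Injective (ap t x)) : IsLfdMod k M :=
  ⟨h.1.of_injective t ht, fun x => by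
    have := h.2 x
    exact FiniteDimensional.of_injective (ap t x) (ht x)⟩

theorem IsLfdMod.of_surjective (h : IsLfdMod k M) (t : M ⟶ N)
    (ht : ∀ x, Function.Surjective (ap t x)) : IsLfdMod k N :=
  ⟨h.1.of_surjective t ht, fun x => by
    have := h.2 x
    exact Module.Finite.of_surjective (ap t x) (ht x)⟩

/-- The action as a linear map in the morphism. -/
def IsMod.actLin (h : IsMod k M) {x y : A} (v : M.obj x) : (x ⟶ y) →ₗ[k] M.obj y where
  toFun f := act M f v
  map_add' f g := h.act_add f g v
  map_smul' r f := h.act_smul r f v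

theorem IsMod.actLin_apply (h : IsMod k M) {x y : A} (v : M.obj x) (f : x ⟶ y) :
    h.actLin v f = act M f v := rfl

theorem IsMod.act_zero (h : IsMod k M) {x y : A} (v : M.obj x) :
    act M (0 : x ⟶ y) v = 0 := (h.actLin v).map_zero

theorem IsMod.act_neg (h : IsMod k M) {x y : A} (f : x ⟶ y) (v : M.obj x) :
    act M (-f) v = - act M f v := (h.actLin v).map_neg f

theorem IsMod.act_sub (h : IsMod k M) {x y : A} (f g : x ⟶ y) (v : M.obj x) :
    act M (f - g) v = act M f v - act M g v := (h.actLin v).map_sub f g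

theorem IsMod.act_sum (h : IsMod k M) {x y : A} {ι : Type} (s : Finset ι) (f : ι → (x ⟶ y))
    (v : M.obj x) : act M (∑ i ∈ s, f i) v = ∑ i ∈ s, act M (f i) v :=
  map_sum (h.actLin v) f s

/-! ### Free modules -/

open Classical in
/-- The free module on a family of objects, the direct sum of the `Hom_A(a i, -)`. -/
noncomputable def free {ι : Type} (a : ι → A) : A ⥤ ModuleCat.{0} k :=
  mkFun (fun x => Π₀ i, (a i ⟶ x))
    (fun {x y} f => DFinsupp.mapRange.linearMap (fun i => Linear.rightComp k (a i) f))
    (fun x v => by ext i; simp)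
    (fun f g v => by ext i; simp)

section Free

variable {ι : Type} (a : ι → A)

open Classical in
/-- The element of a free module given by a morphism out of one of the generating objects. -/
noncomputable def sgl (i : ι) (x : A) : (a i ⟶ x) →ₗ[k] (free (k := k) a).obj x :=
  DFinsupp.lsingle (R := k) (M := fun i => (a i ⟶ x)) i

/-- The coordinates of an element of a free module. -/
noncomputable def coord (x : A) (i : ι) : (free (k := k) a).obj x →ₗ[k] (a i ⟶ x) :=
  DFinsupp.lapply (R := k) (M := fun i => (a i ⟶ x)) i

variable {a}

theorem coord_sgl_self (x : A) (i : ι) (f : a i ⟶ x) :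
    coord (k := k) a x i (sgl a i x f) = f := by
  classical
  exact DFinsupp.single_eq_same (β := fun i => (a i ⟶ x))

theorem coord_sgl_of_ne {x : A} {i j : ι} (h : i ≠ j) (f : a i ⟶ x) :
    coord (k := k) a x j (sgl a i x f) = 0 := by
  classical
  exact DFinsupp.single_eq_of_ne (β := fun i => (a i ⟶ x)) h.symm

theorem free_ext {x : A} {v w : (free (k := k) a).obj x}
    (h : ∀ i, coord a x i v = coord a x i w) : v = w :=
  DFinsupp.ext h

theorem coord_act {x y : A} (f : x ⟶ y) (v : (free (k := k) a).obj x) (i : ι) :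
    coord a y i (act (free a) f v) = coord a x i v ≫ f := rfl

theorem act_sgl {x y : A} (i : ι) (g : a i ⟶ x) (f : x ⟶ y) :
    act (free (k := k) a) f (sgl a i x g) = sgl a i y (g ≫ f) := by
  classical
  exact DFinsupp.mapRange_single (f := fun i => ⇑(Linear.rightComp k (a i) f))
    (hf := fun i => map_zero _)

theorem isMod_free : IsMod k (free (k := k) a) :=
  isMod_of_act (fun f g v => free_ext fun i => by simp [coord_act])
    (fun r f v => free_ext fun i => by simp [coord_act])

theorem exists_eq_sum {x : A} (v : (free (k := k) a).obj x) :
    ∃ s : Finset ι, (∀ i ∉ s, coord a x i v = 0) ∧ v = ∑ i ∈ s, sgl a i x (coord a x i v) := by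
  classical
  refine ⟨DFinsupp.support (β := fun i => (a i ⟶ x)) v,
    fun i hi => DFinsupp.notMem_support_iff.mp hi, ?_⟩
  exact (DFinsupp.sum_single (β := fun i => (a i ⟶ x)) (f := v)).symm

theorem eq_sum_of_coord {x : A} (v : (free (k := k) a).obj x) (s : Finset ι)
    (h : ∀ i ∉ s, coord a x i v = 0) : v = ∑ i ∈ s, sgl a i x (coord a x i v) := by
  obtain ⟨t, ht, e⟩ := exists_eq_sum v
  classical
  refine free_ext fun j => ?_
  rw [map_sum]
  by_cases hj : j ∈ s
  · rw [Finset.sum_eq_single j (fun i _ hi => coord_sgl_of_ne hi _) (fun h => absurd hj h),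
      coord_sgl_self]
  · rw [h j hj, Finset.sum_eq_zero]
    intro i hi
    exact coord_sgl_of_ne (fun e => hj (by rwa [← e])) _

open Classical in
/-- A linear map out of a free module, at a fixed object. -/
noncomputable def freeLin {x : A} {V : Type} [AddCommGroup V] [Module k V]
    (φ : ∀ i, (a i ⟶ x) →ₗ[k] V) : (free (k := k) a).obj x →ₗ[k] V :=
  DFinsupp.lsum k φ

theorem freeLin_sgl {x : A} {V : Type} [AddCommGroup V] [Module k V]
    (φ : ∀ i, (a i ⟶ x) →ₗ[k] V) (i : ι) (f : a i ⟶ x) :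
    freeLin φ (sgl a i x f) = φ i f := by
  classical
  exact DFinsupp.lsum_single ..

theorem free_lin_ext {x : A} {V : Type} [AddCommGroup V] [Module k V]
    {φ ψ : (free (k := k) a).obj x →ₗ[k] V}
    (h : ∀ i f, φ (sgl a i x f) = ψ (sgl a i x f)) (v : (free (k := k) a).obj x) :
    φ v = ψ v := by
  obtain ⟨s, -, e⟩ := exists_eq_sum v
  rw [e, map_sum, map_sum]
  exact Finset.sum_congr rfl fun i _ => h i _

/-- The morphism out of a free module determined by elements of a module. -/
noncomputable def desc (hM : IsMod k M) (m : ∀ i, M.obj (a i)) : free a ⟶ M :=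
  mkHom (fun _ => freeLin fun i => hM.actLin (m i)) (fun {x y} f v => by
    refine free_lin_ext (φ := (freeLin fun i => hM.actLin (m i)).comp (act (free a) f))
      (ψ := (act M f).comp (freeLin fun i => hM.actLin (m i))) (fun i g => ?_) v
    simp only [LinearMap.comp_apply, act_sgl, freeLin_sgl, hM.actLin_apply, act_comp])

theorem desc_sgl (hM : IsMod k M) (m : ∀ i, M.obj (a i)) (i : ι) {x : A} (f : a i ⟶ x) :
    ap (desc hM m) x (sgl a i x f) = act M f (m i) := freeLin_sgl _ _ _

theorem free_hom_ext {s t : free a ⟶ M}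
    (h : ∀ i, ap s _ (sgl a i _ (𝟙 (a i))) = ap t _ (sgl a i _ (𝟙 (a i)))) : s = t := by
  refine hom_ext' fun x v => free_lin_ext (fun i f => ?_) v
  have := act_sgl (k := k) i (𝟙 (a i)) f
  rw [Category.id_comp] at this
  rw [← this, ap_act, ap_act, h]

theorem desc_of_coord (hM : IsMod k M) (m : ∀ i, M.obj (a i)) {x : A} (v : (free a).obj x)
    (s : Finset ι) (h : ∀ i ∉ s, coord a x i v = 0) :
    ap (desc hM m) x v = ∑ i ∈ s, act M (coord a x i v) (m i) := by
  conv_lhs => rw [eq_sum_of_coord v s h]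
  simp only [map_sum, desc_sgl]

theorem desc_fintype [Fintype ι] (hM : IsMod k M) (m : ∀ i, M.obj (a i)) {x : A}
    (v : (free a).obj x) :
    ap (desc hM m) x v = ∑ i, act M (coord a x i v) (m i) :=
  desc_of_coord hM m v Finset.univ (by simp)

theorem exists_coord [Fintype ι] {x : A} (r : ∀ i, a i ⟶ x) :
    ∃ v : (free (k := k) a).obj x, ∀ i, coord a x i v = r i := by
  classical
  exact ⟨(DFinsupp.equivFunOnFintype (β := fun i => (a i ⟶ x))).symm r, fun i => rfl⟩

theorem isLfdMod_free [Finite ι] (hA : ∀ a b : A, FiniteDimensional k (a ⟶ b)) :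
    IsLfdMod k (free (k := k) a) := by
  refine ⟨isMod_free, fun x => ?_⟩
  exact FiniteDimensional.of_injective (LinearMap.pi fun i => coord (k := k) a x i)
    fun v w h => free_ext fun i => congrFun h i

/-- The projection of a free module which kills the coordinates in a set. -/
noncomputable def kill (s : Finset ι) : free (k := k) a ⟶ free (k := k) a :=
  open Classical in
  desc isMod_free fun i => if i ∈ s then 0 else sgl a i _ (𝟙 (a i))

theorem kill_eq_zero (s : Finset ι) {x : A} {v : (free (k := k) a).obj x} :
    ap (kill s) x v = 0 ↔ ∀ i ∉ s, coord a x i v = 0 := by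
  classical
  constructor
  · intro h i hi
    have key : ∀ w : (free (k := k) a).obj x, coord a x i (ap (kill s) x w) = coord a x i w := by
      refine free_lin_ext (φ := (coord a x i).comp (ap (kill s) x)) (ψ := coord a x i) ?_
      intro j f
      rw [LinearMap.comp_apply, kill, desc_sgl]
      by_cases hj : j ∈ s
      · rw [if_pos hj, map_zero, map_zero, coord_sgl_of_ne (fun e => hi (by rwa [← e]))]
      · rw [if_neg hj, act_sgl, Category.id_comp]
    rw [← key, h, map_zero]
  · intro h
    rw [kill, desc_of_coord _ _ v s h]
    exact Finset.sum_eq_zero fun i hi => by rw [if_pos hi, map_zero]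

end Free

/-! ### Lifting derivations -/

/-- A bimodule over `A`. -/
structure Bimod (k : Type) [Field k] (A : Type) [Category.{0} A] [Preadditive A]
    [CategoryTheory.Linear k A] where
  /-- The underlying vector spaces. -/
  V : A → A → Type
  [grp : ∀ x y, AddCommGroup (V x y)]
  [mod : ∀ x y, Module k (V x y)]
  /-- The covariant action. -/
  l : ∀ {x y z : A}, (y ⟶ z) →ₗ[k] V x y →ₗ[k] V x z
  /-- The contravariant action. -/
  r : ∀ {x y z : A}, (x ⟶ y) →ₗ[k] V y z →ₗ[k] V x z
  l_id : ∀ {x y : A} (v : V x y), l (𝟙 y) v = v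
  r_id : ∀ {x y : A} (v : V x y), r (𝟙 x) v = v
  l_comp : ∀ {w x y z : A} (f : x ⟶ y) (g : y ⟶ z) (v : V w x), l (f ≫ g) v = l g (l f v)
  r_comp : ∀ {w x y z : A} (f : w ⟶ x) (g : x ⟶ y) (v : V y z), r (f ≫ g) v = r f (r g v)
  l_r : ∀ {w x y z : A} (f : w ⟶ x) (g : y ⟶ z) (v : V x y), l g (r f v) = r f (l g v)

attribute [instance] Bimod.grp Bimod.mod

/-- A derivation of `A` with values in a bimodule. -/
structure Deriv (B : Bimod k A) where
  /-- The underlying linear maps. -/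
  d : ∀ {x y : A}, (x ⟶ y) →ₗ[k] B.V x y
  leibniz : ∀ {x y z : A} (f : x ⟶ y) (g : y ⟶ z), d (f ≫ g) = B.l g (d f) + B.r f (d g)

/-- Derivations lift along surjections of bimodules; this says that `A` is hereditary. -/
def LiftsDerivations (k : Type) [Field k] (A : Type) [Category.{0} A] [Preadditive A]
    [CategoryTheory.Linear k A] : Prop :=
  ∀ (B B' : Bimod k A) (q : ∀ {x y : A}, B.V x y →ₗ[k] B'.V x y),
    (∀ x y, Function.Surjective (q (x := x) (y := y))) →
    (∀ {x y z : A} (g : y ⟶ z) (v : B.V x y), q (B.l g v) = B'.l g (q v)) →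
    (∀ {x y z : A} (f : x ⟶ y) (v : B.V y z), q (B.r f v) = B'.r f (q v)) →
    ∀ D' : Deriv B', ∃ D : Deriv B, ∀ {x y : A} (f : x ⟶ y), q (D.d f) = D'.d f

/-- The bimodule of linear maps between the values of two modules. -/
def homBimod (hM : IsMod k M) (hN : IsMod k N) : Bimod k A where
  V x y := M.obj x →ₗ[k] N.obj y
  l := LinearMap.mk₂ k (fun f φ => (act N f).comp φ)
    (fun f g φ => LinearMap.ext fun v => hN.act_add f g (φ v))
    (fun r f φ => LinearMap.ext fun v => hN.act_smul r f (φ v))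
    (fun f φ ψ => LinearMap.ext fun v => map_add (act N f) _ _)
    (fun r f φ => LinearMap.ext fun v => map_smul (act N f) _ _)
  r := LinearMap.mk₂ k (fun f φ => φ.comp (act M f))
    (fun f g φ => LinearMap.ext fun v => by
      simp only [LinearMap.comp_apply, LinearMap.add_apply, hM.act_add, map_add])
    (fun r f φ => LinearMap.ext fun v => by
      simp only [LinearMap.comp_apply, LinearMap.smul_apply, hM.act_smul, map_smul])
    (fun f φ ψ => rfl)
    (fun r f φ => rfl)
  l_id φ := LinearMap.ext fun v => act_id _ _
  r_id φ := LinearMap.ext fun v => congrArg φ (act_id _ v)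
  l_comp f g φ := LinearMap.ext fun v => act_comp f g _
  r_comp f g φ := LinearMap.ext fun v => congrArg φ (act_comp f g v)
  l_r f g φ := rfl

/-- Modules embedded in a free module are projective. -/
theorem exists_section_of_free (hA : LiftsDerivations k A) {ι : Type} {a : ι → A}
    (hM : IsMod k M) (j : N ⟶ free a) (hj : ∀ x, Function.Injective (ap j x))
    (g : M ⟶ N) (hg : ∀ x, Function.Surjective (ap g x)) : ∃ s : N ⟶ M, s ≫ g = 𝟙 N := by
  have hN : IsMod k N := isMod_free.of_injective j hj
  let Z := (Sub.ker g).toFun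
  have hZ : IsMod k Z := hM.of_injective _ (Sub.ker g).incl_injective
  choose s₀ hs₀ using fun x => (ap g x).exists_rightInverse_of_surjective
    (LinearMap.range_eq_top.mpr (hg x))
  have hs : ∀ x n, ap g x (s₀ x n) = n := fun x n => LinearMap.congr_fun (hs₀ x) n
  have hθ : ∀ {x y : A} (f : x ⟶ y) (n : N.obj x),
      (act M f (s₀ x n) - s₀ y (act N f n)) ∈ (Sub.ker g).car y := by
    intro x y f n
    rw [Sub.mem_ker, map_sub, ap_act, hs, hs, sub_self]
  let D' : Deriv (homBimod hN hZ) :=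
    { d := fun {x y} =>
        { toFun := fun f => LinearMap.codRestrict ((Sub.ker g).car y)
            ((act M f).comp (s₀ x) - (s₀ y).comp (act N f)) (hθ f)
          map_add' := fun f f' => LinearMap.ext fun n => Subtype.ext <| by
            change act M (f + f') (s₀ x n) - s₀ y (act N (f + f') n) =
              (act M f (s₀ x n) - s₀ y (act N f n)) + (act M f' (s₀ x n) - s₀ y (act N f' n))
            rw [hM.act_add, hN.act_add, map_add]; abel
          map_smul' := fun r f => LinearMap.ext fun n => Subtype.ext <| by
            change act M (r • f) (s₀ x n) - s₀ y (act N (r • f) n) =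
              r • (act M f (s₀ x n) - s₀ y (act N f n))
            rw [hM.act_smul, hN.act_smul, map_smul, smul_sub] }
      leibniz := fun {x y z} f f' => LinearMap.ext fun n => Subtype.ext <| by
        change act M (f ≫ f') (s₀ x n) - s₀ z (act N (f ≫ f') n) =
          act M f' (act M f (s₀ x n) - s₀ y (act N f n)) +
          (act M f' (s₀ y (act N f n)) - s₀ z (act N f' (act N f n)))
        rw [act_comp, act_comp, map_sub]; abel }
  obtain ⟨D, hD⟩ := hA (homBimod isMod_free hZ) (homBimod hN hZ)
    (fun {x y} => LinearMap.lcomp k (Z.obj y) (ap j x))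
    (fun x y φ => by
      obtain ⟨u, hu⟩ := (ap j x).exists_leftInverse_of_injective
        (LinearMap.ker_eq_bot.mpr (hj x))
      refine ⟨LinearMap.comp (show N.obj x →ₗ[k] Z.obj y from φ) u, LinearMap.ext fun v => ?_⟩
      exact congrArg (show N.obj x →ₗ[k] Z.obj y from φ) (LinearMap.congr_fun hu v))
    (fun f φ => rfl)
    (fun {x y z} f φ => LinearMap.ext fun v =>
      congrArg (show (free a).obj y →ₗ[k] Z.obj z from φ) (ap_act j f v).symm) D'
  let dd : ∀ {x y : A}, (x ⟶ y) →ₗ[k] ((free a).obj x →ₗ[k] Z.obj y) := fun {x y} => D.d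
  have hdd : ∀ {x y : A} (f : x ⟶ y) (n : N.obj x),
      ap (Sub.ker g).incl y (dd f (ap j x n)) = act M f (s₀ x n) - s₀ y (act N f n) := by
    intro x y f n
    exact congrArg (fun φ : N.obj x →ₗ[k] Z.obj y => ap (Sub.ker g).incl y (φ n)) (hD f)
  have hleib : ∀ {x y z : A} (f : x ⟶ y) (f' : y ⟶ z) (v : (free a).obj x),
      dd (f ≫ f') v = act Z f' (dd f v) + dd f' (act (free a) f v) := by
    intro x y z f f' v
    exact LinearMap.congr_fun (D.leibniz f f') v
  let τ : ∀ x, (free a).obj x →ₗ[k] Z.obj x := fun x =>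
    freeLin fun i => (dd (x := a i) (y := x)).flip (sgl a i _ (𝟙 (a i)))
  have hτ : ∀ {x y : A} (f : x ⟶ y) (v : (free a).obj x),
      τ y (act (free a) f v) = act Z f (τ x v) + dd f v := by
    intro x y f v
    refine free_lin_ext (φ := (τ y).comp (act (free a) f))
      (ψ := (act Z f).comp (τ x) + dd f) (fun i p => ?_) v
    have e := act_sgl (k := k) i (𝟙 (a i)) p
    rw [Category.id_comp] at e
    simp only [LinearMap.comp_apply, LinearMap.add_apply, act_sgl, τ, freeLin_sgl,
      LinearMap.flip_apply, hleib, e]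
  refine ⟨mkHom (fun x => s₀ x + (ap (Sub.ker g).incl x).comp ((τ x).comp (ap j x))) ?_, ?_⟩
  · intro x y f n
    simp only [LinearMap.add_apply, LinearMap.comp_apply, ap_act, hτ, map_add, hdd]
    rw [← ap_act]
    abel
  · refine hom_ext' fun x n => ?_
    have h0 : ∀ z : Z.obj x, ap g x (ap (Sub.ker g).incl x z) = 0 := fun z => z.2
    rw [ap_comp, ap_mkHom, LinearMap.add_apply, map_add, hs, LinearMap.comp_apply, h0, add_zero,
      ap_id]

/-- A finite subset of a submodule of a free module is fixed by an idempotent endomorphism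
whose image is finitely generated. -/
theorem exists_idempotent_of_free (hA : LiftsDerivations k A) {ι : Type} {a : ι → A}
    (j : N ⟶ free a) (hj : ∀ x, Function.Injective (ap j x)) (T : Finset (Σ x, N.obj x)) :
    ∃ ρ : N ⟶ N, (∀ x n, ap ρ x (ap ρ x n) = ap ρ x n) ∧ (∀ p ∈ T, ap ρ p.1 p.2 = p.2) ∧
      ∃ S : Finset (Σ x, N.obj x), ∀ x n, ∃ c : ∀ i : Σ x, N.obj x, i.1 ⟶ x,
        ap ρ x n = ∑ i ∈ S, act N (c i) i.2 := by
  classical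
  have hN : IsMod k N := isMod_free.of_injective j hj
  let e : (Σ x, N.obj x) → A := Sigma.fst
  let ε : free e ⟶ N := desc hN fun i => i.2
  have hε : ∀ x, Function.Surjective (ap ε x) := fun x n =>
    ⟨sgl e ⟨x, n⟩ x (𝟙 x), by simp only [ε, desc_sgl]; exact act_id _ _⟩
  obtain ⟨σ, hσ⟩ := exists_section_of_free hA isMod_free j hj ε hε
  have hσ' : ∀ x n, ap ε x (ap σ x n) = n := fun x n => by rw [← ap_comp, hσ, ap_id]
  choose supp hsupp using fun p : Σ x, N.obj x => exists_eq_sum (ap σ p.1 p.2)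
  let S := T.biUnion supp
  let h : N ⟶ free e := σ ≫ kill S
  let I := Sub.range h
  let h' : N ⟶ I.toFun := I.lift h fun x v => ⟨v, rfl⟩
  have hh' : ∀ x n, ap I.incl x (ap h' x n) = ap h x n := fun x n => rfl
  have hsurj : ∀ x, Function.Surjective (ap h' x) := by
    rintro x ⟨w, n, rfl⟩
    exact ⟨n, rfl⟩
  obtain ⟨s, hs⟩ := exists_section_of_free hA hN I.incl I.incl_injective h' hsurj
  have hs' : ∀ x n, ap h' x (ap s x n) = n := fun x n => by rw [← ap_comp, hs, ap_id]
  have h0 : ∀ x n, ap h' x n = 0 ↔ ∀ i ∉ S, coord e x i (ap σ x n) = 0 := by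
    intro x n
    rw [← kill_eq_zero, ← ap_comp]
    change _ ↔ ap h x n = 0
    rw [← hh']
    exact (map_eq_zero_iff _ (I.incl_injective x)).symm
  have hρ0 : ∀ x n, ap h' x (ap (𝟙 N - h' ≫ s) x n) = 0 := by
    intro x n
    rw [ap_sub, map_sub, ap_comp, hs', ap_id, sub_self]
  have hρ1 : ∀ x n, ap h' x n = 0 → ap (𝟙 N - h' ≫ s) x n = n := by
    intro x n hn
    rw [ap_sub, ap_comp, hn, map_zero, sub_zero, ap_id]
  refine ⟨𝟙 N - h' ≫ s, fun x n => hρ1 _ _ (hρ0 x n), fun p hp => hρ1 _ _ ?_, S, fun x n => ?_⟩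
  · rw [h0]
    intro i hi
    refine (hsupp p).1 i fun hi' => hi ?_
    exact Finset.mem_biUnion.mpr ⟨p, hp, hi'⟩
  · have := desc_of_coord hN (fun i => i.2) _ S ((h0 _ _).mp (hρ0 x n))
    rw [show desc hN (fun i => i.2) = ε from rfl, hσ'] at this
    exact ⟨_, this⟩

/-- A system of linear equations over a field is solvable as soon as its finite subsystems
are. -/
theorem exists_dual_of_finite {E W : Type} [AddCommGroup W] [Module k W] (w : E → W) (c : E → k)
    (h : ∀ T : Finset E, ∃ φ : Module.Dual k W, ∀ e ∈ T, φ (w e) = c e) :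
    ∃ φ : Module.Dual k W, ∀ e, φ (w e) = c e := by
  classical
  have hn : ((0 : W), (1 : k)) ∉ Submodule.span k (Set.range fun e => (w e, c e)) := by
    intro hmem
    obtain ⟨l, hl⟩ := (Finsupp.mem_span_range_iff_exists_finsupp).mp hmem
    obtain ⟨φ, hφ⟩ := h l.support
    have h1 : l.sum (fun e r => r • w e) = 0 := by
      have := congrArg Prod.fst hl
      simpa [Finsupp.sum, Prod.fst_sum] using this
    have h2 : l.sum (fun e r => r • c e) = 1 := by
      have := congrArg Prod.snd hl
      simpa [Finsupp.sum, Prod.snd_sum] using this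
    have h3 : φ (l.sum (fun e r => r • w e)) = l.sum (fun e r => r • c e) := by
      rw [Finsupp.sum, Finsupp.sum, map_sum]
      exact Finset.sum_congr rfl fun e he => by rw [map_smul, hφ e he]
    rw [h1, h2, map_zero] at h3
    exact zero_ne_one h3
  obtain ⟨ψ, hψ, hle⟩ := Submodule.exists_le_ker_of_notMem hn
  refine ⟨-(ψ (0, 1))⁻¹ • ψ.comp (LinearMap.inl k W k), fun e => ?_⟩
  have h1 : ψ (w e, c e) = 0 := hle (Submodule.subset_span ⟨e, rfl⟩)
  have h2 : (w e, c e) = (w e, (0 : k)) + c e • ((0 : W), (1 : k)) := by simp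
  rw [h2, map_add, map_smul] at h1
  have h3 : ψ (w e, 0) = - (c e * ψ (0, 1)) := by
    rw [smul_eq_mul] at h1
    exact eq_neg_of_add_eq_zero_left h1
  simp only [LinearMap.smul_apply, LinearMap.comp_apply, LinearMap.inl_apply, h3, smul_eq_mul]
  field_simp

/-- An epimorphism from a locally finite dimensional module splits if it splits over all
finitely presented modules. -/
theorem exists_section_of_finite {C : A ⥤ ModuleCat.{0} k} (hM : IsLfdMod k M) (π : M ⟶ C)
    (hπ : ∀ x, Function.Surjective (ap π x))
    (H : ∀ (ι κ : Type) [Fintype ι] [Fintype κ] (a : ι → A) (b : κ → A)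
      (c : ∀ i, C.obj (a i)) (w : ∀ j i, a i ⟶ b j), (∀ j, ∑ i, act C (w j i) (c i) = 0) →
      ∃ m : ∀ i, M.obj (a i), (∀ i, ap π _ (m i) = c i) ∧ ∀ j, ∑ i, act M (w j i) (m i) = 0) :
    ∃ σ : C ⟶ M, ∀ x c, ap π x (ap σ x c) = c := by
  classical
  have hC : IsMod k C := hM.1.of_surjective π hπ
  let I := Σ x, C.obj x
  let R := Σ (y : A) (T : Finset I), {r : ∀ i : I, i.1 ⟶ y // ∑ i ∈ T, act C (r i) i.2 = 0}
  let E := (Σ i : I, Module.Dual k (C.obj i.1)) ⊕ (Σ r : R, Module.Dual k (M.obj r.1))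
  let W := Π₀ i : I, Module.Dual k (M.obj i.1)
  let sg : ∀ i : I, Module.Dual k (M.obj i.1) →ₗ[k] W := fun i =>
    DFinsupp.lsingle (R := k) (M := fun i : I => Module.Dual k (M.obj i.1)) i
  let w : E → W := Sum.elim
    (fun p => sg p.1 (p.2.comp (ap π p.1.1)))
    (fun p => ∑ i ∈ p.1.2.1, sg i (p.2.comp (act M (p.1.2.2.1 i))))
  let c : E → k := Sum.elim (fun p => p.2 p.1.2) (fun _ => 0)
  have fd := hM.2
  obtain ⟨φ, hφ⟩ : ∃ φ : Module.Dual k W, ∀ e, φ (w e) = c e := by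
    refine exists_dual_of_finite w c fun T => ?_
    let rel : E → R := Sum.elim (fun p => ⟨p.1.1, {p.1}, 0, by simp [hC.act_zero]⟩)
      (fun p => p.1)
    let U : Finset I := T.biUnion fun e => (rel e).2.1
    have hsum : ∀ {D : A ⥤ ModuleCat.{0} k} (_ : IsMod k D) (d : ∀ i : I, D.obj i.1) (e : E),
        e ∈ T → ∑ i : U, act D (if i.1 ∈ (rel e).2.1 then (rel e).2.2.1 i.1 else 0) (d i.1) =
          ∑ i ∈ (rel e).2.1, act D ((rel e).2.2.1 i) (d i) := by
      intro D hD d e he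
      have hsub : (rel e).2.1 ⊆ U := Finset.subset_biUnion_of_mem (fun e => (rel e).2.1) he
      rw [Finset.sum_coe_sort U
        (fun i => act D (if i ∈ (rel e).2.1 then (rel e).2.2.1 i else 0) (d i)),
        ← Finset.sum_subset hsub]
      · exact Finset.sum_congr rfl fun i hi => by rw [if_pos hi]
      · intro i _ hi
        rw [if_neg hi, hD.act_zero]
    obtain ⟨m, hm1, hm2⟩ := H U T (fun i => i.1.1) (fun e => (rel e.1).1) (fun i => i.1.2)
      (fun e i => if i.1 ∈ (rel e.1).2.1 then (rel e.1).2.2.1 i.1 else 0)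
      (fun e => by rw [hsum hC (fun i => i.2) e.1 e.2]; exact (rel e.1).2.2.2)
    let m' : ∀ i : I, M.obj i.1 := fun i => if h : i ∈ U then m ⟨i, h⟩ else 0
    have hm' : ∀ i : U, m' i.1 = m i := fun i => dif_pos i.2
    let Φ : Module.Dual k W := DFinsupp.lsum (R := k) k
      (M := fun i : I => Module.Dual k (M.obj i.1)) (fun i => Module.Dual.eval k _ (m' i))
    have hΦ : ∀ i ξ, Φ (sg i ξ) = ξ (m' i) := fun i ξ =>
      DFinsupp.lsum_single (M := fun i : I => Module.Dual k (M.obj i.1)) ..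
    refine ⟨Φ, fun e he => ?_⟩
    have hrel : ∑ i ∈ (rel e).2.1, act M ((rel e).2.2.1 i) (m' i) = 0 := by
      rw [← hsum hM.1 m' e he, ← hm2 ⟨e, he⟩]
      exact Finset.sum_congr rfl fun i _ => by rw [hm']
    rcases e with ⟨i, ξ⟩ | ⟨r, μ⟩
    · have hi : i ∈ U := Finset.mem_biUnion.mpr ⟨_, he, Finset.mem_singleton_self i⟩
      change Φ (sg i (ξ.comp (ap π i.1))) = ξ i.2
      rw [hΦ, LinearMap.comp_apply, hm' ⟨i, hi⟩]
      exact congrArg ξ (hm1 ⟨i, hi⟩)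
    · change Φ (∑ i ∈ r.2.1, sg i (μ.comp (act M (r.2.2.1 i)))) = 0
      have h0 : μ (∑ i ∈ r.2.1, act M (r.2.2.1 i) (m' i)) = 0 :=
        (congrArg μ hrel).trans (map_zero μ)
      rw [map_sum] at h0 ⊢
      exact Eq.trans (Finset.sum_congr rfl fun i _ => hΦ _ _) h0
  let m : ∀ i : I, M.obj i.1 := fun i =>
    (Module.evalEquiv k (M.obj i.1)).symm (φ.comp (sg i))
  have hm : ∀ i (ξ : Module.Dual k (M.obj i.1)), ξ (m i) = φ (sg i ξ) :=
    fun i ξ => Module.apply_evalEquiv_symm_apply k _ ξ _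
  have hm1 : ∀ i, ap π _ (m i) = i.2 := by
    intro i
    rw [← sub_eq_zero, ← Module.forall_dual_apply_eq_zero_iff k]
    intro ξ
    rw [map_sub, sub_eq_zero]
    have := hφ (Sum.inl ⟨i, ξ⟩)
    rw [← LinearMap.comp_apply, hm]
    exact this
  have hm2 : ∀ (y : A) (T : Finset I) (r : ∀ i : I, i.1 ⟶ y),
      ∑ i ∈ T, act C (r i) i.2 = 0 → ∑ i ∈ T, act M (r i) (m i) = 0 := by
    intro y T r hr
    rw [← Module.forall_dual_apply_eq_zero_iff k]
    intro μ
    have := hφ (Sum.inr ⟨⟨y, T, r, hr⟩, μ⟩)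
    change φ (∑ i ∈ T, sg i (μ.comp (act M (r i)))) = 0 at this
    rw [map_sum] at this ⊢
    refine Eq.trans (Finset.sum_congr rfl fun i _ => ?_) this
    rw [← hm, LinearMap.comp_apply]
  let e : I → A := Sigma.fst
  let ε : free e ⟶ C := desc hC fun i => i.2
  have hε : ∀ x n, ap ε x (sgl e ⟨x, n⟩ x (𝟙 x)) = n := fun x n => by
    simp only [ε, desc_sgl]; exact act_id _ _
  obtain ⟨σ, hσ⟩ := exists_factor ε (desc hM.1 m) (𝟙 C) (fun x v hv => by
      obtain ⟨s, hs, -⟩ := exists_eq_sum v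
      rw [desc_of_coord _ _ v s hs] at hv ⊢
      exact hm2 x s _ hv) (fun x n => ⟨_, (hε x n).trans (ap_id x n).symm⟩)
  refine ⟨σ, fun x n => ?_⟩
  rw [hσ x n _ ((ap_id x n).trans (hε x n).symm), desc_sgl]
  change ap π x (act M (𝟙 x) (m ⟨x, n⟩)) = n
  rw [act_id]
  exact hm1 ⟨x, n⟩

/-- The product of two modules. -/
def prodFun (M N : A ⥤ ModuleCat.{0} k) : A ⥤ ModuleCat.{0} k :=
  mkFun (fun x => M.obj x × N.obj x) (fun f => (act M f).prodMap (act N f))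
    (fun x v => Prod.ext (act_id x v.1) (act_id x v.2))
    (fun f g v => Prod.ext (act_comp f g v.1) (act_comp f g v.2))

theorem isLfdMod_prodFun (hM : IsLfdMod k M) (hN : IsLfdMod k N) : IsLfdMod k (prodFun M N) := by
  refine ⟨isMod_of_act (fun f g v => Prod.ext (hM.1.act_add f g v.1) (hN.1.act_add f g v.2))
    (fun r f v => Prod.ext (hM.1.act_smul r f v.1) (hN.1.act_smul r f v.2)), fun x => ?_⟩
  have := hM.2 x
  have := hN.2 x
  exact (inferInstance : FiniteDimensional k (M.obj x × N.obj x))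

/-- The first projection of a product of modules. -/
def prodFst (M N : A ⥤ ModuleCat.{0} k) : prodFun M N ⟶ M :=
  mkHom (fun x => LinearMap.fst k (M.obj x) (N.obj x)) (fun _ _ => rfl)

/-- The second projection of a product of modules. -/
def prodSnd (M N : A ⥤ ModuleCat.{0} k) : prodFun M N ⟶ N :=
  mkHom (fun x => LinearMap.snd k (M.obj x) (N.obj x)) (fun _ _ => rfl)

/-- A morphism to the cokernel of an irreducible monomorphism `f : L ⟶ M` lifts to `M`, or the
projection from `M` factors through it. -/
theorem Irred.lift_or_factor {L C X : A ⥤ ModuleCat.{0} k} {f : L ⟶ M} (hf : Irred k f)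
    (hM : IsLfdMod k M) (π : M ⟶ C) (hπ : ∀ x, Function.Surjective (ap π x))
    (hex : ∀ x v, ap π x v = 0 ↔ ∃ l, ap f x l = v) (hX : IsLfdMod k X) (g : X ⟶ C) :
    (∃ t : X ⟶ M, t ≫ π = g) ∨ ∃ s : M ⟶ X, s ≫ g = π := by
  let P : Sub (prodFun M X) := Sub.ker (prodFst M X ≫ π - prodSnd M X ≫ g)
  have hP : IsLfdMod k P.toFun := (isLfdMod_prodFun hM hX).of_injective _ P.incl_injective
  have hmem : ∀ x (m : M.obj x) (v : X.obj x), (m, v) ∈ P.car x ↔ ap π x m = ap g x v := by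
    intro x m v
    change ap π x m - ap g x v = 0 ↔ _
    exact sub_eq_zero
  let p₁ : P.toFun ⟶ M := P.incl ≫ prodFst M X
  let p₂ : P.toFun ⟶ X := P.incl ≫ prodSnd M X
  have hp : p₁ ≫ π = p₂ ≫ g := hom_ext' fun x v => (hmem x v.1.1 v.1.2).mp v.2
  let u : L ⟶ P.toFun := mkHom (fun x => LinearMap.codRestrict (P.car x)
      (LinearMap.prod (ap f x) 0) (fun l => (hmem x _ _).mpr (by
        rw [LinearMap.zero_apply, map_zero]; exact (hex x _).mpr ⟨l, rfl⟩)))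
    (fun f' l => Subtype.ext (Prod.ext (ap_act f f' l) (map_zero (act X f')).symm))
  have hu : u ≫ p₁ = f := rfl
  rcases hf.2.2 hP u p₁ hu with h | h
  · left
    have hr := IsSplitMono.id u
    have hsurj : ∀ x v, ∃ n, ap p₂ x n = ap (𝟙 X) x v := by
      intro x v
      obtain ⟨m, hm⟩ := hπ x (ap g x v)
      exact ⟨⟨(m, v), (hmem x m v).mpr hm⟩, (ap_id x v).symm⟩
    have hu0 : u ≫ (p₁ - retraction u ≫ f) = 0 := by
      rw [Preadditive.comp_sub, hu, ← Category.assoc u (retraction u) f, hr, Category.id_comp,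
        sub_self]
    have hfπ : f ≫ π = 0 := hom_ext' fun x l => by
      rw [ap_comp, ap_zero]; exact (hex _ _).mpr ⟨l, rfl⟩
    have hpπ : (p₁ - retraction u ≫ f) ≫ π = p₂ ≫ g := by
      rw [Preadditive.sub_comp, Category.assoc _ f π, hfπ, comp_zero, sub_zero, hp]
    obtain ⟨t, ht⟩ := exists_factor p₂ (p₁ - retraction u ≫ f) (𝟙 X) (by
      rintro x ⟨⟨m, v⟩, hv⟩ h0
      have h0 : v = 0 := h0
      subst h0
      have h1 := (hmem x m 0).mp hv
      rw [map_zero, hex] at h1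
      obtain ⟨l, rfl⟩ := h1
      change ap (p₁ - retraction u ≫ f) x (ap u x l) = 0
      rw [← ap_comp, hu0, ap_zero]) hsurj
    refine ⟨t, hom_ext' fun x v => ?_⟩
    obtain ⟨n, hn⟩ := hsurj x v
    rw [ap_comp, ht x v n hn.symm, ← ap_comp, hpπ, ap_comp, hn, ap_id]
  · right
    exact ⟨section_ p₁ ≫ p₂, by rw [Category.assoc, ← hp, IsSplitEpi.id_assoc]⟩


/-! ### Morphisms with finitely presented cokernel -/

/-- The cokernel of `h` is finitely presented, in terms of generators and relations. -/
def CokFP {X Y : A ⥤ ModuleCat.{0} k} (h : X ⟶ Y) : Prop :=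
  ∃ (ι κ : Type) (_ : Fintype ι) (_ : Fintype κ) (a : ι → A) (b : κ → A)
    (m : ∀ i, Y.obj (a i)) (w : ∀ j i, a i ⟶ b j),
    (∀ x (v : Y.obj x), ∃ (r : ∀ i, a i ⟶ x) (u : X.obj x),
      v = ∑ i, act Y (r i) (m i) + ap h x u) ∧
    (∀ j, ∃ u, ∑ i, act Y (w j i) (m i) = ap h (b j) u) ∧
    ∀ x (r : ∀ i, a i ⟶ x) (u : X.obj x), ∑ i, act Y (r i) (m i) = ap h x u →
      ∃ c : ∀ j, b j ⟶ x, ∀ i, r i = ∑ j, w j i ≫ c j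

theorem CokFP.of_surjective {h : M ⟶ N} (hh : ∀ x, Function.Surjective (ap h x)) : CokFP h := by
  refine ⟨Empty, Empty, inferInstance, inferInstance, Empty.elim, Empty.elim, fun i => i.elim,
    fun i => i.elim, fun x v => ?_, fun j => j.elim, fun x r u _ => ⟨fun j => j.elim,
    fun i => i.elim⟩⟩
  obtain ⟨u, rfl⟩ := hh x v
  exact ⟨fun i => i.elim, u, by simp⟩

theorem CokFP.of_free {h : M ⟶ N} (hN : IsMod k N) {ι κ : Type} [Fintype ι] [Fintype κ]
    {a : ι → A} {b : κ → A} (m : ∀ i, N.obj (a i)) (s : ∀ j, (free (k := k) a).obj (b j))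
    (h₁ : ∀ x v, ∃ z u, v = ap (desc hN m) x z + ap h x u)
    (h₂ : ∀ j, ∃ u, ap (desc hN m) (b j) (s j) = ap h (b j) u)
    (h₃ : ∀ x z u, ap (desc hN m) x z = ap h x u →
      ∃ c : ∀ j, b j ⟶ x, z = ∑ j, act (free a) (c j) (s j)) :
    CokFP h := by
  refine ⟨ι, κ, inferInstance, inferInstance, a, b, m,
    fun j i => coord a (b j) i (s j), fun x v => ?_, fun j => ?_, fun x r u hr => ?_⟩
  · obtain ⟨z, u, e⟩ := h₁ x v
    exact ⟨fun i => coord a x i z, u, by rw [e, desc_fintype]⟩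
  · obtain ⟨u, e⟩ := h₂ j
    exact ⟨u, by rw [← e, desc_fintype]⟩
  · obtain ⟨z, hz⟩ := exists_coord (k := k) r
    obtain ⟨c, hc⟩ := h₃ x z u (by rw [desc_fintype, ← hr]; simp only [hz])
    refine ⟨c, fun i => ?_⟩
    rw [← hz i, hc, map_sum]
    rfl

/-- The submodule `N` of a free module is finitely generated if it receives enough
idempotents from a module `L` having only trivial ones. -/
theorem fg_of_idempotents {L : A ⥤ ModuleCat.{0} k} (u : N ⟶ L)
    (hid : ∀ e : L ⟶ L, e ≫ e = e → e = 0 ∨ e = 𝟙 L)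
    (H : ∀ T : Finset (Σ x, N.obj x), ∃ (ρ : N ⟶ N) (l : L ⟶ N), ρ ≫ ρ = ρ ∧
      (∀ p ∈ T, ap ρ p.1 p.2 = p.2) ∧ u ≫ l = 𝟙 N - ρ ∧ l ≫ ρ = 0 ∧
      ∃ S : Finset (Σ x, N.obj x), ∀ x n, ∃ c : ∀ i : Σ x, N.obj x, i.1 ⟶ x,
        ap ρ x n = ∑ i ∈ S, act N (c i) i.2) :
    ∃ S : Finset (Σ x, N.obj x), ∀ x n, ∃ c : ∀ i : Σ x, N.obj x, i.1 ⟶ x,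
      n = ∑ i ∈ S, act N (c i) i.2 := by
  have H' : ∀ T : Finset (Σ x, N.obj x), ∃ (ρ : N ⟶ N) (l : L ⟶ N),
      (∀ p ∈ T, ap ρ p.1 p.2 = p.2) ∧ u ≫ l = 𝟙 N - ρ ∧ (l ≫ u = 𝟙 L ∨
      ∃ S : Finset (Σ x, N.obj x), ∀ x n, ∃ c : ∀ i : Σ x, N.obj x, i.1 ⟶ x,
        n = ∑ i ∈ S, act N (c i) i.2) := by
    intro T
    obtain ⟨ρ, l, h1, h2, h3, h4, S, hS⟩ := H T
    refine ⟨ρ, l, h2, h3, ?_⟩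
    have h5 : u ≫ l ≫ u = u - ρ ≫ u := by
      rw [← Category.assoc, h3, Preadditive.sub_comp, Category.id_comp]
    have h6 : (l ≫ u) ≫ (l ≫ u) = l ≫ u := by
      rw [Category.assoc, h5, Preadditive.comp_sub, ← Category.assoc l ρ, h4, zero_comp, sub_zero]
    refine (hid _ h6).symm.imp id fun h0 => ⟨S, fun x n => ?_⟩
    have h7 : 𝟙 N - ρ = 0 := by
      have : (𝟙 N - ρ) ≫ (𝟙 N - ρ) = 𝟙 N - ρ := by
        simp [Preadditive.comp_sub, Preadditive.sub_comp, h1]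
      rw [← this]
      nth_rw 1 [← h3]
      rw [← h3, Category.assoc, ← Category.assoc l, h0, zero_comp, comp_zero]
    obtain ⟨c, hc⟩ := hS x n
    refine ⟨c, hc ▸ ?_⟩
    rw [← sub_eq_zero.mp h7, ap_id]
  by_contra hcon
  obtain ⟨ρ, l, -, h1, h2⟩ := H' ∅
  have h2 := h2.resolve_right hcon
  have hex : ∃ x n, ap ρ x n ≠ n := by
    by_contra! hall
    have : ρ = 𝟙 N := hom_ext' fun x n => by rw [hall, ap_id]
    rw [this, sub_self] at h1
    have hl : l = 0 := by rw [← Category.id_comp l, ← h2, Category.assoc, h1, comp_zero]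
    have hL : 𝟙 L = 0 := by rw [← h2, hl, zero_comp]
    obtain ⟨ρ', l', -, h3, h4, -, S, hS⟩ := H ∅
    have hu : u = 0 := by rw [← Category.comp_id u, hL, comp_zero]
    rw [hu, zero_comp] at h4
    refine hcon ⟨S, fun x n => ?_⟩
    obtain ⟨c, hc⟩ := hS x n
    refine ⟨c, hc ▸ ?_⟩
    rw [← sub_eq_zero.mp h4.symm, ap_id]
  obtain ⟨x, n, hn⟩ := hex
  obtain ⟨ρ', l', h3, h4, h5⟩ := H' {⟨x, n⟩}
  have h5 := h5.resolve_right hcon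
  have h6 : ap l' x (ap u x n) = 0 := by
    rw [← ap_comp, h4, ap_sub, ap_id, h3 _ (Finset.mem_singleton_self _), sub_self]
  have h7 : ap u x n = 0 := by
    rw [← ap_id (M := L) x (ap u x n), ← h5, ap_comp, h6, map_zero]
  have h8 : ap (𝟙 N - ρ) x n = 0 := by rw [← h1, ap_comp, h7, map_zero]
  rw [ap_sub, ap_id, sub_eq_zero] at h8
  exact hn h8.symm

/-- An irreducible monomorphism starting in a module with trivial idempotents has finitely
presented cokernel. -/
theorem Irred.cokFP (hA : LiftsDerivations k A) (hF : ∀ a b : A, FiniteDimensional k (a ⟶ b))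
    {L : A ⥤ ModuleCat.{0} k} {f : L ⟶ M} (hf : Irred k f) (hM : IsLfdMod k M)
    (hinj : ∀ x, Function.Injective (ap f x))
    (hid : ∀ e : L ⟶ L, e ≫ e = e → e = 0 ∨ e = 𝟙 L) : CokFP f := by
  let K := Sub.range f
  let π : M ⟶ K.quot := K.proj
  have hπ : ∀ x, Function.Surjective (ap π x) := K.proj_surjective
  have hex : ∀ x v, ap π x v = 0 ↔ ∃ l, ap f x l = v := fun x v =>
    K.proj_eq_zero.trans Sub.mem_range
  have hC : IsMod k K.quot := hM.1.of_surjective π hπ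
  have hfπ : ∀ x l, ap π x (ap f x l) = 0 := fun x l => (hex x _).mpr ⟨l, rfl⟩
  have hns : ¬ ∃ σ : K.quot ⟶ M, ∀ x c, ap π x (ap σ x c) = c := by
    rintro ⟨σ, hσ⟩
    obtain ⟨t, ht⟩ := exists_factor f (𝟙 L) (𝟙 M - π ≫ σ)
      (fun x v hv => by rw [ap_id]; exact hinj x (by rw [hv, map_zero]))
      (fun x v => (hex _ _).mp (by rw [ap_sub, map_sub, ap_comp, hσ, ap_id, sub_self]))
    refine hf.1 (IsSplitMono.mk' ⟨t, hom_ext' fun x l => ?_⟩)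
    rw [ap_comp, ht x _ l (by rw [ap_sub, ap_comp, hfπ, map_zero, sub_zero, ap_id])]
  have htest := mt (exists_section_of_finite hM π hπ) hns
  push Not at htest
  obtain ⟨ι, κ, _, _, a, b, c, w, hw, hnot⟩ := htest
  choose r hr using fun j => exists_coord (k := k) (w j)
  let K' := Sub.range (desc isMod_free r)
  have hF' : IsLfdMod k K'.quot := (isLfdMod_free hF).of_surjective _ K'.proj_surjective
  let ε : free a ⟶ K.quot := desc hC c
  have hεr : ∀ j, ap ε _ (r j) = 0 := fun j => by
    rw [desc_fintype, ← hw j]; simp only [hr]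
  have hεK : desc isMod_free r ≫ ε = 0 := free_hom_ext fun j => by
    rw [ap_comp, desc_sgl, act_id, hεr, ap_zero]
  obtain ⟨q, hq⟩ := exists_factor K'.proj ε (𝟙 K'.quot) (fun x v hv => by
      obtain ⟨z, rfl⟩ := Sub.mem_range.mp (K'.proj_eq_zero.mp hv)
      rw [← ap_comp, hεK, ap_zero])
    (fun x l => by rw [ap_id]; exact K'.proj_surjective x l)
  have hq' : ∀ x z, ap q x (ap K'.proj x z) = ap ε x z := fun x z => hq x _ z (ap_id _ _)
  have hprojr : ∀ j, ap K'.proj _ (r j) = 0 := fun j =>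
    K'.proj_eq_zero.mpr ⟨sgl b j _ (𝟙 _), by rw [desc_sgl, act_id]⟩
  have hεe : ∀ i, ap ε _ (sgl a i _ (𝟙 (a i))) = c i := fun i => by rw [desc_sgl, act_id]
  rcases hf.lift_or_factor hM π hπ hex hF' q with ⟨t, ht⟩ | ⟨s, hs⟩
  · exfalso
    let m : ∀ i, M.obj (a i) := fun i => ap t _ (ap K'.proj _ (sgl a i _ (𝟙 (a i))))
    have hm : desc hM.1 m = K'.proj ≫ t := free_hom_ext fun i => by
      rw [desc_sgl, act_id, ap_comp]
    obtain ⟨j, hj⟩ := hnot m (fun i => by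
      rw [← hεe, ← hq', ← ht, ap_comp])
    apply hj
    have := desc_fintype hM.1 m (r j)
    simp only [hr] at this
    rw [← this, hm, ap_comp, hprojr, map_zero]
  have hs' : ∀ x v, ap q x (ap s x v) = ap π x v := fun x v => by rw [← ap_comp, hs]
  choose pm hpm using fun i => hπ _ (c i)
  let p : free a ⟶ M := desc hM.1 pm
  have hpε : p ≫ π = ε := free_hom_ext fun i => by rw [ap_comp, desc_sgl, act_id, hεe, hpm]
  have hp' : ∀ x z, ap π x (ap p x z) = ap ε x z := fun x z => by rw [← ap_comp, hpε]
  let N := (Sub.ker ε).toFun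
  let j : N ⟶ free a := (Sub.ker ε).incl
  have hj : ∀ x, Function.Injective (ap j x) := (Sub.ker ε).incl_injective
  have hjε : ∀ x n, ap ε x (ap j x n) = 0 := fun x n => (Sub.ker ε).incl_mem n
  have hN : IsMod k N := isMod_free.of_injective j hj
  choose rN hrN using fun i => (Sub.ker ε).exists_incl (Sub.mem_ker.mpr (hεr i))
  choose z hz using fun i => K'.proj_surjective _ (ap s _ (pm i))
  choose φ hφ using fun i => (Sub.ker ε).exists_incl
    (v := z i - sgl a i _ (𝟙 (a i))) (Sub.mem_ker.mpr (by
      rw [map_sub, ← hq', hz, hs', hpm, hεe, sub_self]))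
  have hφs : K'.proj + desc hN φ ≫ j ≫ K'.proj = p ≫ s := free_hom_ext fun i => by
    rw [ap_add, ap_comp, ap_comp, ap_comp, desc_sgl, desc_sgl, act_id, act_id, hφ, map_sub, hz,
      add_sub_cancel]
  obtain ⟨u, hu⟩ := exists_factor f (𝟙 L) (j ≫ p)
    (fun x v hv => by rw [ap_id]; exact hinj x (by rw [hv, map_zero]))
    (fun x n => (hex _ _).mp (by rw [ap_comp, hp', hjε]))
  have hfu : ∀ x n, ap f x (ap u x n) = ap p x (ap j x n) := by
    intro x n
    obtain ⟨l, hl⟩ := (hex x (ap p x (ap j x n))).mp (by rw [hp', hjε])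
    rw [hu x n l (by rw [ap_comp, hl]), ap_id, hl]
  obtain ⟨S, hS⟩ : ∃ S : Finset (Σ x, N.obj x), ∀ x n, ∃ c : ∀ i : Σ x, N.obj x, i.1 ⟶ x,
      n = ∑ i ∈ S, act N (c i) i.2 := by
    classical
    refine fg_of_idempotents u hid fun T => ?_
    obtain ⟨ρ, hρ, hρT, hS⟩ := exists_idempotent_of_free hA j hj
      (T ∪ (Finset.univ.image fun i => ⟨b i, rN i⟩) ∪ Finset.univ.image fun i => ⟨a i, φ i⟩)
    have hρ1 : desc hN rN ≫ ρ = desc hN rN := free_hom_ext fun i => by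
      rw [ap_comp, desc_sgl, act_id]
      exact hρT ⟨b i, rN i⟩ (Finset.mem_union_left _ (Finset.mem_union_right _
        (Finset.mem_image_of_mem _ (Finset.mem_univ i))))
    have hρ2 : desc hN φ ≫ ρ = desc hN φ := free_hom_ext fun i => by
      rw [ap_comp, desc_sgl, act_id]
      exact hρT ⟨a i, φ i⟩ (Finset.mem_union_right _
        (Finset.mem_image_of_mem _ (Finset.mem_univ i)))
    have hrj : desc hN rN ≫ j = desc isMod_free r := free_hom_ext fun i => by
      rw [ap_comp, desc_sgl, desc_sgl, act_id, act_id, hrN]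
    have hsurj : ∀ x l, ∃ n, ap (j ≫ K'.proj) x n = ap (f ≫ s) x l := by
      intro x l
      obtain ⟨z, hz⟩ := K'.proj_surjective x (ap (f ≫ s) x l)
      obtain ⟨n, hn⟩ := (Sub.ker ε).exists_incl (v := z) (Sub.mem_ker.mpr (by
        rw [← hq', hz, ap_comp, hs', hfπ]))
      exact ⟨n, by rw [ap_comp, hn, hz]⟩
    obtain ⟨l, hl⟩ := exists_factor (j ≫ K'.proj) (𝟙 N - ρ) (f ≫ s) (fun x n hn => by
      rw [ap_comp] at hn
      obtain ⟨z, hz⟩ := Sub.mem_range.mp (K'.proj_eq_zero.mp hn)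
      rw [← hrj, ap_comp] at hz
      have hz := hj x hz
      rw [← hz, ← ap_comp, Preadditive.comp_sub, hρ1, Category.comp_id, sub_self, ap_zero])
      hsurj
    have hρρ : ρ ≫ ρ = ρ := hom_ext' fun x n => by rw [ap_comp, hρ]
    refine ⟨ρ, l, hρρ, fun p hp => hρT p (by simp [hp]), hom_ext' fun x n => ?_,
      hom_ext' fun x v => ?_, hS⟩
    · have h1 : ap (f ≫ s) x (ap u x n) =
          ap (j ≫ K'.proj) x (n + ap (desc hN φ) x (ap j x n)) := by
        rw [ap_comp, hfu, ← ap_comp, ← hφs, ap_add, map_add]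
        simp only [ap_comp]
      have h2 : ap (𝟙 N - ρ) x (ap (desc hN φ) x (ap j x n)) = 0 := by
        rw [← ap_comp, Preadditive.comp_sub, hρ2, Category.comp_id, sub_self, ap_zero]
      rw [ap_comp, hl x _ _ h1, map_add, h2, add_zero]
    · obtain ⟨n, hn⟩ := hsurj x v
      rw [ap_comp, hl x v n hn.symm, ← ap_comp, Preadditive.sub_comp, hρρ, Category.id_comp,
        sub_self, ap_zero, ap_zero]
  refine CokFP.of_free hM.1 pm (fun i : S => ap j i.1.1 i.1.2) (fun x v => ?_)
    (fun i => ⟨_, (hfu _ _).symm⟩) (fun x y l hy => ?_)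
  · obtain ⟨y, hy⟩ := K'.proj_surjective x (ap s x v)
    obtain ⟨l, hl⟩ := (hex x (v - ap p x y)).mp (by
      rw [map_sub, ← hs', ← hy, hq', hp', sub_self])
    exact ⟨y, l, by rw [hl, add_sub_cancel]⟩
  · have hy0 : ap ε x y = 0 := by
      rw [← hp', hy, hfπ]
    obtain ⟨n, rfl⟩ := (Sub.ker ε).exists_incl (Sub.mem_ker.mpr hy0)
    obtain ⟨c, hc⟩ := hS x n
    refine ⟨fun i => c i.1, ?_⟩
    change ap j x n = _
    conv_lhs => rw [hc, map_sum]
    simp only [ap_act]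
    exact (Finset.sum_coe_sort S (fun i => act (free a) (c i) (ap j i.1 i.2))).symm


/-! ### Duality -/

instance linearOpposite : CategoryTheory.Linear k Aᵒᵖ where
  homModule X Y :=
    { smul := fun r f => (r • f.unop).op
      one_smul := fun f => congrArg Quiver.Hom.op (one_smul k f.unop)
      mul_smul := fun r s f => congrArg Quiver.Hom.op (mul_smul r s f.unop)
      smul_zero := fun r => congrArg Quiver.Hom.op (smul_zero (A := Y.unop ⟶ X.unop) r)
      smul_add := fun r f g => congrArg Quiver.Hom.op (smul_add r f.unop g.unop)
      add_smul := fun r s f => congrArg Quiver.Hom.op (add_smul r s f.unop)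
      zero_smul := fun f => congrArg Quiver.Hom.op (zero_smul k f.unop) }
  smul_comp _ _ Z r f g :=
    congrArg Quiver.Hom.op (CategoryTheory.Linear.comp_smul Z.unop _ _ g.unop r f.unop)
  comp_smul _ _ Z f r g :=
    congrArg Quiver.Hom.op (CategoryTheory.Linear.smul_comp (Z.unop) _ _ r g.unop f.unop)

/-- Passing to the opposite category, as a linear map on morphisms. -/
def opLin (x y : A) : (x ⟶ y) →ₗ[k] (Opposite.op y ⟶ Opposite.op x) where
  toFun f := f.op
  map_add' _ _ := rfl
  map_smul' _ _ := rfl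

/-- Passing from the opposite category, as a linear map on morphisms. -/
def unopLin (x y : Aᵒᵖ) : (x ⟶ y) →ₗ[k] (y.unop ⟶ x.unop) where
  toFun f := f.unop
  map_add' _ _ := rfl
  map_smul' _ _ := rfl

/-- A bimodule over the opposite category, as a bimodule. -/
def Bimod.unop (B : Bimod k Aᵒᵖ) : Bimod k A where
  V x y := B.V (Opposite.op y) (Opposite.op x)
  l := B.r.comp (opLin _ _)
  r := B.l.comp (opLin _ _)
  l_id v := B.r_id v
  r_id v := B.l_id v
  l_comp f g v := B.r_comp g.op f.op v
  r_comp f g v := B.l_comp g.op f.op v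
  l_r f g v := (B.l_r g.op f.op v).symm

theorem LiftsDerivations.op (hA : LiftsDerivations k A) : LiftsDerivations k Aᵒᵖ := by
  intro B B' q hq hl hr D'
  obtain ⟨D, hD⟩ := hA B.unop B'.unop (fun {x y} => q) (fun x y => hq _ _)
    (fun g v => hr g.op v) (fun f v => hl f.op v)
    { d := fun {x y} => D'.d.comp (opLin x y)
      leibniz := fun f g => (D'.leibniz g.op f.op).trans (add_comm _ _) }
  exact ⟨{ d := fun {x y} => D.d.comp (unopLin x y)
           leibniz := fun f g => (D.leibniz g.unop f.unop).trans (add_comm _ _) },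
    fun f => hD f.unop⟩

theorem finiteDimensional_op (hF : ∀ a b : A, FiniteDimensional k (a ⟶ b)) (a b : Aᵒᵖ) :
    FiniteDimensional k (a ⟶ b) := by
  have := hF b.unop a.unop
  exact FiniteDimensional.of_injective (unopLin a b) fun f g h => Quiver.Hom.unop_inj h

/-- The dual of a module. -/
def dual (M : A ⥤ ModuleCat.{0} k) : Aᵒᵖ ⥤ ModuleCat.{0} k :=
  mkFun (fun x => Module.Dual k (M.obj x.unop)) (fun f => (act M f.unop).dualMap)
    (fun x ξ => LinearMap.ext fun v => congrArg ξ (act_id x.unop v))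
    (fun f g ξ => LinearMap.ext fun v => congrArg ξ (act_comp g.unop f.unop v))

/-- Evaluation of an element of the dual. -/
def ev {x : Aᵒᵖ} (ξ : (dual M).obj x) : M.obj x.unop →ₗ[k] k := ξ

theorem ev_act {x y : Aᵒᵖ} (f : x ⟶ y) (ξ : (dual M).obj x) (v : M.obj y.unop) :
    ev (act (dual M) f ξ) v = ev ξ (act M f.unop v) := rfl

theorem dual_ext {x : Aᵒᵖ} {ξ ζ : (dual M).obj x} (h : ∀ v, ev ξ v = ev ζ v) : ξ = ζ :=
  LinearMap.ext h

theorem eq_of_ev {x : A} {v w : M.obj x}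
    (h : ∀ ξ : (dual M).obj (Opposite.op x), ev ξ v = ev ξ w) : v = w := by
  rw [← sub_eq_zero, ← Module.forall_dual_apply_eq_zero_iff k]
  intro ξ
  rw [map_sub, sub_eq_zero]
  exact h ξ

/-- The dual of a morphism. -/
def dualHom (t : M ⟶ N) : dual N ⟶ dual M :=
  mkHom (fun x => (ap t x.unop).dualMap) (fun f ξ => dual_ext fun v =>
    congrArg (ev ξ) (ap_act t f.unop v).symm)

theorem ev_dualHom (t : M ⟶ N) {x : Aᵒᵖ} (ξ : (dual N).obj x) (v : M.obj x.unop) :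
    ev (ap (dualHom t) x ξ) v = ev ξ (ap t x.unop v) := rfl

theorem dualHom_comp {L : A ⥤ ModuleCat.{0} k} (s : M ⟶ N) (t : N ⟶ L) :
    dualHom (s ≫ t) = dualHom t ≫ dualHom s := rfl

theorem dualHom_id : dualHom (𝟙 M) = 𝟙 (dual M) := rfl

theorem dualHom_injective {s t : M ⟶ N} (h : dualHom s = dualHom t) : s = t :=
  hom_ext' fun x v => eq_of_ev fun ξ => by
    have := ev_dualHom s ξ v
    rw [h] at this
    exact this.symm

theorem isLfdMod_dual (hM : IsLfdMod k M) : IsLfdMod k (dual M) := by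
  refine ⟨isMod_of_act (fun f g ξ => dual_ext fun v => ?_) (fun r f ξ => dual_ext fun v => ?_),
    fun x => ?_⟩
  · exact (congrArg (ev ξ) (hM.1.act_add f.unop g.unop v)).trans (map_add _ _ _)
  · exact (congrArg (ev ξ) (hM.1.act_smul r f.unop v)).trans (map_smul (ev ξ) _ _)
  · have := hM.2 x.unop
    exact (inferInstance : FiniteDimensional k (Module.Dual k (M.obj x.unop)))

theorem dualHom_injective_of_surjective {t : M ⟶ N} (h : ∀ x, Function.Surjective (ap t x))
    (x : Aᵒᵖ) : Function.Injective (ap (dualHom t) x) := by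
  intro ξ ζ e
  refine dual_ext fun v => ?_
  obtain ⟨u, rfl⟩ := h _ v
  rw [← ev_dualHom, e, ev_dualHom]

theorem dualHom_surjective_of_injective {t : M ⟶ N} (h : ∀ x, Function.Injective (ap t x))
    (x : Aᵒᵖ) : Function.Surjective (ap (dualHom t) x) :=
  LinearMap.dualMap_surjective_of_injective (h _)

/-- The dual of a module over the opposite category. -/
def undual (X : Aᵒᵖ ⥤ ModuleCat.{0} k) : A ⥤ ModuleCat.{0} k :=
  mkFun (fun x => Module.Dual k (X.obj (Opposite.op x))) (fun f => (act X f.op).dualMap)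
    (fun x ξ => LinearMap.ext fun v => congrArg ξ (act_id (Opposite.op x) v))
    (fun f g ξ => LinearMap.ext fun v => congrArg ξ (act_comp g.op f.op v))

section Transpose

variable {X : Aᵒᵖ ⥤ ModuleCat.{0} k}

/-- Evaluation of an element of the dual. -/
def unev {x : A} (ψ : (undual X).obj x) : X.obj (Opposite.op x) →ₗ[k] k := ψ

theorem unev_act {x y : A} (f : x ⟶ y) (ψ : (undual X).obj x) (v : X.obj (Opposite.op y)) :
    unev (act (undual X) f ψ) v = unev ψ (act X f.op v) := rfl

theorem undual_ext {x : A} {ψ χ : (undual X).obj x} (h : ∀ v, unev ψ v = unev χ v) : ψ = χ :=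
  LinearMap.ext h

theorem eq_of_unev {x : A} {v w : X.obj (Opposite.op x)}
    (h : ∀ ψ : (undual X).obj x, unev ψ v = unev ψ w) : v = w := by
  rw [← sub_eq_zero, ← Module.forall_dual_apply_eq_zero_iff k]
  intro ξ
  rw [map_sub, sub_eq_zero]
  exact h ξ

theorem isLfdMod_undual (hX : IsLfdMod k X) : IsLfdMod k (undual X) := by
  refine ⟨isMod_of_act (fun f g ξ => undual_ext fun v => ?_)
    (fun r f ξ => undual_ext fun v => ?_), fun x => ?_⟩
  · exact (congrArg (unev ξ) (hX.1.act_add f.op g.op v)).trans (map_add _ _ _)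
  · exact (congrArg (unev ξ) (hX.1.act_smul r f.op v)).trans (map_smul (unev ξ) _ _)
  · have := hX.2 (Opposite.op x)
    exact (inferInstance : FiniteDimensional k (Module.Dual k (X.obj (Opposite.op x))))

theorem exists_transpose_to_undual (h : X ⟶ dual M) :
    ∃ t : M ⟶ undual X, ∀ x m v, unev (ap t x m) v = ev (ap h (Opposite.op x) v) m :=
  ⟨mkHom (fun x => (show X.obj (Opposite.op x) →ₗ[k] Module.Dual k (M.obj x) from
    ap h (Opposite.op x)).flip) (fun f m => undual_ext fun v =>
      (congrArg (fun ξ => ev ξ m) (ap_act h f.op v)).symm), fun _ _ _ => rfl⟩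

theorem exists_transpose_to_dual (t : M ⟶ undual X) :
    ∃ h : X ⟶ dual M, ∀ x m v, ev (ap h x v) m = unev (ap t x.unop m) v :=
  ⟨mkHom (fun x => (show M.obj x.unop →ₗ[k] Module.Dual k (X.obj x) from
    ap t x.unop).flip) (fun f m => dual_ext fun v =>
      (congrArg (fun ξ => unev ξ m) (ap_act t f.unop v)).symm), fun _ _ _ => rfl⟩

theorem exists_transpose_from_undual (hM : IsLfdMod k M) (g : dual M ⟶ X) :
    ∃ t : undual X ⟶ M, ∀ x ψ (ξ : (dual M).obj (Opposite.op x)),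
      ev ξ (ap t x ψ) = unev ψ (ap g (Opposite.op x) ξ) := by
  have := hM.2
  let τ : ∀ x, (undual X).obj x →ₗ[k] M.obj x := fun x =>
    (Module.evalEquiv k (M.obj x)).symm.toLinearMap.comp (ap g (Opposite.op x)).dualMap
  have hτ : ∀ x ψ (ξ : (dual M).obj (Opposite.op x)),
      ev ξ (τ x ψ) = unev ψ (ap g (Opposite.op x) ξ) := fun x ψ ξ =>
    Module.apply_evalEquiv_symm_apply k _ (ev ξ) _
  refine ⟨mkHom τ fun {x y} f ψ => eq_of_ev fun ξ => ?_, hτ⟩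
  rw [hτ, unev_act, ← ap_act, ← hτ]
  rfl

theorem exists_transpose_from_dual (hX : IsLfdMod k X) (g : undual X ⟶ M) :
    ∃ t : dual M ⟶ X, ∀ x ξ (ψ : (undual X).obj x),
      unev ψ (ap t (Opposite.op x) ξ) = ev ξ (ap g x ψ) := by
  have := hX.2
  let τ : ∀ x : Aᵒᵖ, (dual M).obj x →ₗ[k] X.obj x := fun x =>
    (Module.evalEquiv k (X.obj x)).symm.toLinearMap.comp (ap g x.unop).dualMap
  have hτ : ∀ x ξ (ψ : (undual X).obj x),
      unev ψ (τ (Opposite.op x) ξ) = ev ξ (ap g x ψ) := fun x ψ ξ =>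
    Module.apply_evalEquiv_symm_apply k _ (unev ξ) _
  refine ⟨mkHom τ fun {x y} f ψ => eq_of_unev (x := y.unop) fun ξ => ?_, hτ⟩
  refine (hτ _ _ _).trans ?_
  rw [ev_act, ← ap_act]
  exact (hτ x.unop ψ (act (undual X) f.unop ξ)).symm

end Transpose

theorem exists_dualHom_eq (hM : IsLfdMod k M) (r : dual M ⟶ dual N) :
    ∃ s : N ⟶ M, dualHom s = r := by
  obtain ⟨t, ht⟩ := exists_transpose_to_undual (𝟙 (dual N))
  obtain ⟨t', ht'⟩ := exists_transpose_from_undual hM r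
  refine ⟨t ≫ t', hom_ext' fun x ξ => dual_ext fun v => ?_⟩
  rw [ev_dualHom, ap_comp]
  refine (ht' x.unop _ ξ).trans ((ht x.unop v _).trans ?_)
  rw [ap_id]

/-- The dual of an irreducible morphism is irreducible. -/
theorem Irred.dual {f : M ⟶ N} (hf : Irred k f) (hM : IsLfdMod k M) (hN : IsLfdMod k N) :
    Irred k (dualHom f) := by
  refine ⟨fun h => ?_, fun h => ?_, fun X hX g h hgh => ?_⟩
  · obtain ⟨s, hs⟩ := exists_dualHom_eq hM (retraction (dualHom f))
    refine hf.2.1 (IsSplitEpi.mk' ⟨s, dualHom_injective ?_⟩)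
    rw [dualHom_comp, hs, IsSplitMono.id, dualHom_id]
  · obtain ⟨s, hs⟩ := exists_dualHom_eq hM (section_ (dualHom f))
    refine hf.1 (IsSplitMono.mk' ⟨s, dualHom_injective ?_⟩)
    rw [dualHom_comp, hs, IsSplitEpi.id, dualHom_id]
  · obtain ⟨h', hh'⟩ := exists_transpose_to_undual h
    obtain ⟨g', hg'⟩ := exists_transpose_from_undual hN g
    have hgh' : h' ≫ g' = f := hom_ext' fun x m => eq_of_ev fun ξ => by
      rw [ap_comp, hg', hh', ← ap_comp, hgh]
      rfl
    rcases hf.2.2 (isLfdMod_undual hX) h' g' hgh' with e | e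
    · right
      obtain ⟨σ, hσ⟩ := exists_transpose_from_dual hX (retraction h')
      refine IsSplitEpi.mk' ⟨σ, hom_ext' fun x ξ => dual_ext fun m => ?_⟩
      rw [ap_comp, ap_id]
      refine (hh' x.unop m _).symm.trans ((hσ x.unop ξ _).trans ?_)
      rw [← ap_comp, IsSplitMono.id, ap_id]
    · left
      obtain ⟨ρ, hρ⟩ := exists_transpose_to_dual (section_ g')
      refine IsSplitMono.mk' ⟨ρ, hom_ext' fun x ξ => dual_ext fun m => ?_⟩
      rw [ap_comp, ap_id, hρ]
      refine (hg' x.unop _ ξ).symm.trans ?_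
      rw [← ap_comp, IsSplitEpi.id, ap_id]

theorem eq_zero_or_id_dual (hM : IsLfdMod k M)
    (hid : ∀ e : M ⟶ M, e ≫ e = e → e = 0 ∨ e = 𝟙 M) (e : dual M ⟶ dual M) (he : e ≫ e = e) :
    e = 0 ∨ e = 𝟙 _ := by
  obtain ⟨s, rfl⟩ := exists_dualHom_eq hM e
  rcases hid s (dualHom_injective (by rw [dualHom_comp, he])) with rfl | rfl
  · left
    exact hom_ext' fun x ξ => dual_ext fun v => by
      rw [ev_dualHom, ap_zero, ap_zero, map_zero]; rfl
  · exact Or.inr dualHom_id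

/-- The kernel of `g` is finitely co-generated, in terms of co-generators. -/
def KerFCG {X Y : A ⥤ ModuleCat.{0} k} (g : X ⟶ Y) : Prop :=
  ∃ (κ : Type) (_ : Finite κ) (b : κ → A) (ξ : ∀ j, Module.Dual k (X.obj (b j))),
    ∀ x (y : X.obj x), ap g x y = 0 → (∀ j (φ : x ⟶ b j), ξ j (act X φ y) = 0) → y = 0

theorem CokFP.kerFCG_dual {f : M ⟶ N} (hf : CokFP f) : KerFCG (dualHom f) := by
  obtain ⟨ι, κ, _, _, a, b, m, w, h1, -, -⟩ := hf
  refine ⟨ι, inferInstance, fun i => Opposite.op (a i), fun i => Module.Dual.eval k _ (m i),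
    fun x ξ h0 hξ => dual_ext fun v => ?_⟩
  obtain ⟨r, u, rfl⟩ := h1 _ v
  have h2 : ev ξ (ap f x.unop u) = 0 := by
    rw [← ev_dualHom, h0]; rfl
  rw [map_add, map_sum, h2, add_zero]
  exact Finset.sum_eq_zero fun i _ => hξ i (r i).op

theorem CokFP.kerFCG_of_dual {f : M ⟶ N} (hf : CokFP (dualHom f)) : KerFCG f := by
  obtain ⟨ι, κ, _, _, a, b, m, w, h1, -, -⟩ := hf
  refine ⟨ι, inferInstance, fun i => (a i).unop, fun i => ev (m i),
    fun x y h0 hy => eq_of_ev fun ξ => ?_⟩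
  obtain ⟨r, u, rfl⟩ := h1 _ ξ
  have h2 : ev (∑ i, act (Paper.dual M) (r i) (m i) + ap (dualHom f) _ u) y =
      ∑ i, ev (act (Paper.dual M) (r i) (m i)) y + ev u (ap f x y) := by
    rw [← ev_dualHom]
    let E : (Paper.dual M).obj (Opposite.op x) →ₗ[k] k :=
      (LinearMap.applyₗ (R := k) y : Module.Dual k (M.obj x) →ₗ[k] k)
    have hE : ∀ ζ : (Paper.dual M).obj (Opposite.op x), ev ζ y = E ζ := fun _ => rfl
    simp only [hE, map_add, map_sum]
  rw [h2, h0, map_zero, map_zero, add_zero]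
  exact Finset.sum_eq_zero fun i _ => hy i (r i).unop


/-! ### Compositions of irreducible morphisms -/

theorem Irred.injective_or_surjective {f : M ⟶ N} (hf : Irred k f) (hN : IsLfdMod k N) :
    (∀ x, Function.Injective (ap f x)) ∨ ∀ x, Function.Surjective (ap f x) := by
  let K := Sub.range f
  let l : M ⟶ K.toFun := K.lift f fun x v => ⟨v, rfl⟩
  have hl : l ≫ K.incl = f := rfl
  rcases hf.2.2 (hN.of_injective K.incl K.incl_injective) l K.incl hl with h | h
  · left
    intro x v w e
    rw [← hl, ap_comp, ap_comp] at e
    exact injective_of_mono l x (K.incl_injective x e)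
  · right
    exact fun x v => by
      obtain ⟨u, rfl⟩ := surjective_of_epi K.incl x v
      exact Sub.mem_range.mp (K.incl_mem u)

theorem Indec.eq_zero_or_id (hM : Indec k M) (hM' : IsLfdMod k M) (e : M ⟶ M) (he : e ≫ e = e) :
    e = 0 ∨ e = 𝟙 M := by
  have he' : ∀ x v, ap e x (ap e x v) = ap e x v := fun x v => by rw [← ap_comp, he]
  let R := Sub.range e
  let K := Sub.ker e
  let l₁ : M ⟶ R.toFun := R.lift e fun x v => ⟨v, rfl⟩
  let l₂ : M ⟶ K.toFun := K.lift (𝟙 M - e) fun x v => Sub.mem_ker.mpr (by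
    rw [ap_sub, map_sub, ap_id, he', sub_self])
  have hl₁ : l₁ ≫ R.incl = e := rfl
  have hl₂ : l₂ ≫ K.incl = 𝟙 M - e := rfl
  have := mono_of_injective _ R.incl_injective
  have := mono_of_injective _ K.incl_injective
  have hR : R.incl ≫ e = R.incl := hom_ext' fun x v => by
    obtain ⟨u, hu⟩ := Sub.mem_range.mp (R.incl_mem v)
    rw [ap_comp, ← hu, he']
  have hK : K.incl ≫ e = 0 := hom_ext' fun x v => by
    rw [ap_comp, ap_zero]
    exact Sub.mem_ker.mp (K.incl_mem v)
  have h11 : R.incl ≫ l₁ = 𝟙 _ := by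
    rw [← cancel_mono R.incl, Category.assoc, hl₁, hR, Category.id_comp]
  have h12 : R.incl ≫ l₂ = 0 := by
    rw [← cancel_mono K.incl, Category.assoc, hl₂, Preadditive.comp_sub, hR, Category.comp_id,
      sub_self, zero_comp]
  have h21 : K.incl ≫ l₁ = 0 := by
    rw [← cancel_mono R.incl, Category.assoc, hl₁, hK, zero_comp]
  have h22 : K.incl ≫ l₂ = 𝟙 _ := by
    rw [← cancel_mono K.incl, Category.assoc, hl₂, Preadditive.comp_sub, hK, Category.comp_id,
      sub_zero, Category.id_comp]
  let i : M ≅ R.toFun ⊞ K.toFun :=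
    { hom := biprod.lift l₁ l₂
      inv := biprod.desc R.incl K.incl
      hom_inv_id := by rw [biprod.lift_desc, hl₁, hl₂, add_sub_cancel]
      inv_hom_id := by
        apply biprod.hom_ext' <;> apply biprod.hom_ext <;> simp [h11, h12, h21, h22] }
  rcases hM.2 (hM'.of_injective _ R.incl_injective) (hM'.of_injective _ K.incl_injective) i with
    h | h
  · left
    rw [← hl₁, h.eq_zero_of_tgt l₁, zero_comp]
  · right
    rw [h.eq_zero_of_tgt l₂, zero_comp] at hl₂
    exact (sub_eq_zero.mp hl₂.symm).symm

/-- Only finitely many objects lie between two given objects. -/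
def IntervalsFinite (A : Type) [Category.{0} A] [Preadditive A] : Prop :=
  ∀ a b : A, {x | (∃ f : a ⟶ x, f ≠ 0) ∧ ∃ g : x ⟶ b, g ≠ 0}.Finite

theorem IntervalsFinite.op (hA : IntervalsFinite A) : IntervalsFinite Aᵒᵖ := by
  intro a b
  refine ((hA b.unop a.unop).image Opposite.op).subset ?_
  rintro x ⟨⟨f, hf⟩, g, hg⟩
  exact ⟨x.unop, ⟨⟨g.unop, fun h => hg (Quiver.Hom.unop_inj h)⟩, f.unop,
    fun h => hf (Quiver.Hom.unop_inj h)⟩, rfl⟩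

theorem IsMod.sum_act_matrix (hM : IsMod k M) {ι κ : Type} [Fintype ι] [Fintype κ] {a : ι → A}
    {b : κ → A} {x : A} (m : ∀ i, M.obj (a i)) (w : ∀ j i, a i ⟶ b j) (c : ∀ j, b j ⟶ x) :
    ∑ i, act M (∑ j, w j i ≫ c j) (m i) = ∑ j, act M (c j) (∑ i, act M (w j i) (m i)) := by
  simp only [hM.act_sum, act_comp, map_sum]
  exact Finset.sum_comm

/-- Modulo the image of a morphism with finitely generated cokernel, a finitely co-generated
kernel is finitely generated. -/
theorem exists_generators_ker {X Y Z : A ⥤ ModuleCat.{0} k} {f : X ⟶ Y} {g : Y ⟶ Z}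
    (hA : IntervalsFinite A) (hY : IsLfdMod k Y) (hf : CokFP f) (hg : KerFCG g) :
    ∃ (κ : Type) (_ : Fintype κ) (o : κ → A) (y : ∀ q, Y.obj (o q)), (∀ q, ap g _ (y q) = 0) ∧
      ∀ x v, ap g x v = 0 → ∃ (φ : ∀ q, o q ⟶ x) (u : X.obj x),
        v = ∑ q, act Y (φ q) (y q) + ap f x u := by
  classical
  obtain ⟨ι, -, _, _, a, -, m, -, hm, -, -⟩ := hf
  obtain ⟨J, _, b, ξ, hξ⟩ := hg
  let Ω : Set A := ⋃ i, ⋃ j, {x | (∃ f : a i ⟶ x, f ≠ 0) ∧ ∃ g : x ⟶ b j, g ≠ 0}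
  have : Finite Ω := Set.finite_iUnion fun i => Set.finite_iUnion fun j => hA _ _
  have := hY.2
  choose n s hs using fun x => Module.Finite.exists_fin (R := k) (M := LinearMap.ker (ap g x))
  have : Fintype (Σ x : Ω, Fin (n x.1)) := Fintype.ofFinite _
  refine ⟨Σ x : Ω, Fin (n x.1), inferInstance, fun q => q.1.1, fun q => (s q.1.1 q.2).1,
    fun q => (s q.1.1 q.2).2, fun x v hv => ?_⟩
  by_cases hx : x ∈ Ω
  · have h1 : ∀ v' : LinearMap.ker (ap g x), v' ∈ Submodule.span k (Set.range (s x)) →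
        ∃ φ : ∀ q : (Σ x : Ω, Fin (n x.1)), q.1.1 ⟶ x,
          v'.1 = ∑ q, act Y (φ q) (s q.1.1 q.2).1 := by
      intro v' hv'
      induction hv' using Submodule.span_induction with
      | mem v' h =>
        obtain ⟨t, rfl⟩ := h
        refine ⟨Pi.single (M := fun q : (Σ x : Ω, Fin (n x.1)) => q.1.1 ⟶ x) ⟨⟨x, hx⟩, t⟩ (𝟙 x),
          ?_⟩
        rw [Finset.sum_eq_single (⟨⟨x, hx⟩, t⟩ : Σ x : Ω, Fin (n x.1))]
        · rw [Pi.single_eq_same]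
          exact (act_id _ _).symm
        · intro q _ hq
          rw [Pi.single_eq_of_ne hq, hY.1.act_zero]
        · intro h
          exact absurd (Finset.mem_univ _) h
      | zero => exact ⟨fun q => 0, by simp [hY.1.act_zero]⟩
      | add v w _ _ hv hw =>
        obtain ⟨φ, hφ⟩ := hv
        obtain ⟨ψ, hψ⟩ := hw
        refine ⟨fun q => φ q + ψ q, ?_⟩
        simp only [hY.1.act_add, Finset.sum_add_distrib, ← hφ, ← hψ]
        rfl
      | smul r v _ hv =>
        obtain ⟨φ, hφ⟩ := hv
        refine ⟨fun q => r • φ q, ?_⟩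
        simp only [hY.1.act_smul, ← Finset.smul_sum, ← hφ]
        rfl
    obtain ⟨φ, hφ⟩ := h1 ⟨v, hv⟩ (by rw [hs]; trivial)
    exact ⟨φ, 0, by rw [map_zero, add_zero]; exact hφ⟩
  · refine ⟨fun q => 0, ?_⟩
    obtain ⟨r, u, hr⟩ := hm x v
    by_cases h0 : v = 0
    · exact ⟨0, by simp [hY.1.act_zero, h0]⟩
    · refine ⟨u, ?_⟩
      have hr0 : ∀ i, r i = 0 := by
        intro i
        by_contra hi
        refine h0 (hξ x v hv fun j φ => ?_)
        by_contra hφ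
        refine hx (Set.mem_iUnion.mpr ⟨i, Set.mem_iUnion.mpr ⟨j, ⟨r i, hi⟩, φ, ?_⟩⟩)
        rintro rfl
        rw [hY.1.act_zero, map_zero] at hφ
        exact hφ rfl
      simp only [hr0, hY.1.act_zero, Finset.sum_const_zero] at hr
      simp only [hY.1.act_zero, Finset.sum_const_zero]
      exact hr

theorem CokFP.of_blocks {h : M ⟶ N} (hN : IsMod k N) {ι ι' κ₁ κ₂ κ₃ : Type} [Fintype ι]
    [Fintype ι'] [Fintype κ₁] [Fintype κ₂] [Fintype κ₃] {a : ι → A} {a' : ι' → A} {b₁ : κ₁ → A}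
    {b₂ : κ₂ → A} {b₃ : κ₃ → A} (m : ∀ i, N.obj (a i)) (m' : ∀ i, N.obj (a' i))
    (w₁ : ∀ j i, a i ⟶ b₁ j) (w' : ∀ j i, a' i ⟶ b₁ j) (w₂ : ∀ j i, a i ⟶ b₂ j)
    (w₃ : ∀ j i, a i ⟶ b₃ j)
    (gen : ∀ x (v : N.obj x), ∃ (r : ∀ i, a i ⟶ x) (r' : ∀ i, a' i ⟶ x) (u : M.obj x),
      v = ∑ i, act N (r i) (m i) + ∑ i, act N (r' i) (m' i) + ap h x u)
    (rel₁ : ∀ j, ∃ u, ∑ i, act N (w₁ j i) (m i) + ∑ i, act N (w' j i) (m' i) = ap h (b₁ j) u)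
    (rel₂ : ∀ j, ∃ u, ∑ i, act N (w₂ j i) (m i) = ap h (b₂ j) u)
    (rel₃ : ∀ j, ∃ u, ∑ i, act N (w₃ j i) (m i) = ap h (b₃ j) u)
    (complete : ∀ x (r : ∀ i, a i ⟶ x) (r' : ∀ i, a' i ⟶ x) (u : M.obj x),
      ∑ i, act N (r i) (m i) + ∑ i, act N (r' i) (m' i) = ap h x u →
      ∃ (c₁ : ∀ j, b₁ j ⟶ x) (c₂ : ∀ j, b₂ j ⟶ x) (c₃ : ∀ j, b₃ j ⟶ x),
        (∀ i, r i = ∑ j, w₁ j i ≫ c₁ j + (∑ j, w₂ j i ≫ c₂ j + ∑ j, w₃ j i ≫ c₃ j)) ∧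
        ∀ i, r' i = ∑ j, w' j i ≫ c₁ j) : CokFP h := by
  refine ⟨ι ⊕ ι', κ₁ ⊕ (κ₂ ⊕ κ₃), inferInstance, inferInstance, Sum.elim a a',
    Sum.elim b₁ (Sum.elim b₂ b₃), Sum.rec m m',
    Sum.rec (fun j => Sum.rec (w₁ j) (w' j)) (Sum.rec
      (fun j => Sum.rec (w₂ j) fun _ => 0) (fun j => Sum.rec (w₃ j) fun _ => 0)),
    fun x v => ?_, ?_, fun x r u hr => ?_⟩
  · obtain ⟨r, r', u, e⟩ := gen x v
    exact ⟨Sum.rec r r', u, by rw [Fintype.sum_sum_type]; exact e⟩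
  · have hz : ∀ x, ∑ i, act N (0 : a' i ⟶ x) (m' i) = 0 := fun x =>
      Finset.sum_eq_zero fun i _ => hN.act_zero _
    rintro (j | j | j)
    · obtain ⟨u, e⟩ := rel₁ j
      exact ⟨u, (Fintype.sum_sum_type _).trans e⟩
    · obtain ⟨u, e⟩ := rel₂ j
      have e' : ∑ i, act N (w₂ j i) (m i) + ∑ i, act N (0 : a' i ⟶ b₂ j) (m' i)
          = ap h (b₂ j) u := by rw [hz, add_zero, e]
      exact ⟨u, (Fintype.sum_sum_type _).trans e'⟩
    · obtain ⟨u, e⟩ := rel₃ j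
      have e' : ∑ i, act N (w₃ j i) (m i) + ∑ i, act N (0 : a' i ⟶ b₃ j) (m' i)
          = ap h (b₃ j) u := by rw [hz, add_zero, e]
      exact ⟨u, (Fintype.sum_sum_type _).trans e'⟩
  · obtain ⟨c₁, c₂, c₃, e, e'⟩ := complete x (fun i => r (.inl i)) (fun i => r (.inr i)) u
      ((Fintype.sum_sum_type _).symm.trans hr)
    refine ⟨Sum.rec c₁ (Sum.rec c₂ c₃), ?_⟩
    rintro (i | i)
    · refine (e i).trans (((Fintype.sum_sum_type _).trans ?_).symm)
      exact congrArg _ (Fintype.sum_sum_type _)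
    · refine (e' i).trans (((Fintype.sum_sum_type _).trans ?_).symm)
      refine (congrArg _ (Finset.sum_eq_zero ?_)).trans (add_zero _)
      rintro (j | j) - <;> exact zero_comp

theorem CokFP.comp {X Y Z : A ⥤ ModuleCat.{0} k} {f : X ⟶ Y} {g : Y ⟶ Z}
    (hA : IntervalsFinite A) (hY : IsLfdMod k Y) (hZ : IsMod k Z) (hf : CokFP f) (hg : CokFP g)
    (hg' : KerFCG g) : CokFP (f ≫ g) := by
  obtain ⟨Q, _, o, y, hy0, hy⟩ := exists_generators_ker hA hY hf hg'
  obtain ⟨ι, κ, _, _, a, b, m, w, h1, h2, h3⟩ := hf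
  obtain ⟨ι', κ', _, _, a', b', m', w', h1', h2', h3'⟩ := hg
  choose y' hy' using h2'
  choose t ut ht using fun q => h1 _ (y q)
  choose α uα hα using fun j => h1 _ (y' j)
  refine CokFP.of_blocks hZ (fun i => ap g _ (m i)) m' (fun j i => - α j i) w' w t
    (fun x v => ?_) (fun j => ?_) (fun j => ?_) (fun q => ?_) (fun x r r' u hr => ?_)
  · obtain ⟨r', z, hz⟩ := h1' x v
    obtain ⟨r, u, hu⟩ := h1 x z
    refine ⟨r, r', u, ?_⟩
    rw [hz, hu]
    simp only [map_add, map_sum, ap_act, ap_comp]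
    abel
  · refine ⟨uα j, ?_⟩
    rw [hy', hα, map_add, map_sum]
    simp only [hZ.act_neg, Finset.sum_neg_distrib, ap_act, ap_comp]
    exact neg_add_cancel_left _ _
  · obtain ⟨u, hu⟩ := h2 j
    refine ⟨u, ?_⟩
    simp only [← ap_act, ← map_sum]
    rw [hu, ap_comp]
  · refine ⟨- ut q, ?_⟩
    have := hy0 q
    rw [ht, map_add, add_eq_zero_iff_eq_neg] at this
    simp only [← ap_act, ← map_sum]
    rw [this, ap_comp, map_neg, map_neg]
  · simp only [← ap_act, ← map_sum, ap_comp] at hr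
    obtain ⟨c', hc'⟩ := h3' x r' (ap f x u - ∑ i, act Y (r i) (m i)) (by
      rw [map_sub, ← hr, add_sub_cancel_left])
    have hc'' : ∑ i, act Z (r' i) (m' i) = ap g x (∑ j, act Y (c' j) (y' j)) := by
      simp only [hc']
      rw [hZ.sum_act_matrix, map_sum]
      simp only [hy', ap_act]
    rw [hc''] at hr
    obtain ⟨φ, u', hφ⟩ := hy x (∑ i, act Y (r i) (m i) + ∑ j, act Y (c' j) (y' j)
      - ap f x u) (by rw [map_sub, map_add, hr, sub_self])
    have e1 : ∑ j, act Y (c' j) (y' j) = ∑ i, act Y (∑ j, α j i ≫ c' j) (m i)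
        + ap f x (∑ j, act X (c' j) (uα j)) := by
      rw [hY.1.sum_act_matrix, map_sum, ← Finset.sum_add_distrib]
      refine Finset.sum_congr rfl fun j _ => ?_
      conv_lhs => rw [hα j]
      rw [map_add, ap_act]
    have e2 : ∑ q, act Y (φ q) (y q) = ∑ i, act Y (∑ q, t q i ≫ φ q) (m i)
        + ap f x (∑ q, act X (φ q) (ut q)) := by
      rw [hY.1.sum_act_matrix, map_sum, ← Finset.sum_add_distrib]
      refine Finset.sum_congr rfl fun q _ => ?_
      conv_lhs => rw [ht q]
      rw [map_add, ap_act]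
    rw [e1, e2] at hφ
    obtain ⟨c, hc⟩ := h3 x (fun i => r i + ∑ j, α j i ≫ c' j - ∑ q, t q i ≫ φ q)
      (u + u' + ∑ q, act X (φ q) (ut q) - ∑ j, act X (c' j) (uα j)) (by
        simp only [hY.1.act_sub, hY.1.act_add, Finset.sum_sub_distrib, Finset.sum_add_distrib]
        rw [map_sub, map_add, map_add]
        rw [sub_eq_iff_eq_add] at hφ ⊢
        rw [← add_assoc, ← eq_sub_iff_add_eq] at hφ
        rw [hφ]
        abel)
    refine ⟨c', c, φ, fun i => ?_, hc'⟩
    rw [← hc i]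
    simp only [Preadditive.neg_comp, Finset.sum_neg_distrib]
    abel

theorem Irred.cokFP_and_dual (hA : LiftsDerivations k A)
    (hF : ∀ a b : A, FiniteDimensional k (a ⟶ b)) {f : M ⟶ N} (hf : Irred k f)
    (hM : IsLfdMod k M) (hM' : Indec k M) (hN : IsLfdMod k N) (hN' : Indec k N) :
    CokFP f ∧ CokFP (dualHom f) := by
  rcases hf.injective_or_surjective hN with h | h
  · exact ⟨hf.cokFP hA hF hN h (hM'.eq_zero_or_id hM),
      .of_surjective (dualHom_surjective_of_injective h)⟩
  · exact ⟨.of_surjective h, (hf.dual hM hN).cokFP hA.op (finiteDimensional_op hF)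
      (isLfdMod_dual hM) (dualHom_injective_of_surjective h)
      (eq_zero_or_id_dual hN (hN'.eq_zero_or_id hN))⟩

theorem IrredChain.cokFP (hA : LiftsDerivations k A)
    (hF : ∀ a b : A, FiniteDimensional k (a ⟶ b)) (hI : IntervalsFinite A)
    {X Y : A ⥤ ModuleCat.{0} k} {h : X ⟶ Y} (hc : IrredChain k h) :
    (IsLfdMod k X ∧ Indec k X ∧ IsLfdMod k Y) ∧ CokFP h ∧ CokFP (dualHom h) := by
  induction hc with
  | single f hX hX' hY hY' hf => exact ⟨⟨hX, hX', hY⟩, hf.cokFP_and_dual hA hF hX hX' hY hY'⟩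
  | comp f g hX hX' hf _ ih =>
    obtain ⟨⟨hY, hY', hZ⟩, hg, hg'⟩ := ih
    obtain ⟨h1, h2⟩ := hf.cokFP_and_dual hA hF hX hX' hY hY'
    refine ⟨⟨hX, hX', hZ⟩, h1.comp hI hY hZ.1 hg hg'.kerFCG_of_dual, ?_⟩
    rw [dualHom_comp]
    exact hg'.comp hI.op (isLfdMod_dual hY) (isLfdMod_dual hX).1 h2 h1.kerFCG_dual


/-! ### Finitely presented cokernels and finitely co-presented kernels -/

section Biproduct

variable {ι : Type} [Fintype ι] {F : ι → A ⥤ ModuleCat.{0} k}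

theorem ap_sum {J : Type} (s : Finset J) (t : J → (M ⟶ N)) (x : A) (v : M.obj x) :
    ap (∑ j ∈ s, t j) x v = ∑ j ∈ s, ap (t j) x v := by
  classical
  induction s using Finset.induction_on with
  | empty => simp
  | insert j s hj ih => rw [Finset.sum_insert hj, Finset.sum_insert hj, ap_add, ih]

theorem ap_biproduct_desc (φ : ∀ i, F i ⟶ M) (x : A) (z : (⨁ F).obj x) :
    ap (biproduct.desc φ) x z = ∑ i, ap (φ i) x (ap (biproduct.π F i) x z) := by
  rw [biproduct.desc_eq, ap_sum]
  simp only [ap_comp]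

theorem biproduct_ext {x : A} {z z' : (⨁ F).obj x}
    (h : ∀ i, ap (biproduct.π F i) x z = ap (biproduct.π F i) x z') : z = z' := by
  have hz : ∀ z : (⨁ F).obj x, ∑ i, ap (biproduct.ι F i) x (ap (biproduct.π F i) x z) = z := by
    intro z
    rw [← ap_biproduct_desc, biproduct.desc_eq, biproduct.total, ap_id]
  rw [← hz z, ← hz z']
  simp only [h]

theorem exists_biproduct {x : A} (v : ∀ i, (F i).obj x) :
    ∃ z : (⨁ F).obj x, ∀ i, ap (biproduct.π F i) x z = v i := by
  classical
  refine ⟨∑ j, ap (biproduct.ι F j) x (v j), fun i => ?_⟩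
  rw [map_sum, Finset.sum_eq_single i, ← ap_comp, biproduct.ι_π_self, ap_id]
  · intro j _ hj
    rw [← ap_comp, biproduct.ι_π_ne F hj, ap_zero]
  · intro h
    exact absurd (Finset.mem_univ i) h

end Biproduct

theorem exists_kernel_ι {h : M ⟶ N} {x : A} {v : M.obj x} (hv : ap h x v = 0) :
    ∃ z, ap (kernel.ι h) x z = v := by
  let K := Sub.ker h
  have hK : K.incl ≫ h = 0 := hom_ext' fun x v => by
    rw [ap_comp, ap_zero]
    exact Sub.mem_ker.mp (K.incl_mem v)
  obtain ⟨w, hw⟩ := K.exists_incl (Sub.mem_ker.mpr hv)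
  exact ⟨ap (kernel.lift h K.incl hK) x w, by rw [← ap_comp, kernel.lift_ι, hw]⟩

theorem ap_kernel_ι {h : M ⟶ N} {x : A} (z : (kernel h).obj x) :
    ap h x (ap (kernel.ι h) x z) = 0 := by
  rw [← ap_comp, kernel.condition, ap_zero]

theorem exists_of_cokernel_π_eq_zero {h : M ⟶ N} {x : A} {v : N.obj x}
    (hv : ap (cokernel.π h) x v = 0) : ∃ u, ap h x u = v := by
  let K := Sub.range h
  have hK : h ≫ K.proj = 0 := hom_ext' fun x v => by
    rw [ap_comp, ap_zero]
    exact (Sub.proj_eq_zero K).mpr (Sub.mem_range.mpr ⟨v, rfl⟩)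
  have : ap K.proj x v = 0 := by
    rw [← cokernel.π_desc h K.proj hK, ap_comp, hv, map_zero]
  exact Sub.mem_range.mp ((Sub.proj_eq_zero K).mp this)

theorem ap_cokernel_π (h : M ⟶ N) {x : A} (v : M.obj x) :
    ap (cokernel.π h) x (ap h x v) = 0 := by
  rw [← ap_comp, cokernel.condition, ap_zero]

/-- The morphism from a projective module corresponding to an element. -/
noncomputable def projDesc (hM : IsMod k M) {a : A} (m : M.obj a) : ProjAt k a ⟶ M :=
  mkHom (fun x => (hM.actLin m : (a ⟶ x) →ₗ[k] M.obj x)) (fun f r => act_comp r f m)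

theorem isMod_projAt (a : A) : IsMod k (ProjAt k a) :=
  isMod_of_act (fun f g r => Preadditive.comp_add _ _ _ r f g)
    (fun c f r => Linear.comp_smul _ _ _ r c f)

/-- The morphism to an injective module corresponding to a functional. -/
noncomputable def injLift (hM : IsMod k M) {a : A} (ξ : Module.Dual k (M.obj a)) :
    M ⟶ InjAt k a :=
  mkHom (fun x =>
    (({ toFun := fun v => ξ ∘ₗ hM.actLin v
        map_add' := fun v w => LinearMap.ext fun g => by
          change ξ (act M g (v + w)) = ξ (act M g v) + ξ (act M g w)
          rw [map_add, map_add]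
        map_smul' := fun r v => LinearMap.ext fun g => by
          change ξ (act M g (r • v)) = r • ξ (act M g v)
          rw [map_smul, map_smul] } : M.obj x →ₗ[k] Module.Dual k (x ⟶ a))))
    (fun f v => LinearMap.ext fun g => congrArg ξ (act_comp f g v).symm)

/-- The evaluation of an element of an injective module at a morphism. -/
def injEv {a x : A} (η : (InjAt k a).obj x) : (x ⟶ a) →ₗ[k] k := η

theorem injAt_ext {a x : A} {η η' : (InjAt k a).obj x} (h : ∀ g, injEv η g = injEv η' g) :
    η = η' := LinearMap.ext h

theorem injEv_sum {ι : Type} [Fintype ι] {a x : A} (η : ι → (InjAt k a).obj x) (g : x ⟶ a) :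
    injEv (∑ i, η i) g = ∑ i, injEv (η i) g :=
  map_sum (LinearMap.applyₗ (R := k) g : Module.Dual k (x ⟶ a) →ₗ[k] k) η _

/-- The morphism of injective modules induced by a morphism of `A`. -/
noncomputable def injMap {a b : A} (w : b ⟶ a) : InjAt k a ⟶ InjAt k b :=
  mkHom (fun x => (Linear.rightComp k x w).dualMap)
    (fun f η => LinearMap.ext fun g => congrArg (injEv η) (Category.assoc f g w).symm)

theorem isFG_of_epi {ι : Type} [Finite ι] {a : ι → A} (f : (⨁ fun i => ProjAt k (a i)) ⟶ M)
    [Epi f] : IsFG k M := by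
  obtain ⟨n, ⟨e⟩⟩ := Finite.exists_equiv_fin ι
  exact ⟨n, a ∘ e.symm, (biproduct.reindex e.symm fun i => ProjAt k (a i)).hom ≫ f,
    epi_comp _ _⟩

theorem isFP_of_epi {ι : Type} [Finite ι] {a : ι → A} (f : (⨁ fun i => ProjAt k (a i)) ⟶ M)
    [Epi f] (hf : IsFG k (kernel f)) : IsFP k M := by
  obtain ⟨n, ⟨e⟩⟩ := Finite.exists_equiv_fin ι
  refine ⟨n, a ∘ e.symm, (biproduct.reindex e.symm fun i => ProjAt k (a i)).hom ≫ f,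
    epi_comp _ _, ?_⟩
  obtain ⟨r, b, g, _⟩ := hf
  exact ⟨r, b, g ≫ (kernelIsIsoComp _ f).inv, epi_comp _ _⟩

theorem isFCG_of_mono {ι : Type} [Finite ι] {a : ι → A} (f : M ⟶ ⨁ fun i => InjAt k (a i))
    [Mono f] : IsFCG k M := by
  obtain ⟨n, ⟨e⟩⟩ := Finite.exists_equiv_fin ι
  exact ⟨n, a ∘ e.symm, f ≫ (biproduct.reindex e.symm fun i => InjAt k (a i)).inv,
    mono_comp _ _⟩

theorem isFCP_of_mono {ι : Type} [Finite ι] {a : ι → A} (f : M ⟶ ⨁ fun i => InjAt k (a i))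
    [Mono f] (hf : IsFCG k (cokernel f)) : IsFCP k M := by
  obtain ⟨n, ⟨e⟩⟩ := Finite.exists_equiv_fin ι
  refine ⟨n, a ∘ e.symm, f ≫ (biproduct.reindex e.symm fun i => InjAt k (a i)).inv,
    mono_comp _ _, ?_⟩
  obtain ⟨r, b, g, _⟩ := hf
  exact ⟨r, b, (cokernelCompIsIso f _).hom ≫ g, mono_comp _ _⟩

theorem CokFP.isFP_cokernel {h : M ⟶ N} (hN : IsMod k N) (hh : CokFP h) :
    IsFP k (cokernel h) := by
  obtain ⟨ι, κ, _, _, a, b, m, w, h1, h2, h3⟩ := hh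
  let φ : (⨁ fun i => ProjAt k (a i)) ⟶ N := biproduct.desc fun i => projDesc hN (m i)
  have hφ : ∀ x z, ap φ x z = ∑ i, act N (ap (biproduct.π _ i) x z) (m i) :=
    fun x z => ap_biproduct_desc _ x z
  let ψ : (⨁ fun j => ProjAt k (b j)) ⟶ ⨁ fun i => ProjAt k (a i) :=
    biproduct.lift fun i => biproduct.desc fun j => projDesc (isMod_projAt (a i)) (w j i)
  have hψ : ∀ x z i, ap (biproduct.π _ i) x (ap ψ x z) =
      ∑ j, act (ProjAt k (a i)) (ap (biproduct.π _ j) x z) (w j i) := fun x z i => by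
    rw [← ap_comp, biproduct.lift_π]
    exact ap_biproduct_desc _ x z
  have hψφ : ψ ≫ φ ≫ cokernel.π h = 0 := by
    refine hom_ext' fun x z => ?_
    choose u hu using h2
    have : ap φ x (ap ψ x z) = ap h x (∑ j, act M (ap (biproduct.π _ j) x z) (u j)) := by
      rw [hφ, map_sum]
      simp only [hψ]
      refine (hN.sum_act_matrix m w fun j =>
        ap (biproduct.π (fun j => ProjAt k (b j)) j) x z).trans
          (Finset.sum_congr rfl fun j _ => ?_)
      rw [hu]
      exact (ap_act _ _ _).symm
    rw [ap_comp, ap_comp, this, ap_cokernel_π, ap_zero]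
  have : Epi (φ ≫ cokernel.π h) := by
    refine epi_of_surjective _ fun x v => ?_
    obtain ⟨y, rfl⟩ := surjective_of_epi (cokernel.π h) x v
    obtain ⟨r, u, rfl⟩ := h1 x y
    obtain ⟨z, hz⟩ := exists_biproduct (F := fun i => ProjAt k (a i)) (x := x) r
    refine ⟨z, ?_⟩
    rw [ap_comp, hφ, map_add, ap_cokernel_π, add_zero]
    simp only [hz]
  have : Epi (kernel.lift (φ ≫ cokernel.π h) ψ hψφ) := by
    refine epi_of_surjective _ fun x v => ?_
    have hv := ap_kernel_ι v
    rw [ap_comp] at hv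
    obtain ⟨u, hu⟩ := exists_of_cokernel_π_eq_zero hv
    rw [hφ] at hu
    obtain ⟨c, hc⟩ := h3 x _ u hu.symm
    obtain ⟨z, hz⟩ := exists_biproduct (F := fun j => ProjAt k (b j)) (x := x) c
    refine ⟨z, injective_of_mono (kernel.ι _) x ?_⟩
    rw [← ap_comp, kernel.lift_ι]
    refine biproduct_ext fun i => ?_
    rw [hψ]
    refine Eq.trans ?_ (hc i).symm
    refine Finset.sum_congr rfl fun j _ => ?_
    rw [hz]
    rfl
  exact isFP_of_epi (φ ≫ cokernel.π h) (isFG_of_epi (kernel.lift (φ ≫ cokernel.π h) ψ hψφ))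

theorem ev_sum_add {h : M ⟶ N} {ι : Type} [Fintype ι] {a : ι → Aᵒᵖ} {x : Aᵒᵖ}
    (r : ∀ i, a i ⟶ x) (m : ∀ i, (dual M).obj (a i)) (u : (dual N).obj x) (y : M.obj x.unop) :
    ev (∑ i, act (dual M) (r i) (m i) + ap (dualHom h) _ u) y =
      ∑ i, ev (m i) (act M (r i).unop y) + ev u (ap h x.unop y) := by
  let E : (dual M).obj x →ₗ[k] k :=
    (LinearMap.applyₗ (R := k) y : Module.Dual k (M.obj x.unop) →ₗ[k] k)
  have hE : ∀ ζ : (dual M).obj x, ev ζ y = E ζ := fun _ => rfl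
  rw [hE, map_add, map_sum]
  rfl

theorem exists_dualHom_eq_of_ker {h : M ⟶ N} {x : Aᵒᵖ} (ξ : (dual M).obj x)
    (hξ : ∀ v, ap h x.unop v = 0 → ev ξ v = 0) : ∃ u, ξ = ap (dualHom h) x u := by
  have h1 : ev ξ ∈ LinearMap.range (ap h x.unop).dualMap := by
    rw [LinearMap.range_dualMap_eq_dualAnnihilator_ker, Submodule.mem_dualAnnihilator]
    exact hξ
  obtain ⟨u, hu⟩ := h1
  exact ⟨u, hu.symm⟩

/-- Linear duality: a functional on a product that vanishes on the kernel of a map to the dual of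
a finite dimensional space is given by an element of that space. -/
theorem exists_eval_of_ker {R K : Type} [AddCommGroup R] [Module k R] [AddCommGroup K] [Module k K]
    [FiniteDimensional k K] (E : R →ₗ[k] Module.Dual k K) (η : Module.Dual k R)
    (h : ∀ r, E r = 0 → η r = 0) : ∃ v : K, ∀ r, η r = E r v := by
  have h1 : η ∈ LinearMap.range E.dualMap := by
    rw [LinearMap.range_dualMap_eq_dualAnnihilator_ker, Submodule.mem_dualAnnihilator]
    exact h
  obtain ⟨l, rfl⟩ := h1
  obtain ⟨v, rfl⟩ := (Module.evalEquiv k K).surjective l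
  exact ⟨v, fun r => rfl⟩

theorem CokFP.isFCP_kernel {h : M ⟶ N} (hM : IsLfdMod k M) (hh : CokFP (dualHom h)) :
    IsFCP k (kernel h) := by
  classical
  obtain ⟨ι, κ, _, _, a, b, m, w, h1, h2, h3⟩ := hh
  let φ : M ⟶ ⨁ fun i => InjAt k (a i).unop := biproduct.lift fun i => injLift hM.1 (ev (m i))
  have hφ : ∀ x v i g, injEv (ap (biproduct.π (fun i => InjAt k (a i).unop) i) x (ap φ x v)) g =
      ev (m i) (act M g v) := fun x v i g => by
    rw [← ap_comp, biproduct.lift_π]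
    rfl
  let ψ : (⨁ fun i => InjAt k (a i).unop) ⟶ ⨁ fun j => InjAt k (b j).unop :=
    biproduct.lift fun j => biproduct.desc fun i => injMap (w j i).unop
  have hψ : ∀ x z j g, injEv (ap (biproduct.π (fun j => InjAt k (b j).unop) j) x (ap ψ x z)) g =
      ∑ i, injEv (ap (biproduct.π (fun i => InjAt k (a i).unop) i) x z) (g ≫ (w j i).unop) :=
    fun x z j g => by
      rw [← ap_comp, biproduct.lift_π, ap_biproduct_desc]
      exact injEv_sum _ _
  have hφψ : (kernel.ι h ≫ φ) ≫ ψ = 0 := by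
    refine hom_ext' fun x y => biproduct_ext fun j => injAt_ext fun g => ?_
    obtain ⟨u, hu⟩ := h2 j
    rw [ap_comp, ap_comp, hψ, ap_zero, map_zero]
    simp only [hφ, act_comp]
    have := ev_sum_add (h := h) (w j) m 0 (act M g (ap (kernel.ι h) x y))
    rw [map_zero, add_zero, hu, ev_dualHom, ap_act, ap_kernel_ι, map_zero, map_zero] at this
    exact (this.trans (add_zero _)).symm
  have : Mono (kernel.ι h ≫ φ) := by
    refine mono_of_injective _ fun x => (injective_iff_map_eq_zero _).mpr fun y hy => ?_
    refine injective_of_mono (kernel.ι h) x ?_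
    rw [map_zero]
    refine eq_of_ev fun ξ => ?_
    obtain ⟨r, u, rfl⟩ := h1 _ ξ
    rw [map_zero, ev_sum_add, ap_kernel_ι, map_zero, add_zero]
    refine Finset.sum_eq_zero fun i _ => ?_
    have hy' : ap φ x (ap (kernel.ι h) x y) = 0 := by rw [← ap_comp]; exact hy
    have := hφ x (ap (kernel.ι h) x y) i (r i).unop
    rw [hy', map_zero] at this
    exact this.symm
  have : Mono (cokernel.desc (kernel.ι h ≫ φ) ψ hφψ) := by
    refine mono_of_injective _ fun x => (injective_iff_map_eq_zero _).mpr fun y hy => ?_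
    obtain ⟨z, rfl⟩ := surjective_of_epi (cokernel.π _) x y
    rw [← ap_comp, cokernel.π_desc] at hy
    have := hM.2 x
    let E : (∀ i, x ⟶ (a i).unop) →ₗ[k] Module.Dual k (LinearMap.ker (ap h x)) :=
      ∑ i, ((ap (injLift hM.1 (ev (m i))) x : M.obj x →ₗ[k] Module.Dual k (x ⟶ (a i).unop)) ∘ₗ
        (LinearMap.ker (ap h x)).subtype).flip ∘ₗ LinearMap.proj i
    have hE : ∀ r v, E r v = ∑ i, ev (m i) (act M (r i) v.1) := fun r v => by
      simp only [E, LinearMap.sum_apply]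
      rfl
    let η : Module.Dual k (∀ i, x ⟶ (a i).unop) :=
      ∑ i, injEv (ap (biproduct.π (fun i => InjAt k (a i).unop) i) x z) ∘ₗ LinearMap.proj i
    have hη : ∀ r, η r =
        ∑ i, injEv (ap (biproduct.π (fun i => InjAt k (a i).unop) i) x z) (r i) := fun r => by
      simp only [η, LinearMap.sum_apply]
      rfl
    obtain ⟨v, hv⟩ := exists_eval_of_ker E η fun r hr => by
      obtain ⟨u, hu⟩ := exists_dualHom_eq_of_ker (h := h) (x := Opposite.op x)
        (∑ i, act (dual M) (r i).op (m i)) fun v hv => by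
          have h4 := ev_sum_add (h := h) (x := Opposite.op x) (fun i => (r i).op) m 0 v
          rw [map_zero, add_zero] at h4
          rw [h4]
          have h5 := hE r ⟨v, hv⟩
          rw [hr] at h5
          exact (add_zero _).trans h5.symm
      obtain ⟨c, hc⟩ := h3 _ _ u hu
      have hc' : ∀ i, r i = ∑ j, (c j).unop ≫ (w j i).unop := fun i => by
        rw [← Quiver.Hom.unop_op (r i), hc i, unop_sum]
        rfl
      rw [hη]
      simp only [hc', map_sum]
      rw [Finset.sum_comm]
      refine Finset.sum_eq_zero fun j _ => ?_
      rw [← hψ, hy, map_zero]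
      rfl
    obtain ⟨v', hv'⟩ := exists_kernel_ι (h := h) (x := x) (v := v.1) v.2
    have : z = ap (kernel.ι h ≫ φ) x v' := by
      refine biproduct_ext fun i => injAt_ext fun g => ?_
      rw [ap_comp, hv', hφ]
      have h4 := hv (Pi.single (M := fun i => x ⟶ (a i).unop) i g)
      rw [hη, hE, Finset.sum_eq_single i, Finset.sum_eq_single i, Pi.single_eq_same] at h4
      · exact h4
      · intro j _ hj
        rw [Pi.single_eq_of_ne hj, hM.1.act_zero, map_zero]
      · intro h
        exact absurd (Finset.mem_univ i) h
      · intro j _ hj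
        rw [Pi.single_eq_of_ne hj, map_zero]
      · intro h
        exact absurd (Finset.mem_univ i) h
    rw [this, ap_cokernel_π]
  exact isFCP_of_mono (kernel.ι h ≫ φ)
    (isFCG_of_mono (cokernel.desc (kernel.ι h ≫ φ) ψ hφψ))


end Additive

section PathCategory

variable (k) {Q : Type} [Quiver.{0} Q]

/-- The basis of a morphism space of the path category given by the paths. -/
noncomputable def pathBasis (x y : Q) :
    Module.Basis (Quiver.Path x y) k (vtx k Q x ⟶ vtx k Q y) :=
  ⟨LinearEquiv.refl k (Quiver.Path x y →₀ k)⟩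

theorem pathBasis_nil (x : Q) : pathBasis k x x Quiver.Path.nil = 𝟙 (vtx k Q x) := rfl

theorem pathBasis_comp {x y z : Q} (p : Quiver.Path x y) (q : Quiver.Path y z) :
    pathBasis k x z (p.comp q) = pathBasis k x y p ≫ pathBasis k y z q := by
  have h := Free.single_comp_single k (C := Paths Q) (X := x) (Y := y) (Z := z) p q 1 1
  rw [mul_one] at h
  exact h.symm

theorem pathBasis_cons {x y z : Q} (p : Quiver.Path x y) (α : y ⟶ z) :
    pathBasis k x z (p.cons α) = pathBasis k x y p ≫ pathBasis k y z α.toPath :=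
  pathBasis_comp k p α.toPath

variable {k}

/-- The value on a path of the derivation with given values on arrows. -/
noncomputable def derivPath {B : Bimod k (PathCat k Q)}
    (δ : ∀ {x y : Q} (_ : x ⟶ y), B.V (vtx k Q x) (vtx k Q y)) {x : Q} :
    ∀ {y : Q}, Quiver.Path x y → B.V (vtx k Q x) (vtx k Q y)
  | _, .nil => 0
  | _, .cons p α => B.l (pathBasis k _ _ α.toPath) (derivPath δ p) + B.r (pathBasis k _ _ p) (δ α)

theorem derivPath_comp {B : Bimod k (PathCat k Q)}
    (δ : ∀ {x y : Q} (_ : x ⟶ y), B.V (vtx k Q x) (vtx k Q y))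
    {x y z : Q} (p : Quiver.Path x y) (q : Quiver.Path y z) :
    derivPath δ (p.comp q) =
      B.l (pathBasis k _ _ q) (derivPath δ p) + B.r (pathBasis k _ _ p) (derivPath δ q) := by
  induction q with
  | nil =>
    rw [pathBasis_nil, B.l_id, derivPath, map_zero, add_zero]
    rfl
  | cons q α ih =>
    rw [Quiver.Path.comp_cons, derivPath, ih, derivPath, pathBasis_cons, pathBasis_comp, B.l_comp,
      B.r_comp, map_add, map_add, B.l_r, add_assoc]

/-- The linear maps with given values on paths. -/
noncomputable def derivLin {B : Bimod k (PathCat k Q)}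
    (δ : ∀ {x y : Q} (_ : x ⟶ y), B.V (vtx k Q x) (vtx k Q y)) (x y : Q) :
    (vtx k Q x ⟶ vtx k Q y) →ₗ[k] B.V (vtx k Q x) (vtx k Q y) :=
  (pathBasis k x y).constr k (derivPath δ)

theorem derivLin_pathBasis {B : Bimod k (PathCat k Q)}
    (δ : ∀ {x y : Q} (_ : x ⟶ y), B.V (vtx k Q x) (vtx k Q y)) {x y : Q} (p : Quiver.Path x y) :
    derivLin δ x y (pathBasis k x y p) = derivPath δ p :=
  (pathBasis k x y).constr_basis k _ p

theorem derivLin_leibniz {B : Bimod k (PathCat k Q)}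
    (δ : ∀ {x y : Q} (_ : x ⟶ y), B.V (vtx k Q x) (vtx k Q y)) {x y z : Q}
    (f : vtx k Q x ⟶ vtx k Q y) (g : vtx k Q y ⟶ vtx k Q z) :
    derivLin δ x z (f ≫ g) = B.l g (derivLin δ x y f) + B.r f (derivLin δ y z g) := by
  have key : LinearMap.compr₂ (Linear.comp (vtx k Q x) (vtx k Q y) (vtx k Q z)) (derivLin δ x z) =
      (B.l.flip ∘ₗ derivLin δ x y) + (B.r.compl₂ (derivLin δ y z)) := by
    refine (pathBasis k x y).ext fun p => (pathBasis k y z).ext fun q => ?_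
    change derivLin δ x z (pathBasis k x y p ≫ pathBasis k y z q) =
      B.l (pathBasis k y z q) (derivLin δ x y (pathBasis k x y p)) +
      B.r (pathBasis k x y p) (derivLin δ y z (pathBasis k y z q))
    rw [← pathBasis_comp, derivLin_pathBasis, derivLin_pathBasis, derivLin_pathBasis,
      derivPath_comp]
  exact LinearMap.congr_fun (LinearMap.congr_fun key f) g

/-- The derivation with given values on arrows. -/
noncomputable def derivOfArrows {B : Bimod k (PathCat k Q)}
    (δ : ∀ {x y : Q} (_ : x ⟶ y), B.V (vtx k Q x) (vtx k Q y)) : Deriv B where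
  d {x y} := derivLin δ x y
  leibniz f g := derivLin_leibniz δ f g

theorem Deriv.id_eq_zero {A : Type} [Category.{0} A] [Preadditive A] [CategoryTheory.Linear k A]
    {B : Bimod k A} (D : Deriv B) (x : A) : D.d (𝟙 x) = 0 := by
  have h := D.leibniz (𝟙 x) (𝟙 x)
  rw [Category.id_comp, B.l_id, B.r_id] at h
  exact left_eq_add.mp h

theorem liftsDerivations_pathCat : LiftsDerivations k (PathCat k Q) := by
  intro B B' q hq hl hr D'
  choose s hs using hq
  let δ : ∀ {x y : Q} (_ : x ⟶ y), B.V (vtx k Q x) (vtx k Q y) := fun {x y} α =>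
    s _ _ (D'.d (pathBasis k x y α.toPath))
  have key : ∀ {x y : Q} (p : Quiver.Path x y), q (derivPath δ p) = D'.d (pathBasis k x y p) := by
    intro x y p
    induction p with
    | nil => rw [pathBasis_nil, D'.id_eq_zero, derivPath, map_zero]
    | cons p α ih => rw [derivPath, map_add, hl, hr, ih, hs, pathBasis_cons, D'.leibniz]
  have key' : ∀ x y : Q, q ∘ₗ derivLin δ x y = D'.d :=
    fun x y => (pathBasis k x y).ext fun p => by
      rw [LinearMap.comp_apply, derivLin_pathBasis, key]
  exact ⟨derivOfArrows δ, fun {x y} f => LinearMap.congr_fun (key' x y) f⟩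

theorem finiteDimensional_pathCat (hQ : IntervalFinite Q) (a b : PathCat k Q) :
    FiniteDimensional k (a ⟶ b) := by
  have := hQ a b
  exact Module.Finite.of_basis (pathBasis k (Q := Q) a b)

theorem exists_path_of_ne_zero {x y : Q} {f : vtx k Q x ⟶ vtx k Q y} (hf : f ≠ 0) :
    Nonempty (Quiver.Path x y) := by
  by_contra h
  rw [not_nonempty_iff] at h
  exact hf ((pathBasis k x y).ext_elem fun p => h.elim p)

theorem finite_between (hQ : IntervalFinite Q) (a b : Q) :
    {x : Q | Nonempty (Quiver.Path a x) ∧ Nonempty (Quiver.Path x b)}.Finite := by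
  have := hQ a b
  refine (Set.finite_iUnion fun p : Quiver.Path a b => List.finite_toSet p.vertices).subset ?_
  rintro x ⟨⟨p⟩, ⟨q⟩⟩
  refine Set.mem_iUnion.mpr ⟨p.comp q, ?_⟩
  change x ∈ (p.comp q).vertices
  rw [Quiver.Path.vertices_comp]
  exact List.mem_append_right _ q.start_mem_vertices

theorem intervalsFinite_pathCat (hQ : IntervalFinite Q) : IntervalsFinite (PathCat k Q) := by
  intro a b
  refine Set.Finite.subset (s := {x : PathCat k Q | Nonempty (Quiver.Path (V := Q) a x) ∧
    Nonempty (Quiver.Path (V := Q) x b)}) (finite_between hQ a b) ?_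
  rintro x ⟨⟨f, hf⟩, g, hg⟩
  exact ⟨exists_path_of_ne_zero (k := k) hf, exists_path_of_ne_zero (k := k) hg⟩

end PathCategory

end Modules

variable (k : Type) [Field k] [IsAlgClosed k]
variable (Q : Type) [Quiver.{0} Q]

/-- A composition of irreducible morphisms between indecomposable objects of `rep(Q)` has
finitely co-presented kernel and finitely presented cokernel. -/
theorem statement_16 (hQ : StronglyLocallyFinite Q)
    {X Y : PathCat k Q ⥤ ModuleCat.{0} k} (h : X ⟶ Y) (hchain : IrredChain k h) :
    IsFCP k (kernel h) ∧ IsFP k (cokernel h) := by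
  obtain ⟨⟨hX, -, hY⟩, h1, h2⟩ := hchain.cokFP liftsDerivations_pathCat
    (finiteDimensional_pathCat hQ.2) (intervalsFinite_pathCat hQ.2)
  exact ⟨h2.isFCP_kernel hX, h1.isFP_cokernel hY.1⟩

end Paper
end

section
/- Let k be an algebraically closed field and Q a strongly locally finite quiver. Suppose Q contains an infinite sourced path or an infinite sinked path p such that infinitely many vertices of p have degree at least three in Q. Then there is an indecomposable representation E in rep(Q) which does not lie in rrep(Q). -/
open CategoryTheory CategoryTheory.Limits

namespace Paper

variable (k : Type) [Field k]

section Helpers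

variable {k : Type} [Field k] {Q : Type} [Quiver.{0} Q]

/-- A path of `Q`, seen as a morphism of the path category. -/
noncomputable def pathHom {a b : Q} (p : Quiver.Path a b) : vtx k Q a ⟶ vtx k Q b :=
  (Free.embedding k (Paths Q)).map (X := (Paths.of Q).obj a) (Y := (Paths.of Q).obj b) p

theorem pathHom_nil (a : Q) :
    pathHom (k := k) (Quiver.Path.nil : Quiver.Path a a) = 𝟙 (vtx k Q a) := rfl

theorem pathHom_comp {a b c : Q} (p : Quiver.Path a b) (q : Quiver.Path b c) :
    pathHom (k := k) (p.comp q) = pathHom p ≫ pathHom q :=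
  (Free.embedding k (Paths Q)).map_comp (X := (Paths.of Q).obj a) (Y := (Paths.of Q).obj b)
    (Z := (Paths.of Q).obj c) p q

theorem pathHom_cons {a b c : Q} (p : Quiver.Path a b) (e : b ⟶ c) :
    pathHom (k := k) (p.cons e) = pathHom p ≫ arrHom k Q e :=
  pathHom_comp p e.toPath

/-- Morphisms of the path category are linear combinations of paths. -/
noncomputable def homEquiv (a b : Q) : (vtx k Q a ⟶ vtx k Q b) ≃ₗ[k] (Quiver.Path a b →₀ k) where
  toFun f := f
  invFun f := f
  map_add' _ _ := rfl
  map_smul' _ _ := rfl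
  left_inv _ := rfl
  right_inv _ := rfl

theorem homEquiv_pathHom {a b : Q} (p : Quiver.Path a b) :
    homEquiv a b (pathHom (k := k) p) = Finsupp.single p 1 := rfl

theorem hom_induction {a b : Q} {P : (vtx k Q a ⟶ vtx k Q b) → Prop} (f : vtx k Q a ⟶ vtx k Q b)
    (add : ∀ f g, P f → P g → P (f + g))
    (smul : ∀ (r : k) (p : Quiver.Path a b), P (r • pathHom p))
    (zero : P 0) : P f := by
  obtain ⟨f, rfl⟩ := (homEquiv a b).symm.surjective f
  induction f using Finsupp.induction_linear with
  | zero => rwa [map_zero]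
  | add f g hf hg => rw [map_add]; exact add _ _ hf hg
  | single p r =>
    have : (homEquiv a b).symm (Finsupp.single p r) = r • pathHom p := by
      rw [LinearEquiv.symm_apply_eq, map_smul, homEquiv_pathHom, Finsupp.smul_single, smul_eq_mul,
        mul_one]
    rw [this]; exact smul r p

theorem hom_ext_paths {M : Type*} [AddCommGroup M] [Module k M] {a b : Q}
    {F G : (vtx k Q a ⟶ vtx k Q b) →ₗ[k] M}
    (h : ∀ p : Quiver.Path a b, F (pathHom p) = G (pathHom p)) :
    F = G := by
  ext f
  induction f using hom_induction with
  | add f g hf hg => rw [map_add, map_add, hf, hg]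
  | smul r p => rw [map_smul, map_smul, h]
  | zero => rw [map_zero, map_zero]

theorem firstArrow_unique {a b c d : Q} (e : a ⟶ b) (f : a ⟶ c) (p : Quiver.Path b d)
    (q : Quiver.Path c d) (h : e.toPath.comp p = f.toPath.comp q) :
    (⟨b, e⟩ : Σ y : Q, a ⟶ y) = ⟨c, f⟩ := by
  induction p with
  | nil =>
    cases q with
    | nil =>
      have := eq_of_heq (Quiver.Path.hom_heq_of_cons_eq_cons h)
      rw [this]
    | cons q g =>
      have := congrArg Quiver.Path.length h
      simp at this
  | cons p g ih =>
    cases q with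
    | nil =>
      have := congrArg Quiver.Path.length h
      simp at this
    | cons q g' =>
      rw [Quiver.Path.comp_cons, Quiver.Path.comp_cons] at h
      obtain rfl := Quiver.Path.obj_eq_of_cons_eq_cons h
      exact ih q (eq_of_heq (Quiver.Path.heq_of_cons_eq_cons h))

theorem exists_firstArrow {a b : Q} (p : Quiver.Path a b) (h : a ≠ b) :
    ∃ (c : Q) (e : a ⟶ c) (q : Quiver.Path c b), p = e.toPath.comp q := by
  have hp : p.length ≠ 0 := fun h0 => h (Quiver.Path.eq_of_length_zero p h0)
  obtain ⟨n, hn⟩ := Nat.exists_eq_succ_of_ne_zero hp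
  obtain ⟨c, e, q, -, rfl⟩ := p.eq_toPath_comp_of_length_eq_succ hn
  exact ⟨c, e, q, rfl⟩

theorem exists_lastArrow {a b : Q} (p : Quiver.Path a b) (h : a ≠ b) :
    ∃ (c : Q) (q : Quiver.Path a c) (e : c ⟶ b), p = q.cons e := by
  cases p with
  | nil => exact absurd rfl h
  | cons q e => exact ⟨_, q, e, rfl⟩

/-- Remove the last arrow `β` of a path, sending paths not ending with `β` to zero. -/
noncomputable def stripLast {x y : Q} (β : x ⟶ y) (c : Q) :
    (vtx k Q c ⟶ vtx k Q y) →ₗ[k] (vtx k Q c ⟶ vtx k Q x) :=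
  (homEquiv c x).symm.toLinearMap ∘ₗ
    Finsupp.lcomapDomain (fun p : Quiver.Path c x => p.cons β)
      (fun _ _ h => eq_of_heq (Quiver.Path.heq_of_cons_eq_cons h)) ∘ₗ (homEquiv c y).toLinearMap

theorem stripLast_pathHom_cons {x y c : Q} (β : x ⟶ y) (p : Quiver.Path c x) :
    stripLast (k := k) β c (pathHom (p.cons β)) = pathHom p := by
  apply (homEquiv c x).injective
  simp only [stripLast, LinearMap.comp_apply, LinearEquiv.coe_coe, homEquiv_pathHom,
    LinearEquiv.apply_symm_apply]
  exact Finsupp.comapDomain_single (fun p : Quiver.Path c x => p.cons β) p (1 : k) _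

theorem stripLast_pathHom_of_ne {x y z c : Q} (β : x ⟶ y) (γ : z ⟶ y) (p : Quiver.Path c z)
    (h : (⟨z, γ⟩ : Σ z : Q, z ⟶ y) ≠ ⟨x, β⟩) :
    stripLast (k := k) β c (pathHom (p.cons γ)) = 0 := by
  apply (homEquiv c x).injective
  simp only [stripLast, LinearMap.comp_apply, LinearEquiv.coe_coe, homEquiv_pathHom,
    LinearEquiv.apply_symm_apply, map_zero]
  refine Finsupp.comapDomain_single_of_not_mem_range ?_ _ _
  rintro ⟨q, hq⟩
  obtain rfl := Quiver.Path.obj_eq_of_cons_eq_cons hq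
  exact h (by rw [eq_of_heq (Quiver.Path.hom_heq_of_cons_eq_cons hq)])

theorem stripLast_comp_arrHom {x y c : Q} (β : x ⟶ y) (f : vtx k Q c ⟶ vtx k Q x) :
    stripLast β c (f ≫ arrHom k Q β) = f := by
  have : stripLast β c ∘ₗ Linear.rightComp k _ (arrHom k Q β) = LinearMap.id :=
    hom_ext_paths fun p => by
      simp only [LinearMap.comp_apply, Linear.rightComp_apply]
      exact (congrArg _ (pathHom_cons p β).symm).trans (stripLast_pathHom_cons β p)
  exact LinearMap.congr_fun this f

theorem stripLast_comp {x y a c : Q} (β : x ⟶ y) (f : vtx k Q a ⟶ vtx k Q c)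
    (g : vtx k Q c ⟶ vtx k Q y) (hc : c ≠ y) :
    stripLast β a (f ≫ g) = f ≫ stripLast β c g := by
  have : ∀ p : Quiver.Path a c, stripLast β a ∘ₗ Linear.leftComp k _ (pathHom p) =
      Linear.leftComp k _ (pathHom p) ∘ₗ stripLast β c := fun p => hom_ext_paths fun q => by
    obtain ⟨z, q, e, rfl⟩ := exists_lastArrow q hc
    simp only [LinearMap.comp_apply, Linear.leftComp_apply]
    rw [← pathHom_comp, Quiver.Path.comp_cons]
    by_cases h : (⟨z, e⟩ : Σ z : Q, z ⟶ y) = ⟨x, β⟩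
    · cases h
      rw [stripLast_pathHom_cons, stripLast_pathHom_cons, pathHom_comp]
    · rw [stripLast_pathHom_of_ne _ _ _ h, stripLast_pathHom_of_ne _ _ _ h, comp_zero]
  have : stripLast β a ∘ₗ Linear.rightComp k _ g = Linear.rightComp k _ (stripLast β c g) :=
    hom_ext_paths fun p => LinearMap.congr_fun (this p) g
  exact LinearMap.congr_fun this f

/-- Remove the first arrow `β` of a path, sending paths not starting with `β` to zero. -/
noncomputable def stripFirst {x y : Q} (β : y ⟶ x) (c : Q) :
    (vtx k Q y ⟶ vtx k Q c) →ₗ[k] (vtx k Q x ⟶ vtx k Q c) :=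
  (homEquiv x c).symm.toLinearMap ∘ₗ
    Finsupp.lcomapDomain (fun p : Quiver.Path x c => β.toPath.comp p)
      (Quiver.Path.comp_injective_right _) ∘ₗ (homEquiv y c).toLinearMap

theorem stripFirst_pathHom_comp {x y c : Q} (β : y ⟶ x) (p : Quiver.Path x c) :
    stripFirst (k := k) β c (pathHom (β.toPath.comp p)) = pathHom p := by
  apply (homEquiv x c).injective
  simp only [stripFirst, LinearMap.comp_apply, LinearEquiv.coe_coe, homEquiv_pathHom,
    LinearEquiv.apply_symm_apply]
  exact Finsupp.comapDomain_single (fun p : Quiver.Path x c => β.toPath.comp p) p (1 : k) _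

theorem stripFirst_pathHom_of_ne {x y z c : Q} (β : y ⟶ x) (γ : y ⟶ z) (p : Quiver.Path z c)
    (h : (⟨z, γ⟩ : Σ z : Q, y ⟶ z) ≠ ⟨x, β⟩) :
    stripFirst (k := k) β c (pathHom (γ.toPath.comp p)) = 0 := by
  apply (homEquiv x c).injective
  simp only [stripFirst, LinearMap.comp_apply, LinearEquiv.coe_coe, homEquiv_pathHom,
    LinearEquiv.apply_symm_apply, map_zero]
  refine Finsupp.comapDomain_single_of_not_mem_range ?_ _ _
  rintro ⟨q, hq⟩
  exact h (firstArrow_unique _ _ _ _ hq.symm)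

theorem stripFirst_arrHom_comp {x y c : Q} (β : y ⟶ x) (f : vtx k Q x ⟶ vtx k Q c) :
    stripFirst β c (arrHom k Q β ≫ f) = f := by
  have : stripFirst β c ∘ₗ Linear.leftComp k _ (arrHom k Q β) = LinearMap.id :=
    hom_ext_paths fun p => by
      simp only [LinearMap.comp_apply, Linear.leftComp_apply]
      exact (congrArg _ (pathHom_comp β.toPath p).symm).trans (stripFirst_pathHom_comp β p)
  exact LinearMap.congr_fun this f

theorem stripFirst_comp {x y a c : Q} (β : y ⟶ x) (g : vtx k Q y ⟶ vtx k Q c)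
    (f : vtx k Q c ⟶ vtx k Q a) (hc : y ≠ c) :
    stripFirst β a (g ≫ f) = stripFirst β c g ≫ f := by
  have : ∀ p : Quiver.Path c a, stripFirst β a ∘ₗ Linear.rightComp k _ (pathHom p) =
      Linear.rightComp k _ (pathHom p) ∘ₗ stripFirst β c := fun p => hom_ext_paths fun q => by
    obtain ⟨z, e, q, rfl⟩ := exists_firstArrow q hc
    simp only [LinearMap.comp_apply, Linear.rightComp_apply]
    rw [← pathHom_comp, Quiver.Path.comp_assoc]
    by_cases h : (⟨z, e⟩ : Σ z : Q, y ⟶ z) = ⟨x, β⟩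
    · cases h
      rw [stripFirst_pathHom_comp, stripFirst_pathHom_comp, pathHom_comp]
    · rw [stripFirst_pathHom_of_ne _ _ _ h, stripFirst_pathHom_of_ne _ _ _ h, zero_comp]
  have : stripFirst β a ∘ₗ Linear.leftComp k _ g = Linear.leftComp k _ (stripFirst β c g) :=
    hom_ext_paths fun p => LinearMap.congr_fun (this p) g
  exact LinearMap.congr_fun this f

section Functors

variable {A : Type} [Category.{0} A]

theorem app_surjective {M N : A ⥤ ModuleCat.{0} k} (f : M ⟶ N) [Epi f] (a : A) :
    Function.Surjective (f.app a) :=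
  (ModuleCat.epi_iff_surjective _).1 inferInstance

theorem app_injective {M N : A ⥤ ModuleCat.{0} k} (f : M ⟶ N) [Mono f] (a : A) :
    Function.Injective (f.app a) :=
  (ModuleCat.mono_iff_injective _).1 inferInstance

theorem naturality_elem {M N : A ⥤ ModuleCat.{0} k} (f : M ⟶ N) {a b : A} (g : a ⟶ b)
    (v : M.obj a) : f.app b (M.map g v) = N.map g (f.app a v) :=
  ConcreteCategory.congr_hom (f.naturality g) v

theorem exists_preimage_of_exact {S : ShortComplex (A ⥤ ModuleCat.{0} k)} (hS : S.Exact) (a : A)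
    (v : S.X₂.obj a) (hv : S.g.app a v = 0) : ∃ u : S.X₁.obj a, S.f.app a u = v :=
  (ShortComplex.moduleCat_exact_iff _).1 (hS.map ((evaluation A (ModuleCat.{0} k)).obj a)) v hv

theorem biproduct_elem_ext {r : ℕ} {F : Fin r → (A ⥤ ModuleCat.{0} k)} {a : A}
    {v w : (⨁ F).obj a} (h : ∀ i, (biproduct.π F i).app a v = (biproduct.π F i).app a w) :
    v = w := by
  have key : ∀ u : (⨁ F).obj a,
      u = ∑ i, (biproduct.ι F i).app a ((biproduct.π F i).app a u) := fun u => by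
    have := congrArg (fun φ : (⨁ F) ⟶ ⨁ F => φ.app a u) (biproduct.total (f := F))
    simp only [NatTrans.app_sum, NatTrans.comp_app, NatTrans.id_app, ModuleCat.hom_sum,
      LinearMap.sum_apply, ModuleCat.comp_apply, ModuleCat.id_apply] at this
    exact this.symm
  rw [key v, key w]
  simp only [h]

theorem biproduct_exists_elem {r : ℕ} (F : Fin r → (A ⥤ ModuleCat.{0} k)) {a : A}
    (v : ∀ i, (F i).obj a) : ∃ w : (⨁ F).obj a, ∀ i, (biproduct.π F i).app a w = v i := by
  refine ⟨∑ j, (biproduct.ι F j).app a (v j), fun i => ?_⟩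
  rw [map_sum, Finset.sum_eq_single i]
  · rw [← ModuleCat.comp_apply, ← NatTrans.comp_app, biproduct.ι_π_self]
    rfl
  · intro j _ hj
    rw [← ModuleCat.comp_apply, ← NatTrans.comp_app, biproduct.ι_π_ne _ hj]
    rfl
  · simp

variable [Preadditive A] [CategoryTheory.Linear k A]

theorem isMod_of_mono {M N : A ⥤ ModuleCat.{0} k} (f : M ⟶ N) [Mono f] (hN : IsMod k N) :
    IsMod k M := by
  constructor
  · intro a b g h
    ext v
    apply app_injective f
    simp only [naturality_elem, hN.1, ModuleCat.hom_add, LinearMap.add_apply, map_add]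
  · intro a b r g
    ext v
    apply app_injective f
    simp only [naturality_elem, hN.2, ModuleCat.hom_smul, LinearMap.smul_apply, map_smul]

theorem isMod_of_epi {M N : A ⥤ ModuleCat.{0} k} (f : M ⟶ N) [Epi f] (hM : IsMod k M) :
    IsMod k N := by
  constructor
  · intro a b g h
    ext v
    obtain ⟨v, rfl⟩ := app_surjective f a v
    simp only [← naturality_elem, hM.1, ModuleCat.hom_add, LinearMap.add_apply, map_add]
  · intro a b r g
    ext v
    obtain ⟨v, rfl⟩ := app_surjective f a v
    simp only [← naturality_elem, hM.2, ModuleCat.hom_smul, LinearMap.smul_apply, map_smul]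

end Functors

section Generation

variable {A : Type} [Category.{0} A] [Preadditive A] [CategoryTheory.Linear k A]

/-- The coordinate of an element of a finite sum of projectives `Hom(a i, -)`. -/
noncomputable def projCoord {r : ℕ} (a : Fin r → A) (i : Fin r) (y : A) :
    (⨁ fun i => ProjAt k (a i)).obj y →ₗ[k] (a i ⟶ y) :=
  ((biproduct.π (fun i => ProjAt k (a i)) i).app y).hom

theorem projCoord_map {r : ℕ} (a : Fin r → A) (i : Fin r) {y z : A} (g : y ⟶ z)
    (w : (⨁ fun i => ProjAt k (a i)).obj y) :
    projCoord a i z ((⨁ fun i => ProjAt k (a i)).map g w) = projCoord a i y w ≫ g :=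
  naturality_elem (biproduct.π (fun i => ProjAt k (a i)) i) g w

/-- The generator of the summand `Hom(a i, -)`. -/
noncomputable def projGen {r : ℕ} (a : Fin r → A) (i : Fin r) :
    (⨁ fun i => ProjAt k (a i)).obj (a i) :=
  (biproduct.ι (fun i => ProjAt k (a i)) i).app (a i) (𝟙 (a i) : a i ⟶ a i)

theorem app_eq_sum_projGen {r : ℕ} (a : Fin r → A) {M : A ⥤ ModuleCat.{0} k}
    (f : (⨁ fun i => ProjAt k (a i)) ⟶ M) {y : A} (w : (⨁ fun i => ProjAt k (a i)).obj y) :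
    f.app y w = ∑ i, M.map (projCoord a i y w) (f.app (a i) (projGen a i)) := by
  have := congrArg (fun φ : (⨁ fun i => ProjAt k (a i)) ⟶ _ => φ.app y w)
    (biproduct.total (f := fun i => ProjAt k (a i)))
  simp only [NatTrans.app_sum, NatTrans.comp_app, NatTrans.id_app, ModuleCat.hom_sum,
    LinearMap.sum_apply, ModuleCat.comp_apply, ModuleCat.id_apply] at this
  conv_lhs => rw [← this]
  rw [map_sum]
  refine Finset.sum_congr rfl fun i _ => ?_
  rw [← naturality_elem]
  refine congrArg (f.app y) (Eq.trans ?_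
    (naturality_elem (biproduct.ι (fun i => ProjAt k (a i)) i) (projCoord a i y w) _))
  exact congrArg ((biproduct.ι (fun i => ProjAt k (a i)) i).app y)
    (Category.id_comp (projCoord a i y w)).symm

theorem IsFG.exists_generators {M : A ⥤ ModuleCat.{0} k} (hM : IsFG k M) :
    ∃ (r : ℕ) (a : Fin r → A) (m : ∀ i, M.obj (a i)), ∀ (y : A) (v : M.obj y),
      ∃ h : ∀ i, a i ⟶ y, v = ∑ i, M.map (h i) (m i) := by
  obtain ⟨r, a, f, hf⟩ := hM
  refine ⟨r, a, fun i => f.app (a i) (projGen a i), fun y v => ?_⟩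
  obtain ⟨w, rfl⟩ := app_surjective f y v
  exact ⟨fun i => projCoord a i y w, app_eq_sum_projGen a f w⟩

/-- The coordinate of an element of a finite sum of injectives `D Hom(-, b j)`. -/
noncomputable def injCoord {s : ℕ} (b : Fin s → A) (j : Fin s) (y : A) :
    (⨁ fun j => InjAt k (b j)).obj y →ₗ[k] Module.Dual k (y ⟶ b j) :=
  ((biproduct.π (fun j => InjAt k (b j)) j).app y).hom

theorem injCoord_map {s : ℕ} (b : Fin s → A) (j : Fin s) {y z : A} (g : y ⟶ z)
    (w : (⨁ fun j => InjAt k (b j)).obj y) (h : z ⟶ b j) :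
    injCoord b j z ((⨁ fun j => InjAt k (b j)).map g w) h = injCoord b j y w (g ≫ h) :=
  LinearMap.congr_fun
    (naturality_elem (biproduct.π (fun j => InjAt k (b j)) j) g w) h

theorem IsFCG.exists_cogenerators {M : A ⥤ ModuleCat.{0} k} (hM : IsFCG k M) :
    ∃ (s : ℕ) (b : Fin s → A), ∀ (y : A) (v : M.obj y),
      (∀ (j : Fin s) (g : y ⟶ b j), M.map g v = 0) → v = 0 := by
  obtain ⟨s, b, f, hf⟩ := hM
  refine ⟨s, b, fun y v hv => ?_⟩
  apply app_injective f
  rw [map_zero]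
  refine biproduct_elem_ext fun j => ?_
  rw [map_zero]
  refine LinearMap.ext fun g => ?_
  have : injCoord b j y (f.app y v) g = 0 := by
    rw [← Category.comp_id g, ← injCoord_map, ← naturality_elem, hv, map_zero, map_zero,
      LinearMap.zero_apply]
  exact this

end Generation

theorem IsFP.finite_exceptions {L : PathCat k Q ⥤ ModuleCat.{0} k} (hL : IsFP k L) :
    ∃ F : Set Q, F.Finite ∧ ∀ (x y : Q) (β : x ⟶ y), y ∉ F → L.map (arrHom k Q β) = 0 →
      ∀ v : L.obj (vtx k Q x), v = 0 := by
  obtain ⟨r, a, f, hf, s, c, g, hg⟩ := hL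
  refine ⟨Set.range (fun j => (c j : Q)), Set.finite_range _, fun x y β hy hβ v => ?_⟩
  let P := ⨁ fun i => ProjAt k (a i)
  have hS : ∀ w : P.obj (vtx k Q y), ∃ u : P.obj (vtx k Q x), ∀ i,
      projCoord a i _ u = stripLast β (a i) (projCoord a i _ w) := fun w =>
    biproduct_exists_elem (fun i => ProjAt k (a i))
      (fun i => stripLast β (a i) (projCoord a i _ w))
  choose S hS using hS
  have hSβ : ∀ u : P.obj (vtx k Q x), S (P.map (arrHom k Q β) u) = u := fun u =>
    biproduct_elem_ext fun i =>
      ((hS _ i).trans (by rw [projCoord_map]; exact stripLast_comp_arrHom β _) :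
        projCoord a i _ _ = projCoord a i _ u)
  have hScomp : ∀ (d : Q) (h : vtx k Q d ⟶ vtx k Q y) (w : P.obj (vtx k Q d)), d ≠ y →
      S (P.map h w) = P.map (stripLast β d h) w := fun d h w hd =>
    biproduct_elem_ext fun i =>
      ((hS _ i).trans (by rw [projCoord_map, projCoord_map]; exact stripLast_comp β _ _ hd) :
        projCoord a i _ _ = projCoord a i _ (P.map (stripLast β d h) w))
  have hSsum : ∀ w : Fin s → P.obj (vtx k Q y), S (∑ j, w j) = ∑ j, S (w j) := fun w =>
    biproduct_elem_ext fun i =>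
      ((hS _ i).trans (by simp only [map_sum, hS]; exact map_sum _ _ _) :
        projCoord a i _ _ = projCoord a i _ (∑ j, S (w j)))
  obtain ⟨u, rfl⟩ := app_surjective f _ v
  have h0 : f.app _ (P.map (arrHom k Q β) u) = 0 := by
    rw [naturality_elem, hβ]; rfl
  obtain ⟨w, hw⟩ := exists_preimage_of_exact (ShortComplex.exact_kernel f) _ _ h0
  obtain ⟨w, rfl⟩ := app_surjective g _ w
  let h := g ≫ kernel.ι f
  have hw' : P.map (arrHom k Q β) u =
      ∑ j, P.map (projCoord c j _ w) (h.app (c j) (projGen c j)) :=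
    hw.symm.trans (app_eq_sum_projGen c h w)
  have hu : u = ∑ j, P.map (stripLast β (c j) (projCoord c j _ w)) (h.app (c j) (projGen c j)) := by
    rw [← hSβ u, hw', hSsum]
    exact Finset.sum_congr rfl fun j _ => hScomp _ _ _ fun hj => hy ⟨j, hj⟩
  have hfh : ∀ (z : PathCat k Q) (e), f.app z (h.app z e) = 0 := fun z e => by
    have : h ≫ f = 0 := by simp [h]
    exact ConcreteCategory.congr_hom (congrArg (fun φ => NatTrans.app φ z) this) e
  rw [hu, map_sum]
  exact Finset.sum_eq_zero fun j _ =>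
    (naturality_elem f _ _).trans ((congrArg _ (hfh _ _)).trans (map_zero _))

theorem IsFCP.finite_exceptions {N : PathCat k Q ⥤ ModuleCat.{0} k} (hN : IsFCP k N) :
    ∃ F : Set Q, F.Finite ∧ ∀ (x y : Q) (β : y ⟶ x), y ∉ F → N.map (arrHom k Q β) = 0 →
      ∀ v : N.obj (vtx k Q x), v = 0 := by
  obtain ⟨s, b, f, hf, hC⟩ := hN
  obtain ⟨t, c, hc⟩ := hC.exists_cogenerators
  refine ⟨Set.range (fun j => (c j : Q)), Set.finite_range _, fun x y β hy hβ v => ?_⟩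
  let I := ⨁ fun j => InjAt k (b j)
  obtain ⟨w, hw⟩ : ∃ w : I.obj (vtx k Q y), ∀ j,
      injCoord b j _ w = injCoord b j _ (f.app _ v) ∘ₗ stripFirst β (b j) :=
    biproduct_exists_elem (fun j => InjAt k (b j))
      (fun j => injCoord b j _ (f.app _ v) ∘ₗ stripFirst β (b j))
  have hwβ : I.map (arrHom k Q β) w = f.app _ v :=
    biproduct_elem_ext fun j => (LinearMap.ext fun h => by
      rw [injCoord_map, hw]
      exact congrArg _ (stripFirst_arrHom_comp β h) : injCoord b j _ _ = injCoord b j _ _)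
  have hwcomp : ∀ (d : Q) (g : vtx k Q y ⟶ vtx k Q d), y ≠ d →
      I.map g w = I.map (stripFirst β d g) (f.app _ v) := fun d g hd =>
    biproduct_elem_ext fun j => (LinearMap.ext fun h => by
      rw [injCoord_map, injCoord_map, hw]
      exact congrArg _ (stripFirst_comp β g h hd) : injCoord b j _ _ = injCoord b j _ _)
  have hfπ : ∀ (z : PathCat k Q) (e), (cokernel.π f).app z (f.app z e) = 0 := fun z e => by
    have : f ≫ cokernel.π f = 0 := by simp
    exact ConcreteCategory.congr_hom (congrArg (fun φ => NatTrans.app φ z) this) e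
  have hw0 : (cokernel.π f).app _ w = 0 := hc _ _ fun j g => by
    have := hwcomp (c j) g fun hj => hy ⟨j, hj.symm⟩
    rw [← naturality_elem]
    exact (congrArg _ this).trans
      ((naturality_elem (cokernel.π f) _ _).trans ((congrArg _ (hfπ _ _)).trans (map_zero _)))
  obtain ⟨n, rfl⟩ := exists_preimage_of_exact (ShortComplex.exact_cokernel f) _ _ hw0
  apply app_injective f
  rw [← hwβ, map_zero]
  refine (naturality_elem f _ n).symm.trans ?_
  rw [hβ]
  exact map_zero _

theorem IsMod.map_zero' {M : PathCat k Q ⥤ ModuleCat.{0} k} (hM : IsMod k M) {a b : PathCat k Q} :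
    M.map (0 : a ⟶ b) = 0 := by
  have := hM.2 (0 : k) (0 : a ⟶ b)
  rwa [zero_smul, zero_smul] at this

theorem IsMod.map_eq_zero {M : PathCat k Q ⥤ ModuleCat.{0} k} (hM : IsMod k M) {a b : Q}
    (h : ∀ p : Quiver.Path a b, M.map (pathHom p) = 0) (g : vtx k Q a ⟶ vtx k Q b) :
    M.map g = 0 := by
  induction g using hom_induction with
  | add f g hf hg => rw [hM.1, hf, hg, add_zero]
  | smul r p => rw [hM.2, h, smul_zero]
  | zero => exact hM.map_zero'

theorem IsMod.map_eq_zero_of_target {M : PathCat k Q ⥤ ModuleCat.{0} k} (hM : IsMod k M) {y : Q}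
    (h : ∀ (z : Q) (γ : z ⟶ y), M.map (arrHom k Q γ) = 0) {a : Q} (ha : a ≠ y)
    (g : vtx k Q a ⟶ vtx k Q y) : M.map g = 0 :=
  hM.map_eq_zero (fun p => by
    obtain ⟨c, q, e, rfl⟩ := exists_lastArrow p ha
    rw [pathHom_cons, M.map_comp, h, comp_zero]) g

theorem IsMod.map_eq_zero_of_source {M : PathCat k Q ⥤ ModuleCat.{0} k} (hM : IsMod k M) {y : Q}
    (h : ∀ (z : Q) (γ : y ⟶ z), M.map (arrHom k Q γ) = 0) {b : Q} (hb : y ≠ b)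
    (g : vtx k Q y ⟶ vtx k Q b) : M.map g = 0 :=
  hM.map_eq_zero (fun p => by
    obtain ⟨c, e, q, rfl⟩ := exists_firstArrow p hb
    have : pathHom (k := k) e.toPath = arrHom k Q e := rfl
    rw [pathHom_comp, M.map_comp, this, h, zero_comp]) g

theorem IsFG.finite_exceptions {L : PathCat k Q ⥤ ModuleCat.{0} k} (hL : IsFG k L)
    (hmod : IsMod k L) : ∃ F : Set Q, F.Finite ∧ ∀ y : Q, y ∉ F →
      (∀ (z : Q) (γ : z ⟶ y), L.map (arrHom k Q γ) = 0) → ∀ v : L.obj (vtx k Q y), v = 0 := by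
  obtain ⟨r, a, m, h⟩ := hL.exists_generators
  refine ⟨Set.range (fun i => (a i : Q)), Set.finite_range _, fun y hy hγ v => ?_⟩
  obtain ⟨g, rfl⟩ := h _ v
  exact Finset.sum_eq_zero fun i _ => ConcreteCategory.congr_hom
    (hmod.map_eq_zero_of_target (a := a i) hγ (fun hi => hy ⟨i, hi⟩) (g i)) _

theorem IsFCG.finite_exceptions {N : PathCat k Q ⥤ ModuleCat.{0} k} (hN : IsFCG k N)
    (hmod : IsMod k N) : ∃ F : Set Q, F.Finite ∧ ∀ y : Q, y ∉ F →
      (∀ (z : Q) (γ : y ⟶ z), N.map (arrHom k Q γ) = 0) → ∀ v : N.obj (vtx k Q y), v = 0 := by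
  obtain ⟨s, b, h⟩ := hN.exists_cogenerators
  exact ⟨Set.range (fun i => (b i : Q)), Set.finite_range _, fun y hy hγ v => h _ v fun j g =>
    ConcreteCategory.congr_hom
      (hmod.map_eq_zero_of_source (b := b j) hγ (fun hj => hy ⟨j, hj.symm⟩) g) _⟩

theorem exists_path_of_ray {x : ℕ → Q} (p : ∀ n, x n ⟶ x (n + 1)) (n : ℕ) :
    ∃ q : Quiver.Path (x 0) (x n), q.length = n := by
  induction n with
  | zero => exact ⟨.nil, rfl⟩
  | succ n ih =>
    obtain ⟨q, hq⟩ := ih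
    exact ⟨q.cons (p n), by rw [Quiver.Path.length_cons, hq]⟩

theorem exists_path_of_coray {x : ℕ → Q} (p : ∀ n, x (n + 1) ⟶ x n) (n : ℕ) :
    ∃ q : Quiver.Path (x n) (x 0), q.length = n := by
  induction n with
  | zero => exact ⟨.nil, rfl⟩
  | succ n ih =>
    obtain ⟨q, hq⟩ := ih
    exact ⟨(p n).toPath.comp q, by
      rw [Quiver.Path.length_comp, Quiver.Path.length_toPath, hq, add_comm]⟩

theorem exists_length_lt (hQ : IntervalFinite Q) (a b : Q) :
    ∃ n : ℕ, ∀ p : Quiver.Path a b, p.length < n := by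
  have := hQ a b
  obtain ⟨n, hn⟩ := (Set.finite_range (fun p : Quiver.Path a b => p.length)).bddAbove
  exact ⟨n + 1, fun p => Nat.lt_succ_of_le (hn ⟨p, rfl⟩)⟩

theorem IsFG.eventually_zero (hQ : IntervalFinite Q) {L : PathCat k Q ⥤ ModuleCat.{0} k}
    (hL : IsFG k L) (hmod : IsMod k L) {x : ℕ → Q} (p : ∀ n, x (n + 1) ⟶ x n) :
    ∃ m : ℕ, ∀ n ≥ m, ∀ v : L.obj (vtx k Q (x n)), v = 0 := by
  obtain ⟨r, a, e, h⟩ := hL.exists_generators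
  choose m hm using fun i => exists_length_lt hQ (a i) (x 0)
  refine ⟨∑ i, m i, fun n hn v => ?_⟩
  obtain ⟨g, rfl⟩ := h _ v
  refine Finset.sum_eq_zero fun i _ => ConcreteCategory.congr_hom
    (hmod.map_eq_zero (a := a i) (fun q => ?_) (g i)) _
  obtain ⟨q', hq'⟩ := exists_path_of_coray p n
  have h1 := (Quiver.Path.length_comp q q').symm.trans_lt (hm i (q.comp q'))
  have h2 := Finset.single_le_sum (f := m) (fun _ _ => Nat.zero_le _) (Finset.mem_univ i)
  omega

theorem IsFCG.eventually_zero (hQ : IntervalFinite Q) {N : PathCat k Q ⥤ ModuleCat.{0} k}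
    (hN : IsFCG k N) (hmod : IsMod k N) {x : ℕ → Q} (p : ∀ n, x n ⟶ x (n + 1)) :
    ∃ m : ℕ, ∀ n ≥ m, ∀ v : N.obj (vtx k Q (x n)), v = 0 := by
  obtain ⟨s, b, h⟩ := hN.exists_cogenerators
  choose m hm using fun j => exists_length_lt hQ (x 0) (b j)
  refine ⟨∑ j, m j, fun n hn v => h _ v fun j g => ConcreteCategory.congr_hom
    (hmod.map_eq_zero (b := b j) (fun q => ?_) g) _⟩
  obtain ⟨q', hq'⟩ := exists_path_of_ray p n
  have h1 := (Quiver.Path.length_comp q' q).symm.trans_lt (hm j (q'.comp q))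
  have h2 := Finset.single_le_sum (f := m) (fun _ _ => Nat.zero_le _) (Finset.mem_univ j)
  omega

theorem IsFP.isFG {L : PathCat k Q ⥤ ModuleCat.{0} k} (hL : IsFP k L) : IsFG k L := by
  obtain ⟨r, a, f, hf, -⟩ := hL
  exact ⟨r, a, f, hf⟩

theorem IsFCP.isFCG {N : PathCat k Q ⥤ ModuleCat.{0} k} (hN : IsFCP k N) : IsFCG k N := by
  obtain ⟨s, b, f, hf, -⟩ := hN
  exact ⟨s, b, f, hf⟩

/-- The part of membership in `rrep(Q)` which does not involve the exceptional arrows: an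
extension of a finitely co-presented by a finitely presented representation. -/
theorem InRrep.exists_extension {M : PathCat k Q ⥤ ModuleCat.{0} k} (hM : InRrep k Q M)
    (hmod : IsMod k M) : ∃ L N : PathCat k Q ⥤ ModuleCat.{0} k, IsMod k L ∧ IsMod k N ∧
      IsFP k L ∧ IsFCP k N ∧
      (∀ a b (g : a ⟶ b), M.map g = 0 → L.map g = 0 ∧ N.map g = 0) ∧
      ∀ a, (∀ v : L.obj a, v = 0) → (∀ v : N.obj a, v = 0) → ∀ v : M.obj a, v = 0 := by
  obtain ⟨L, N, f, g, zero, hf, hg, hex, hL, hN, -⟩ := hM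
  refine ⟨L, N, isMod_of_mono f hmod, isMod_of_epi g hmod, hL, hN, fun a b h hh => ⟨?_, ?_⟩,
    fun a hLa hNa v => ?_⟩
  · ext v
    apply app_injective f
    rw [naturality_elem, hh]
    exact (map_zero _).symm
  · ext v
    obtain ⟨v, rfl⟩ := app_surjective g _ v
    rw [← naturality_elem, hh]
    exact map_zero _
  · obtain ⟨u, rfl⟩ := exists_preimage_of_exact hex a v (hNa _)
    rw [hLa u]
    exact map_zero _

section Thin

variable (k) (V : Set Q) (S : Set (Σ (x : Q) (y : Q), x ⟶ y))

open Classical in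
/-- The value at a vertex of the thin representation supported on `V`. -/
noncomputable def thinObj (v : Q) : Submodule k k := if v ∈ V then ⊤ else ⊥

open Classical in
/-- The action of an arrow on a thin representation: the identity of `k` where possible if the
arrow is in `S`, and zero otherwise. -/
noncomputable def thinMap {a b : Q} (α : a ⟶ b) : thinObj k V a →ₗ[k] thinObj k V b :=
  if h : ⟨a, b, α⟩ ∈ S ∧ b ∈ V then
    (thinObj k V a).subtype.codRestrict (thinObj k V b) (fun _ => by simp [thinObj, h.2])
  else 0

/-- The action of a path on a thin representation. -/
noncomputable def thinPath {a : Q} :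
    ∀ {b : Q}, Quiver.Path a b → (thinObj k V a →ₗ[k] thinObj k V b)
  | _, .nil => LinearMap.id
  | _, .cons p α => thinMap k V S α ∘ₗ thinPath p

theorem thinPath_comp {a b c : Q} (p : Quiver.Path a b) (q : Quiver.Path b c) :
    thinPath k V S (p.comp q) = thinPath k V S q ∘ₗ thinPath k V S p := by
  induction q with
  | nil => rfl
  | cons q α ih => rw [Quiver.Path.comp_cons, thinPath, ih, thinPath, LinearMap.comp_assoc]

/-- The action of a morphism of the path category on a thin representation. -/
noncomputable def thinHom (a b : Q) :
    (vtx k Q a ⟶ vtx k Q b) →ₗ[k] (thinObj k V a →ₗ[k] thinObj k V b) :=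
  Finsupp.linearCombination k (thinPath k V S) ∘ₗ (homEquiv a b).toLinearMap

theorem thinHom_pathHom {a b : Q} (p : Quiver.Path a b) :
    thinHom k V S a b (pathHom p) = thinPath k V S p := by
  rw [thinHom, LinearMap.comp_apply, LinearEquiv.coe_coe, homEquiv_pathHom,
    Finsupp.linearCombination_single, one_smul]

theorem thinHom_comp {a b c : Q} (f : vtx k Q a ⟶ vtx k Q b) (g : vtx k Q b ⟶ vtx k Q c) :
    thinHom k V S a c (f ≫ g) = thinHom k V S b c g ∘ₗ thinHom k V S a b f := by
  have : ∀ p : Quiver.Path a b, thinHom k V S a c ∘ₗ Linear.leftComp k _ (pathHom p) =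
      LinearMap.lcomp k _ (thinHom k V S a b (pathHom p)) ∘ₗ thinHom k V S b c :=
    fun p => hom_ext_paths fun q => by
      simp only [LinearMap.comp_apply, Linear.leftComp_apply, LinearMap.lcomp_apply']
      rw [← pathHom_comp, thinHom_pathHom, thinHom_pathHom, thinHom_pathHom, thinPath_comp]
  have : thinHom k V S a c ∘ₗ Linear.rightComp k _ g =
      LinearMap.llcomp k _ _ _ (thinHom k V S b c g) ∘ₗ thinHom k V S a b :=
    hom_ext_paths fun p => LinearMap.congr_fun (this p) g
  exact LinearMap.congr_fun this f

theorem thinHom_id (a : Q) : thinHom k V S a a (𝟙 (vtx k Q a)) = LinearMap.id := by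
  rw [← pathHom_nil, thinHom_pathHom, thinPath]

/-- The thin representation supported on `V` whose nonzero arrows are those in `S`. -/
noncomputable def thin : PathCat k Q ⥤ ModuleCat.{0} k where
  obj a := ModuleCat.of k (thinObj k V a)
  map {a b} f := ModuleCat.ofHom (thinHom k V S a b f)
  map_id a := (congrArg ModuleCat.ofHom (thinHom_id k V S a)).trans ModuleCat.ofHom_id
  map_comp {a b c} f g :=
    (congrArg ModuleCat.ofHom (thinHom_comp k V S (a := a) (b := b) (c := c) f g)).trans
      (ModuleCat.ofHom_comp _ _)

theorem thin_isLfdMod : IsLfdMod k (thin k V S) := by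
  refine ⟨⟨fun {a b} f g => ?_, fun {a b} r f => ?_⟩, fun a => ?_⟩
  · exact congrArg ModuleCat.ofHom (map_add (thinHom k V S a b) f g)
  · exact congrArg ModuleCat.ofHom (map_smul (thinHom k V S a b) r f)
  · change FiniteDimensional k (thinObj k V a)
    infer_instance

theorem thin_map_arrHom {a b : Q} (α : a ⟶ b) :
    (thin k V S).map (arrHom k Q α) = ModuleCat.ofHom (thinMap k V S α) :=
  congrArg ModuleCat.ofHom (thinHom_pathHom k V S α.toPath)

variable {k V S}

theorem thin_map_arrHom_eq_zero {a b : Q} (α : a ⟶ b) (h : ⟨a, b, α⟩ ∉ S) :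
    (thin k V S).map (arrHom k Q α) = 0 := by
  rw [thin_map_arrHom, thinMap, dif_neg (fun h' => h h'.1)]
  rfl

/-- The inclusion of a value of a thin representation in `k`. -/
noncomputable def thinVal (a : Q) : (thin k V S).obj (vtx k Q a) →ₗ[k] k :=
  (thinObj k V a).subtype

theorem thinVal_injective (a : Q) : Function.Injective (thinVal (k := k) (V := V) (S := S) a) :=
  Subtype.val_injective

theorem exists_thinVal_eq_one {a : Q} (ha : a ∈ V) :
    ∃ v : (thin k V S).obj (vtx k Q a), thinVal a v = 1 :=
  ⟨(⟨1, by simp [thinObj, ha]⟩ : thinObj k V a), rfl⟩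

theorem thin_eq_zero {a : Q} (ha : a ∉ V) (v : (thin k V S).obj (vtx k Q a)) : v = 0 := by
  have h : ∀ w : thinObj k V a, w = 0 := fun w => by
    have := w.2
    simp only [thinObj, if_neg ha, Submodule.mem_bot] at this
    exact Subtype.ext this
  exact h v

theorem thinVal_map {a b : Q} (α : a ⟶ b) (h : ⟨a, b, α⟩ ∈ S) (hb : b ∈ V)
    (v : (thin k V S).obj (vtx k Q a)) :
    thinVal b ((thin k V S).map (arrHom k Q α) v) = thinVal a v := by
  rw [thin_map_arrHom, thinMap, dif_pos ⟨h, hb⟩]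
  rfl

/-- If `V` is connected through the arrows of `S`, the endomorphisms of the thin representation
are scalars. -/
theorem thin_endomorphism {v₀ : Q} (hS : ∀ a b (α : a ⟶ b), ⟨a, b, α⟩ ∈ S → a ∈ V ∧ b ∈ V)
    (hconn : ∀ P : Q → Prop, P v₀ → (∀ a b (α : a ⟶ b), ⟨a, b, α⟩ ∈ S → (P a ↔ P b)) →
      ∀ v ∈ V, P v) (e : thin k V S ⟶ thin k V S) :
    ∃ c : k, ∀ (a : Q) (v : (thin k V S).obj (vtx k Q a)), e.app _ v = c • v := by
  have hsc : ∀ a : Q, ∃ c : k, ∀ v : (thin k V S).obj (vtx k Q a), e.app _ v = c • v := by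
    intro a
    by_cases ha : a ∈ V
    · obtain ⟨w, hw⟩ := exists_thinVal_eq_one (k := k) (S := S) ha
      have hspan : ∀ v : (thin k V S).obj (vtx k Q a), v = thinVal a v • w := fun v =>
        thinVal_injective a (by rw [map_smul, hw, smul_eq_mul, mul_one])
      refine ⟨thinVal a (e.app _ w), fun v => ?_⟩
      rw [hspan (e.app _ v)]
      conv_rhs => rw [hspan v]
      conv_lhs => rw [hspan v, map_smul, map_smul]
      simp only [smul_smul, smul_eq_mul, mul_comm]
    · exact ⟨0, fun v => by rw [thin_eq_zero ha v, map_zero, smul_zero]⟩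
  choose c hc using hsc
  have hedge : ∀ a b (α : a ⟶ b), ⟨a, b, α⟩ ∈ S → c a = c b := fun a b α hα => by
    obtain ⟨w, hw⟩ := exists_thinVal_eq_one (k := k) (S := S) (hS a b α hα).1
    have h1 := congrArg (thinVal b) (naturality_elem e (arrHom k Q α) w)
    rw [hc, thinVal_map α hα (hS a b α hα).2, map_smul, thinVal_map α hα (hS a b α hα).2, hc,
      map_smul, hw] at h1
    simpa using h1.symm
  have hall := hconn (fun a => c a = c v₀) rfl fun a b α hα => by rw [hedge a b α hα]
  refine ⟨c v₀, fun a v => ?_⟩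
  by_cases ha : a ∈ V
  · rw [hc, hall a ha]
  · rw [thin_eq_zero ha v, map_zero, smul_zero]

theorem indec_of_idempotent {A : Type} [Category.{0} A] [Preadditive A]
    [CategoryTheory.Linear k A] {M : A ⥤ ModuleCat.{0} k} (hM : ¬ IsZero M)
    (h : ∀ e : M ⟶ M, e ≫ e = e → e = 0 ∨ e = 𝟙 M) : Indec k M := by
  refine ⟨hM, fun X Y _ _ φ => ?_⟩
  have key : ∀ (Z : A ⥤ ModuleCat.{0} k) (i : Z ⟶ M) (q : M ⟶ Z), i ≫ q = 𝟙 Z →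
      q ≫ i = 0 → IsZero Z := fun Z i q hiq hqi => by
    rw [IsZero.iff_id_eq_zero, ← Category.id_comp (𝟙 Z), ← hiq, Category.assoc,
      ← Category.assoc q, hqi, zero_comp, comp_zero]
  have hX : (biprod.inl ≫ φ.inv) ≫ (φ.hom ≫ biprod.fst) = 𝟙 X := by simp
  have hY : (biprod.inr ≫ φ.inv) ≫ (φ.hom ≫ biprod.snd) = 𝟙 Y := by simp
  rcases h ((φ.hom ≫ biprod.fst) ≫ (biprod.inl ≫ φ.inv)) (by simp) with h0 | h1
  · exact Or.inl (key X _ _ hX h0)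
  · refine Or.inr (key Y _ _ hY ?_)
    rw [← Category.comp_id ((φ.hom ≫ biprod.snd) ≫ (biprod.inr ≫ φ.inv)), ← h1]
    simp

theorem thin_indec {v₀ : Q} (hv₀ : v₀ ∈ V)
    (hS : ∀ a b (α : a ⟶ b), ⟨a, b, α⟩ ∈ S → a ∈ V ∧ b ∈ V)
    (hconn : ∀ P : Q → Prop, P v₀ → (∀ a b (α : a ⟶ b), ⟨a, b, α⟩ ∈ S → (P a ↔ P b)) →
      ∀ v ∈ V, P v) : Indec k (thin k V S) := by
  obtain ⟨w, hw⟩ := exists_thinVal_eq_one (k := k) (S := S) hv₀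
  refine indec_of_idempotent (fun h0 => ?_) fun e he => ?_
  · have h1 := ConcreteCategory.congr_hom
      (congrArg (fun φ => NatTrans.app φ (vtx k Q v₀)) ((IsZero.iff_id_eq_zero _).1 h0)) w
    have h2 : w = 0 := h1
    rw [h2, map_zero] at hw
    exact zero_ne_one hw
  · obtain ⟨c, hc⟩ := thin_endomorphism hS hconn e
    have hcc : c * c = c := by
      have h1 : e.app _ (e.app _ w) = e.app _ w :=
        ConcreteCategory.congr_hom (congrArg (fun φ => NatTrans.app φ (vtx k Q v₀)) he) w
      rw [hc, hc, smul_smul] at h1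
      have h2 := congrArg (thinVal v₀) h1
      rw [map_smul, map_smul, hw] at h2
      simpa using h2
    have hc' : c = 0 ∨ c = 1 := by
      rcases eq_or_ne c 0 with h | h
      · exact Or.inl h
      · exact Or.inr (mul_left_cancel₀ h (by rw [hcc, mul_one]))
    rcases hc' with rfl | rfl
    · left
      ext a v
      exact (hc a v).trans (zero_smul _ _)
    · right
      ext a v
      exact (hc a v).trans (one_smul _ _)

end Thin

theorem not_forall_thin_eq_zero {V : Set Q} {S : Set (Σ (x : Q) (y : Q), x ⟶ y)} {a : Q}
    (ha : a ∈ V) : ¬ ∀ v : (thin k V S).obj (vtx k Q a), v = 0 := fun h => by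
  obtain ⟨w, hw⟩ := exists_thinVal_eq_one (k := k) (S := S) ha
  rw [h w, map_zero] at hw
  exact zero_ne_one hw

theorem LocallyFinite.finite_sources (hQ : LocallyFinite Q) {F : Set Q} (hF : F.Finite) :
    {y | ∃ z ∈ F, Nonempty (y ⟶ z)}.Finite := by
  have : ∀ z, {y : Q | Nonempty (y ⟶ z)}.Finite := fun z => by
    have := (hQ z).2
    exact (Set.finite_range (Sigma.fst : (Σ y : Q, y ⟶ z) → Q)).subset fun y ⟨γ⟩ => ⟨⟨y, γ⟩, rfl⟩
  exact (hF.biUnion fun z _ => this z).subset fun y ⟨z, hz, hy⟩ => Set.mem_biUnion hz hy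

theorem LocallyFinite.finite_targets (hQ : LocallyFinite Q) {F : Set Q} (hF : F.Finite) :
    {y | ∃ z ∈ F, Nonempty (z ⟶ y)}.Finite := by
  have : ∀ z, {y : Q | Nonempty (z ⟶ y)}.Finite := fun z => by
    have := (hQ z).1
    exact (Set.finite_range (Sigma.fst : (Σ y : Q, z ⟶ y) → Q)).subset fun y ⟨γ⟩ => ⟨⟨y, γ⟩, rfl⟩
  exact (hF.biUnion fun z _ => this z).subset fun y ⟨z, hz, hy⟩ => Set.mem_biUnion hz hy

theorem LocallyFinite.degree_le_two (hQ : LocallyFinite Q) {a : Q} (s : Σ y : Q, a ⟶ y)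
    (t : Σ y : Q, y ⟶ a) (hs : ∀ s', s' = s) (ht : ∀ t', t' = t) : degree Q a ≤ 2 := by
  have := (hQ a).1
  have := (hQ a).2
  have h1 : Subsingleton (Σ y : Q, a ⟶ y) := ⟨fun u v => (hs u).trans (hs v).symm⟩
  have h2 : Subsingleton (Σ y : Q, y ⟶ a) := ⟨fun u v => (ht u).trans (ht v).symm⟩
  rw [degree, Nat.card_sum]
  exact Nat.add_le_add (Finite.card_le_one_iff_subsingleton.2 h1)
    (Finite.card_le_one_iff_subsingleton.2 h2)

theorem infinite_branches_of_ray (hQ : LocallyFinite Q) {x : ℕ → Q} (p : ∀ n, x n ⟶ x (n + 1))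
    (hx : Function.Injective x) (hdeg : {n | 3 ≤ degree Q (x n)}.Infinite) :
    {n | ∃ β : Σ z : Q, x n ⟶ z, β ≠ ⟨x (n + 1), p n⟩}.Infinite ∨
      {n | ∃ y ∉ Set.range x, Nonempty (y ⟶ x n)}.Infinite := by
  by_contra! h
  obtain ⟨h1, h2⟩ := h
  have h3 := (hQ.finite_targets (h1.image x)).preimage (f := x) hx.injOn
  obtain ⟨n, hn, hn'⟩ := hdeg.exists_notMem_finite (((Set.finite_singleton 0).union h1).union
    (h2.union h3))
  simp only [Set.mem_union, Set.mem_singleton_iff, not_or] at hn'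
  obtain ⟨⟨hn0, hn1⟩, hn2, hn3⟩ := hn'
  obtain ⟨m, rfl⟩ := Nat.exists_eq_succ_of_ne_zero hn0
  refine absurd (hQ.degree_le_two ⟨_, p (m + 1)⟩ ⟨_, p m⟩
    (fun β => by_contra fun h => hn1 ⟨β, h⟩) ?_) (not_le.2 hn)
  rintro ⟨y, γ⟩
  obtain ⟨l, rfl⟩ : y ∈ Set.range x := by_contra fun h => hn2 ⟨y, h, ⟨γ⟩⟩
  have hl : (⟨_, γ⟩ : Σ z : Q, x l ⟶ z) = ⟨x (l + 1), p l⟩ :=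
    by_contra fun h => hn3 ⟨x l, ⟨l, ⟨_, h⟩, rfl⟩, ⟨γ⟩⟩
  obtain rfl : m = l := Nat.succ_injective (hx (congrArg Sigma.fst hl))
  rw [eq_of_heq (Sigma.mk.inj hl).2]

theorem infinite_branches_of_coray (hQ : LocallyFinite Q) {x : ℕ → Q} (p : ∀ n, x (n + 1) ⟶ x n)
    (hx : Function.Injective x) (hdeg : {n | 3 ≤ degree Q (x n)}.Infinite) :
    {n | ∃ β : Σ z : Q, z ⟶ x n, β ≠ ⟨x (n + 1), p n⟩}.Infinite ∨
      {n | ∃ y ∉ Set.range x, Nonempty (x n ⟶ y)}.Infinite := by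
  by_contra! h
  obtain ⟨h1, h2⟩ := h
  have h3 := (hQ.finite_sources (h1.image x)).preimage (f := x) hx.injOn
  obtain ⟨n, hn, hn'⟩ := hdeg.exists_notMem_finite (((Set.finite_singleton 0).union h1).union
    (h2.union h3))
  simp only [Set.mem_union, Set.mem_singleton_iff, not_or] at hn'
  obtain ⟨⟨hn0, hn1⟩, hn2, hn3⟩ := hn'
  obtain ⟨m, rfl⟩ := Nat.exists_eq_succ_of_ne_zero hn0
  refine absurd (hQ.degree_le_two ⟨_, p m⟩ ⟨_, p (m + 1)⟩ ?_
    (fun β => by_contra fun h => hn1 ⟨β, h⟩)) (not_le.2 hn)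
  rintro ⟨y, γ⟩
  obtain ⟨l, rfl⟩ : y ∈ Set.range x := by_contra fun h => hn2 ⟨y, h, ⟨γ⟩⟩
  have hl : (⟨_, γ⟩ : Σ z : Q, z ⟶ x l) = ⟨x (l + 1), p l⟩ :=
    by_contra fun h => hn3 ⟨x l, ⟨l, ⟨_, h⟩, rfl⟩, ⟨γ⟩⟩
  obtain rfl : m = l := Nat.succ_injective (hx (congrArg Sigma.fst hl))
  rw [eq_of_heq (Sigma.mk.inj hl).2]

theorem exists_of_ray (hQ : StronglyLocallyFinite Q) {x : ℕ → Q} (p : ∀ n, x n ⟶ x (n + 1))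
    (hx : Function.Injective x) (hdeg : {n | 3 ≤ degree Q (x n)}.Infinite) :
    ∃ E : PathCat k Q ⥤ ModuleCat.{0} k, IsLfdMod k E ∧ Indec k E ∧ ¬ InRrep k Q E := by
  rcases infinite_branches_of_ray hQ.1 p hx hdeg with hinf | hinf
  · refine ⟨thin k (Set.range x) {s | ∃ n, s = ⟨x n, x (n + 1), p n⟩}, thin_isLfdMod k _ _,
      thin_indec ⟨0, rfl⟩ ?_ ?_, fun hE => ?_⟩
    · rintro a b α ⟨n, h⟩
      cases h
      exact ⟨⟨n, rfl⟩, ⟨n + 1, rfl⟩⟩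
    · rintro P h0 h _ ⟨n, rfl⟩
      induction n with
      | zero => exact h0
      | succ n ih => exact (h _ _ (p n) ⟨n, rfl⟩).1 ih
    · obtain ⟨L, N, -, hNm, hL, hN, hmap, hobj⟩ := hE.exists_extension (thin_isLfdMod k _ _).1
      obtain ⟨m, hm⟩ := hN.isFCG.eventually_zero hQ.2 hNm p
      obtain ⟨F, hF, hFL⟩ := hL.finite_exceptions
      obtain ⟨n, ⟨⟨z, β⟩, hβ⟩, hn⟩ := hinf.exists_notMem_finite ((Set.finite_lt_nat m).union
        ((hQ.1.finite_sources hF).preimage (f := x) hx.injOn))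
      simp only [Set.mem_union, not_or] at hn
      refine not_forall_thin_eq_zero (Set.mem_range_self n) (hobj _ (hFL (x n) z β
        (fun hz => hn.2 ⟨z, hz, ⟨β⟩⟩) (hmap _ _ _ (thin_map_arrHom_eq_zero β ?_)).1)
        (hm n (not_lt.1 hn.1)))
      rintro ⟨l, hl⟩
      obtain rfl := hx (congrArg Sigma.fst hl)
      exact hβ (eq_of_heq (Sigma.mk.inj hl).2)
  · have hY : {y | y ∉ Set.range x ∧ ∃ n, Nonempty (y ⟶ x n)}.Infinite := fun hfin => hinf <|
      ((hQ.1.finite_targets hfin).preimage (f := x) hx.injOn).subset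
        fun n ⟨y, hy, hyn⟩ => ⟨y, ⟨hy, n, hyn⟩, hyn⟩
    set Y := {y | y ∉ Set.range x ∧ ∃ n, Nonempty (y ⟶ x n)}
    refine ⟨thin k (Set.range x ∪ Y) {s | (∃ n, s = ⟨x n, x (n + 1), p n⟩) ∨
      (s.1 ∈ Y ∧ s.2.1 ∈ Set.range x)}, thin_isLfdMod k _ _,
      thin_indec (Or.inl ⟨0, rfl⟩) ?_ ?_, fun hE => ?_⟩
    · rintro a b α (⟨n, h⟩ | ⟨ha, hb⟩)
      · cases h
        exact ⟨Or.inl ⟨n, rfl⟩, Or.inl ⟨n + 1, rfl⟩⟩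
      · exact ⟨Or.inr ha, Or.inl hb⟩
    · intro P h0 h
      have hP : ∀ n, P (x n) := fun n => by
        induction n with
        | zero => exact h0
        | succ n ih => exact (h _ _ (p n) (Or.inl ⟨n, rfl⟩)).1 ih
      rintro v (⟨n, rfl⟩ | hv)
      · exact hP n
      · obtain ⟨n, ⟨γ⟩⟩ := hv.2
        exact (h _ _ γ (Or.inr ⟨hv, n, rfl⟩)).2 (hP n)
    · obtain ⟨L, N, hLm, hNm, hL, hN, hmap, hobj⟩ := hE.exists_extension (thin_isLfdMod k _ _).1
      obtain ⟨m, hm⟩ := hN.isFCG.eventually_zero hQ.2 hNm p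
      obtain ⟨F, hF, hFL⟩ := hL.isFG.finite_exceptions hLm
      obtain ⟨G, hG, hGN⟩ := hN.isFCG.finite_exceptions hNm
      obtain ⟨y, hy, hn⟩ := hY.exists_notMem_finite ((hF.union hG).union
        (hQ.1.finite_sources ((Set.finite_lt_nat m).image x)))
      simp only [Set.mem_union, not_or] at hn
      obtain ⟨⟨hyF, hyG⟩, hyx⟩ := hn
      refine not_forall_thin_eq_zero (Set.mem_union_right _ hy) (hobj _ (hFL y hyF fun z γ =>
        (hmap _ _ _ (thin_map_arrHom_eq_zero γ ?_)).1) (hGN y hyG fun z γ => ?_))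
      · rintro (⟨l, hl⟩ | ⟨-, hz⟩)
        · cases hl
          exact hy.1 ⟨_, rfl⟩
        · exact hy.1 hz
      · by_cases hz : z ∈ Set.range x
        · obtain ⟨l, rfl⟩ := hz
          ext v
          exact hm l (not_lt.1 fun hl => hyx ⟨x l, ⟨l, hl, rfl⟩, ⟨γ⟩⟩) _
        · refine (hmap _ _ _ (thin_map_arrHom_eq_zero γ ?_)).2
          rintro (⟨l, hl⟩ | ⟨-, hz'⟩)
          · exact hy.1 ⟨l, (congrArg Sigma.fst hl).symm⟩
          · exact hz hz'

theorem exists_of_coray (hQ : StronglyLocallyFinite Q) {x : ℕ → Q} (p : ∀ n, x (n + 1) ⟶ x n)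
    (hx : Function.Injective x) (hdeg : {n | 3 ≤ degree Q (x n)}.Infinite) :
    ∃ E : PathCat k Q ⥤ ModuleCat.{0} k, IsLfdMod k E ∧ Indec k E ∧ ¬ InRrep k Q E := by
  rcases infinite_branches_of_coray hQ.1 p hx hdeg with hinf | hinf
  · refine ⟨thin k (Set.range x) {s | ∃ n, s = ⟨x (n + 1), x n, p n⟩}, thin_isLfdMod k _ _,
      thin_indec ⟨0, rfl⟩ ?_ ?_, fun hE => ?_⟩
    · rintro a b α ⟨n, h⟩
      cases h
      exact ⟨⟨n + 1, rfl⟩, ⟨n, rfl⟩⟩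
    · rintro P h0 h _ ⟨n, rfl⟩
      induction n with
      | zero => exact h0
      | succ n ih => exact (h _ _ (p n) ⟨n, rfl⟩).2 ih
    · obtain ⟨L, N, hLm, -, hL, hN, hmap, hobj⟩ := hE.exists_extension (thin_isLfdMod k _ _).1
      obtain ⟨m, hm⟩ := hL.isFG.eventually_zero hQ.2 hLm p
      obtain ⟨F, hF, hFN⟩ := hN.finite_exceptions
      obtain ⟨n, ⟨⟨z, β⟩, hβ⟩, hn⟩ := hinf.exists_notMem_finite ((Set.finite_lt_nat m).union
        ((hQ.1.finite_targets hF).preimage (f := x) hx.injOn))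
      simp only [Set.mem_union, not_or] at hn
      refine not_forall_thin_eq_zero (Set.mem_range_self n) (hobj _ (hm n (not_lt.1 hn.1))
        (hFN (x n) z β (fun hz => hn.2 ⟨z, hz, ⟨β⟩⟩) (hmap _ _ _ (thin_map_arrHom_eq_zero β ?_)).2))
      rintro ⟨l, hl⟩
      obtain rfl : n = l := hx (congrArg (fun s => s.2.1) hl)
      cases hl
      exact hβ rfl
  · have hY : {y | y ∉ Set.range x ∧ ∃ n, Nonempty (x n ⟶ y)}.Infinite := fun hfin => hinf <|
      ((hQ.1.finite_sources hfin).preimage (f := x) hx.injOn).subset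
        fun n ⟨y, hy, hyn⟩ => ⟨y, ⟨hy, n, hyn⟩, hyn⟩
    set Y := {y | y ∉ Set.range x ∧ ∃ n, Nonempty (x n ⟶ y)}
    refine ⟨thin k (Set.range x ∪ Y) {s | (∃ n, s = ⟨x (n + 1), x n, p n⟩) ∨
      (s.1 ∈ Set.range x ∧ s.2.1 ∈ Y)}, thin_isLfdMod k _ _,
      thin_indec (Or.inl ⟨0, rfl⟩) ?_ ?_, fun hE => ?_⟩
    · rintro a b α (⟨n, h⟩ | ⟨ha, hb⟩)
      · cases h
        exact ⟨Or.inl ⟨n + 1, rfl⟩, Or.inl ⟨n, rfl⟩⟩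
      · exact ⟨Or.inl ha, Or.inr hb⟩
    · intro P h0 h
      have hP : ∀ n, P (x n) := fun n => by
        induction n with
        | zero => exact h0
        | succ n ih => exact (h _ _ (p n) (Or.inl ⟨n, rfl⟩)).2 ih
      rintro v (⟨n, rfl⟩ | hv)
      · exact hP n
      · obtain ⟨n, ⟨γ⟩⟩ := hv.2
        exact (h _ _ γ (Or.inr ⟨⟨n, rfl⟩, hv⟩)).1 (hP n)
    · obtain ⟨L, N, hLm, hNm, hL, hN, hmap, hobj⟩ := hE.exists_extension (thin_isLfdMod k _ _).1
      obtain ⟨m, hm⟩ := hL.isFG.eventually_zero hQ.2 hLm p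
      obtain ⟨F, hF, hFL⟩ := hL.isFG.finite_exceptions hLm
      obtain ⟨G, hG, hGN⟩ := hN.isFCG.finite_exceptions hNm
      obtain ⟨y, hy, hn⟩ := hY.exists_notMem_finite ((hF.union hG).union
        (hQ.1.finite_targets ((Set.finite_lt_nat m).image x)))
      simp only [Set.mem_union, not_or] at hn
      obtain ⟨⟨hyF, hyG⟩, hyx⟩ := hn
      refine not_forall_thin_eq_zero (Set.mem_union_right _ hy) (hobj _ (hFL y hyF fun z γ => ?_)
        (hGN y hyG fun z γ => (hmap _ _ _ (thin_map_arrHom_eq_zero γ ?_)).2))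
      · by_cases hz : z ∈ Set.range x
        · obtain ⟨l, rfl⟩ := hz
          ext v
          rw [hm l (not_lt.1 fun hl => hyx ⟨x l, ⟨l, hl, rfl⟩, ⟨γ⟩⟩) v, map_zero, map_zero]
        · refine (hmap _ _ _ (thin_map_arrHom_eq_zero γ ?_)).1
          rintro (⟨l, hl⟩ | ⟨hz', -⟩)
          · exact hz ⟨l + 1, (congrArg Sigma.fst hl).symm⟩
          · exact hz hz'
      · rintro (⟨l, hl⟩ | ⟨hz, -⟩)
        · exact hy.1 ⟨l + 1, (congrArg Sigma.fst hl).symm⟩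
        · exact hy.1 hz

end Helpers

variable (k : Type) [Field k] [IsAlgClosed k]
variable (Q : Type) [Quiver.{0} Q]

/-- If `Q` has an infinite sourced path or an infinite sinked path infinitely many of
whose vertices have degree at least three in `Q`, then there is an indecomposable
representation in `rep(Q)` not lying in `rrep(Q)`. -/
theorem statement_18 (hQ : StronglyLocallyFinite Q)
    (hp : (∃ (x : ℕ → Q) (_ : ∀ n : ℕ, x n ⟶ x (n + 1)),
            Function.Injective x ∧ {n : ℕ | 3 ≤ degree Q (x n)}.Infinite) ∨
          (∃ (x : ℕ → Q) (_ : ∀ n : ℕ, x (n + 1) ⟶ x n),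
            Function.Injective x ∧ {n : ℕ | 3 ≤ degree Q (x n)}.Infinite)) :
    ∃ E : PathCat k Q ⥤ ModuleCat.{0} k, IsLfdMod k E ∧ Indec k E ∧ ¬ InRrep k Q E := by
  rcases hp with ⟨x, p, hx, hdeg⟩ | ⟨x, p, hx, hdeg⟩
  · exact exists_of_ray hQ p hx hdeg
  · exact exists_of_coray hQ p hx hdeg

end Paper
end
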